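/- arXiv:2203.10235 — 5 statements merged into one kernel-verified Lean document; each statement's English description precedes it below -/
import Mathlib

section
/- There exists a constant N such that for every binary quartic form F(U,V) = aU⁴ + bU³V + cU²V² + dUV³ + eV⁴ with integer coefficients which is irreducible over ℚ and whose discriminant D(F) is negative with |D(F)| ≥ N, the number of pairs (u,v) ∈ ℤ² with F(u,v) = ±1, counted up to the identification of (u,v) with (−u,−v), is at most 14. -/
/-- The value of the binary quartic form `aU⁴ + bU³V + cU²V² + dUV³ + eV⁴` at a pair. -/
def quarticFormVal (a b c d e : ℤ) (p : ℤ × ℤ) : ℤ :=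
  a * p.1 ^ 4 + b * p.1 ^ 3 * p.2 + c * p.1 ^ 2 * p.2 ^ 2 + d * p.1 * p.2 ^ 3 +
    e * p.2 ^ 4

/-- Solutions of the Thue equation `F(U,V) = ±1`. -/
abbrev QuarticThueSol (a b c d e : ℤ) : Type :=
  {p : ℤ × ℤ // quarticFormVal a b c d e p = 1 ∨ quarticFormVal a b c d e p = -1}

/-- Identification of a solution `(u,v)` with `(-u,-v)`. -/
def pmRelQuartic (a b c d e : ℤ) (p q : QuarticThueSol a b c d e) : Prop :=
  (p : ℤ × ℤ) = (q : ℤ × ℤ) ∨ (p : ℤ × ℤ) = -(q : ℤ × ℤ)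

/-- The discriminant of the binary quartic form `aU⁴ + bU³V + cU²V² + dUV³ + eV⁴`. -/
def quarticDisc (a b c d e : ℤ) : ℤ :=
  256 * a ^ 3 * e ^ 3 - 192 * a ^ 2 * b * d * e ^ 2 - 128 * a ^ 2 * c ^ 2 * e ^ 2 +
    144 * a ^ 2 * c * d ^ 2 * e - 27 * a ^ 2 * d ^ 4 + 144 * a * b ^ 2 * c * e ^ 2 -
    6 * a * b ^ 2 * d ^ 2 * e - 80 * a * b * c ^ 2 * d * e + 18 * a * b * c * d ^ 3 +
    16 * a * c ^ 4 * e - 4 * a * c ^ 3 * d ^ 2 - 27 * b ^ 4 * e ^ 2 +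
    18 * b ^ 3 * c * d * e - 4 * b ^ 3 * d ^ 3 - 4 * b ^ 2 * c ^ 3 * e +
    b ^ 2 * c ^ 2 * d ^ 2

section

open Polynomial

theorem exists_ne_forall_abs_sub_le {ι κ : Type*} [Fintype ι] [Fintype κ] [DecidableEq κ]
    (v : ι → κ → ℝ) (R : κ → ℝ) (K : κ → ℕ) (hK : ∀ k, 0 < K k) (hR : ∀ k, 0 < R k)
    (hv : ∀ i k, |v i k| ≤ R k) (hcard : ∏ k, K k < Fintype.card ι) :
    ∃ i i', i ≠ i' ∧ ∀ k, |v i k - v i' k| ≤ 2 * R k / K k := by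
  classical
  let box : ι → ∀ k, Fin (K k) := fun i k =>
    ⟨min ⌊(v i k + R k) / (2 * R k / K k)⌋₊ (K k - 1), by have := hK k; omega⟩
  have hlt : Fintype.card (∀ k, Fin (K k)) < Fintype.card ι := by
    simpa [Fintype.card_pi] using hcard
  obtain ⟨i, i', hne, heq⟩ := Fintype.exists_ne_map_eq_of_card_lt box hlt
  refine ⟨i, i', hne, fun k => ?_⟩
  have hk : (0 : ℝ) < K k := by exact_mod_cast hK k
  have hwpos : 0 < 2 * R k / K k := by have := hR k; positivity
  set w := 2 * R k / K k with hw
  have hKw : K k * w = 2 * R k := by rw [hw]; field_simp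
  have hbox : ∀ l, ((box l k : ℕ) : ℝ) * w ≤ v l k + R k ∧
      v l k + R k ≤ ((box l k : ℕ) + 1) * w := by
    intro l
    have hl := abs_le.1 (hv l k)
    have h0 : 0 ≤ (v l k + R k) / w := by
      apply div_nonneg _ hwpos.le; linarith
    have h1 := Nat.floor_le h0
    have h2 := (Nat.lt_floor_add_one ((v l k + R k) / w)).le
    have hb : (box l k : ℕ) = min ⌊(v l k + R k) / w⌋₊ (K k - 1) := rfl
    rw [le_div_iff₀ hwpos] at h1
    rw [div_le_iff₀ hwpos] at h2
    constructor
    · refine le_trans ?_ h1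
      gcongr
      rw [hb]; exact min_le_left _ _
    · rcases le_total ⌊(v l k + R k) / w⌋₊ (K k - 1) with h | h
      · rw [hb, min_eq_left h]; exact h2
      · rw [hb, min_eq_right h]
        have : ((K k - 1 : ℕ) : ℝ) + 1 = K k := by
          have := hK k
          rw [Nat.cast_sub (by omega)]; simp
        rw [this, hKw]; linarith
  have e : (box i k : ℕ) = box i' k := by rw [heq]
  have a := hbox i
  have b := hbox i'
  rw [← e] at b
  rw [abs_le]; constructor <;> nlinarith

theorem norm_aeval_hasseDeriv_le {n j : ℕ} {B μ : ℝ} {P : ℤ[X]} (hP : P.natDegree < n)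
    (hc : ∀ k, |(P.coeff k : ℝ)| ≤ B) {z : ℂ} (hμ : 1 ≤ μ) (hz : ‖z‖ ≤ μ) :
    ‖aeval z (hasseDeriv j P)‖ ≤ n * 2 ^ n * B * μ ^ (n - 1 - j) := by
  have hB : 0 ≤ B := (abs_nonneg _).trans (hc 0)
  have hterm : ∀ k ∈ Finset.range n,
      ‖aeval z (hasseDeriv j (monomial k (P.coeff k)))‖ ≤ 2 ^ n * B * μ ^ (n - 1 - j) := by
    intro k hk
    rw [Finset.mem_range] at hk
    rw [hasseDeriv_monomial, aeval_monomial]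
    rcases lt_or_ge k j with h | h
    · simp [Nat.choose_eq_zero_of_lt h]; positivity
    · rw [norm_mul, norm_pow]
      have h1 : ‖(algebraMap ℤ ℂ) (↑(k.choose j) * P.coeff k)‖ ≤ 2 ^ n * B := by
        simp only [algebraMap_int_eq, map_mul, map_natCast, eq_intCast, norm_mul,
          Complex.norm_natCast, Complex.norm_intCast]
        gcongr
        · have := (Nat.choose_le_two_pow k j).trans
            (Nat.pow_le_pow_right (by norm_num) hk.le : 2 ^ k ≤ 2 ^ n)
          exact_mod_cast this
        · exact hc k
      have h2 : ‖z‖ ^ (k - j) ≤ μ ^ (n - 1 - j) :=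
        (pow_le_pow_left₀ (norm_nonneg _) hz _).trans
          (pow_le_pow_right₀ hμ (by omega))
      gcongr
  calc ‖aeval z (hasseDeriv j P)‖
      = ‖∑ k ∈ Finset.range n, aeval z (hasseDeriv j (monomial k (P.coeff k)))‖ := by
        conv_lhs => rw [P.as_sum_range' n hP]
        simp only [map_sum]
    _ ≤ ∑ k ∈ Finset.range n, 2 ^ n * B * μ ^ (n - 1 - j) :=
        (norm_sum_le _ _).trans (Finset.sum_le_sum hterm)
    _ = _ := by simp; ring

theorem dvd_of_prod_norm_aeval_lt_one {f : ℤ[X]} (hf : f.Monic)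
    (hirr : Irreducible (f.map (Int.castRingHom ℚ))) {k : ℕ} {r : Fin k → ℂ}
    (hr : f.map (Int.castRingHom ℂ) = ∏ i, (X - C (r i))) {g : ℤ[X]}
    (hg : ∏ i, ‖aeval (r i) g‖ < 1) : f ∣ g := by
  have hmon : (f.map (Int.castRingHom ℂ)).Monic := hf.map _
  have hroots : (f.map (Int.castRingHom ℂ)).roots = Finset.univ.val.map r := by
    rw [hr, Finset.prod_eq_multiset_prod]
    conv_rhs => rw [← roots_multiset_prod_X_sub_C (Finset.univ.val.map r), Multiset.map_map]
    rfl
  have hres : ((resultant f g : ℤ) : ℂ) = ∏ i, aeval (r i) g := by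
    have h1 := resultant_eq_prod_eval (f.map (Int.castRingHom ℂ)) (g.map (Int.castRingHom ℂ))
      g.natDegree natDegree_map_le (IsAlgClosed.splits _)
    rw [hmon.leadingCoeff, one_pow, one_mul, hroots, hf.natDegree_map,
      resultant_map_map] at h1
    simp only [eq_intCast] at h1
    rw [h1, Multiset.map_map]
    simp only [aeval_def, eval_map]
    rfl
  have hzero : resultant f g = 0 := by
    have : |((resultant f g : ℤ) : ℝ)| < 1 := by
      rw [← Complex.norm_intCast, hres, norm_prod]; exact hg
    have h2 : |resultant f g| < 1 := by exact_mod_cast this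
    exact Int.abs_lt_one_iff.1 h2
  rw [hzero, Int.cast_zero] at hres
  obtain ⟨i, -, hi⟩ := Finset.prod_eq_zero_iff.1 hres.symm
  have hfi : aeval (r i) f = 0 := by
    have : eval (r i) (f.map (Int.castRingHom ℂ)) = 0 := by
      rw [hr, eval_prod]
      exact Finset.prod_eq_zero (Finset.mem_univ i) (by simp)
    simpa [aeval_def, eval_map] using this
  have hdvd : f.map (Int.castRingHom ℚ) ∣ g.map (Int.castRingHom ℚ) := by
    have hmin : f.map (Int.castRingHom ℚ) = minpoly ℚ (r i) :=
      minpoly.eq_of_irreducible_of_monic hirr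
        ((aeval_map_algebraMap ℚ (r i) f).trans hfi) (hf.map _)
    rw [hmin]
    exact minpoly.dvd _ _ ((aeval_map_algebraMap ℚ (r i) g).trans hi)
  exact (map_dvd_map _ (RingHom.injective_int (Int.castRingHom ℚ)) hf).1 hdvd

theorem prod_X_sub_C_four (α₁ α₂ : ℝ) (γ : ℂ) :
    ∏ i, (X - C ((![(α₁ : ℂ), α₂, γ, (starRingEnd ℂ) γ] : Fin 4 → ℂ) i)) =
      (X - C (α₁ : ℂ)) * (X - C (α₂ : ℂ)) * (X - C γ) * (X - C ((starRingEnd ℂ) γ)) := by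
  simp [Fin.prod_univ_four]

theorem aeval_ofReal_im (α : ℝ) (g : ℤ[X]) : (aeval (α : ℂ) g).im = 0 := by
  have h : aeval (algebraMap ℝ ℂ α) g = algebraMap ℝ ℂ (aeval α g) := aeval_algebraMap_apply _ _ _
  have h' : aeval (α : ℂ) g = ((aeval α g : ℝ) : ℂ) := h
  rw [h', Complex.ofReal_im]

theorem norm_aeval_conj (z : ℂ) (g : ℤ[X]) :
    ‖aeval ((starRingEnd ℂ) z) g‖ = ‖aeval z g‖ := by
  have h : aeval ((starRingEnd ℂ) z) g = (starRingEnd ℂ) (aeval z g) := by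
    rw [aeval_def, aeval_def, hom_eval₂]
    congr 1
    ext
    simp
  rw [h, RCLike.norm_conj]

theorem norm_aeval_hasseDeriv_sub_le {n j : ℕ} {B μ : ℝ} {P Q : ℤ[X]} (hP : P.natDegree < n)
    (hQ : Q.natDegree < n) (hj : j < n) (hcP : ∀ k, |(P.coeff k : ℝ)| ≤ B)
    (hcQ : ∀ k, |(Q.coeff k : ℝ)| ≤ B) {z : ℂ} (hμ : 1 ≤ μ) (hz : ‖z‖ ≤ μ) :
    ‖aeval z (hasseDeriv j P - X * hasseDeriv j Q)‖ ≤ n * 2 ^ (n + 1) * B * μ ^ (n - j) := by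
  have hB : 0 ≤ B := (abs_nonneg _).trans (hcP 0)
  have h1 := norm_aeval_hasseDeriv_le hP hcP hμ hz (j := j)
  have h2 := norm_aeval_hasseDeriv_le hQ hcQ hμ hz (j := j)
  have e : μ ^ (n - j) = μ * μ ^ (n - 1 - j) := by
    rw [← pow_succ']; congr 1; omega
  rw [map_sub, map_mul, aeval_X]
  calc _ ≤ ‖aeval z (hasseDeriv j P)‖ + ‖z‖ * ‖aeval z (hasseDeriv j Q)‖ := by
        rw [← norm_mul]; exact norm_sub_le _ _
    _ ≤ μ * (n * 2 ^ n * B * μ ^ (n - 1 - j)) + μ * (n * 2 ^ n * B * μ ^ (n - 1 - j)) := by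
        gcongr
        refine h1.trans (le_mul_of_one_le_left (by positivity) hμ)
    _ = _ := by rw [e]; ring

theorem exists_pair_dvd_hasseDeriv {f : ℤ[X]} (hf : f.Monic)
    (hirr : Irreducible (f.map (Int.castRingHom ℚ))) {α₁ α₂ : ℝ} {γ : ℂ}
    (hr : f.map (Int.castRingHom ℂ) =
      (X - C (α₁ : ℂ)) * (X - C (α₂ : ℂ)) * (X - C γ) * (X - C ((starRingEnd ℂ) γ)))
    {m s n : ℕ} (hn : n = 2 * m + s) (hm : 0 < m) {l : ℝ} (hl : 0 ≤ l)
    (hM : max 1 |α₁| * max 1 |α₂| * max 1 ‖γ‖ ^ 2 ≤ Real.exp l) {B : ℕ} (hB : 1 ≤ B)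
    (hBs : (8 * n * 2 ^ (n + 1) : ℝ) ^ (4 * m) *
      Real.exp (l * ∑ j : Fin m, ((n - j : ℕ) : ℝ)) ≤ (B : ℝ) ^ (2 * s)) :
    ∃ P Q : ℤ[X], (P ≠ 0 ∨ Q ≠ 0) ∧ P.natDegree < n ∧ Q.natDegree < n ∧
      (∀ k, |(P.coeff k : ℝ)| ≤ B) ∧ (∀ k, |(Q.coeff k : ℝ)| ≤ B) ∧
      ∀ j < m, f ∣ hasseDeriv j P - X * hasseDeriv j Q := by
  have hn0 : 0 < n := by omega
  have hn1 : (1 : ℝ) ≤ n := by exact_mod_cast hn0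
  have hB1 : (1 : ℝ) ≤ B := by exact_mod_cast hB
  let poly : (Fin n → Fin (B + 1)) → ℤ[X] := fun c => ∑ k : Fin n, monomial k ((c k : ℕ) : ℤ)
  have hcoeff : ∀ c k, (poly c).coeff k = if h : k < n then ((c ⟨k, h⟩ : ℕ) : ℤ) else 0 := by
    intro c k
    simp only [poly, finsetSum_coeff, coeff_monomial]
    split_ifs with h
    · rw [Finset.sum_eq_single ⟨k, h⟩]
      · simp
      · intro b _ hb
        rw [if_neg]; rintro rfl; exact hb rfl
      · simp
    · apply Finset.sum_eq_zero
      intro b _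
      rw [if_neg]; rintro rfl; exact h b.2
  have hdeg : ∀ p : ℤ[X], (∀ k, n ≤ k → p.coeff k = 0) → p.natDegree < n := fun p hp => by
    have : p.natDegree ≤ n - 1 := natDegree_le_iff_coeff_eq_zero.2 fun k hk => hp k (by omega)
    omega
  have hpn : ∀ c, (poly c).natDegree < n := fun c => hdeg _ fun k hk => by
    rw [hcoeff, dif_neg (by omega)]
  have hpc : ∀ c k, (0 : ℝ) ≤ ((poly c).coeff k : ℝ) ∧ ((poly c).coeff k : ℝ) ≤ B := by
    intro c k
    rw [hcoeff]
    split_ifs with h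
    · have := (c ⟨k, h⟩).2
      constructor
      · positivity
      · have h2 : ((c ⟨k, h⟩ : ℕ) : ℝ) ≤ B := by exact_mod_cast (by omega)
        simpa using h2
    · simp
  have hpa : ∀ c k, |((poly c).coeff k : ℝ)| ≤ B := fun c k => by
    rw [abs_of_nonneg (hpc c k).1]; exact (hpc c k).2
  let L : ℕ → ℤ[X] → ℤ[X] → ℤ[X] := fun j P Q => hasseDeriv j P - X * hasseDeriv j Q
  let μ : Fin 4 → ℝ := ![max 1 |α₁|, max 1 |α₂|, max 1 ‖γ‖, max 1 ‖γ‖]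
  let ev : Fin 4 → ℤ[X] → ℝ := fun i g =>
    ![(aeval (α₁ : ℂ) g).re, (aeval (α₂ : ℂ) g).re, (aeval γ g).re, (aeval γ g).im] i
  have hμ1 : ∀ i, 1 ≤ μ i := by
    intro i; fin_cases i <;> simp [μ]
  let R : Fin m × Fin 4 → ℝ := fun k => n * 2 ^ (n + 1) * B * μ k.2 ^ (n - k.1)
  let T : Fin m → ℝ := fun j => 4 * n * 2 ^ (n + 1) * B * Real.exp (l * ((n - j : ℕ) : ℝ) / 4)
  let K : Fin m × Fin 4 → ℕ := fun k => ⌈T k.1⌉₊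
  have hT1 : ∀ j, 1 ≤ T j := by
    intro j
    have h1 : (1 : ℝ) ≤ Real.exp (l * ((n - j : ℕ) : ℝ) / 4) := Real.one_le_exp (by positivity)
    have h2 : (1 : ℝ) ≤ 2 ^ (n + 1) := one_le_pow₀ (by norm_num)
    calc (1 : ℝ) ≤ 4 * 1 * 1 * 1 * 1 := by norm_num
      _ ≤ T j := by simp only [T]; gcongr
  have hTK : ∀ k, T k.1 ≤ K k := fun k => Nat.le_ceil _
  have hKT : ∀ k, (K k : ℝ) ≤ 2 * T k.1 := fun k => by
    have := Nat.ceil_lt_add_one (zero_le_one.trans (hT1 k.1))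
    have := hT1 k.1
    simp only [K]; linarith
  have hev : ∀ c c' : Fin n → Fin (B + 1), ∀ k : Fin m × Fin 4,
      |ev k.2 (L k.1 (poly c) (poly c'))| ≤ R k := by
    rintro c c' ⟨j, i⟩
    have hj : (j : ℕ) < n := by have := j.2; omega
    have key : ∀ z : ℂ, ‖aeval z (L j (poly c) (poly c'))‖ ≤
        n * 2 ^ (n + 1) * B * (max 1 ‖z‖) ^ (n - j) := fun z =>
      norm_aeval_hasseDeriv_sub_le (hpn c) (hpn c') hj (hpa c) (hpa c')
        (le_max_left _ _) (le_max_right _ _)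
    have k1 := key α₁
    have k2 := key α₂
    rw [Complex.norm_real, Real.norm_eq_abs] at k1 k2
    fin_cases i
    · exact (Complex.abs_re_le_norm _).trans k1
    · exact (Complex.abs_re_le_norm _).trans k2
    · exact (Complex.abs_re_le_norm _).trans (key γ)
    · exact (Complex.abs_im_le_norm _).trans (key γ)
  have hcard : ∏ k, K k < Fintype.card ((Fin n → Fin (B + 1)) × (Fin n → Fin (B + 1))) := by
    have hc : (Fintype.card ((Fin n → Fin (B + 1)) × (Fin n → Fin (B + 1)))) =
        (B + 1) ^ (2 * n) := by
      simp [Fintype.card_prod]; ring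
    rw [hc]
    have : (∏ k, (K k : ℝ)) < ((B : ℝ) + 1) ^ (2 * n) := by
      calc ∏ k, (K k : ℝ) ≤ ∏ k : Fin m × Fin 4, 2 * T k.1 :=
            Finset.prod_le_prod (fun _ _ => by positivity) fun k _ => hKT k
        _ = ∏ j : Fin m, (2 * T j) ^ 4 := by
            rw [Fintype.prod_prod_type]; simp
        _ = ∏ j : Fin m, ((8 * n * 2 ^ (n + 1)) ^ 4 * B ^ 4 *
              Real.exp (l * ((n - j : ℕ) : ℝ))) := by
            refine Finset.prod_congr rfl fun j _ => ?_
            have : Real.exp (l * ((n - j : ℕ) : ℝ)) =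
                Real.exp (l * ((n - j : ℕ) : ℝ) / 4) ^ 4 := by
              rw [← Real.exp_nat_mul]; congr 1; push_cast; ring
            rw [this]; simp only [T]; ring
        _ = (8 * n * 2 ^ (n + 1)) ^ (4 * m) * Real.exp (l * ∑ j : Fin m, ((n - j : ℕ) : ℝ)) *
              B ^ (4 * m) := by
            rw [Finset.prod_mul_distrib, ← Real.exp_sum, Finset.mul_sum]
            simp only [Finset.prod_const, Finset.card_univ, Fintype.card_fin]
            rw [mul_pow, ← pow_mul, ← pow_mul]; ring
        _ ≤ (B : ℝ) ^ (2 * s) * B ^ (4 * m) := by gcongr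
        _ = (B : ℝ) ^ (2 * n) := by rw [← pow_add]; congr 1; omega
        _ < ((B : ℝ) + 1) ^ (2 * n) := by
            apply pow_lt_pow_left₀ (by linarith) (by linarith) (by omega)
    exact_mod_cast this
  obtain ⟨⟨c, d⟩, ⟨c', d'⟩, hne, hclose⟩ := exists_ne_forall_abs_sub_le
    (fun (i : (Fin n → Fin (B + 1)) × (Fin n → Fin (B + 1))) (k : Fin m × Fin 4) =>
      ev k.2 (L k.1 (poly i.1) (poly i.2))) R K
    (fun k => by
      have h1 := hTK k
      have h2 := hT1 k.1
      have : (0 : ℝ) < K k := by linarith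
      exact_mod_cast this)
    (fun k => by have := hμ1 k.2; simp only [R]; positivity) (fun i k => hev i.1 i.2 k) hcard
  have hbound : ∀ c c' k, |((poly c - poly c').coeff k : ℝ)| ≤ B := by
    intro c c' k
    rw [coeff_sub, Int.cast_sub, abs_le]
    have := hpc c k
    have := hpc c' k
    constructor <;> linarith
  have hinj : ∀ c c', poly c - poly c' = 0 → c = c' := by
    intro c c' h
    funext k
    have h1 := congrArg (fun p => coeff p k) (sub_eq_zero.1 h)
    simp only [hcoeff, dif_pos k.2] at h1
    ext
    exact_mod_cast h1
  refine ⟨poly c - poly c', poly d - poly d', ?_, ?_, ?_, hbound _ _, hbound _ _, ?_⟩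
  · by_contra! h
    exact hne (Prod.ext (hinj _ _ h.1) (hinj _ _ h.2))
  · exact (natDegree_sub_le _ _).trans_lt (max_lt (hpn _) (hpn _))
  · exact (natDegree_sub_le _ _).trans_lt (max_lt (hpn _) (hpn _))
  intro j hj
  have hj' : j < n := by omega
  rw [← prod_X_sub_C_four] at hr
  apply dvd_of_prod_norm_aeval_lt_one hf hirr hr
  set g := hasseDeriv j (poly c - poly c') - X * hasseDeriv j (poly d - poly d') with hg
  have hgL : g = L j (poly c) (poly d) - L j (poly c') (poly d') := by
    simp only [hg, L, map_sub]; ring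
  have hevg : ∀ i, |ev i g| ≤
      1 / 2 * (μ i ^ (n - j) * Real.exp (-(l * ((n - j : ℕ) : ℝ) / 4))) := by
    intro i
    have h1 := hclose (⟨j, hj⟩, i)
    have h2 : ev i g = ev i (L j (poly c) (poly d)) - ev i (L j (poly c') (poly d')) := by
      rw [hgL]; fin_cases i <;> simp [ev]
    rw [h2]
    refine h1.trans ?_
    have h3 := hTK (⟨j, hj⟩, i)
    have h4 := hT1 ⟨j, hj⟩
    have hμ := hμ1 i
    calc 2 * R (⟨j, hj⟩, i) / K (⟨j, hj⟩, i) ≤ 2 * R (⟨j, hj⟩, i) / T ⟨j, hj⟩ := by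
          apply div_le_div_of_nonneg_left _ (by linarith) h3
          simp only [R]; positivity
      _ = _ := by
          simp only [R, T]
          rw [Real.exp_neg]
          field_simp
          ring
  set E := Real.exp (-(l * ((n - j : ℕ) : ℝ) / 4)) with hE
  have hE4 : E ^ 4 * Real.exp l ^ (n - j) = 1 := by
    rw [hE, ← Real.exp_nat_mul, ← Real.exp_nat_mul, ← Real.exp_add, Real.exp_eq_one_iff]
    push_cast; ring
  have n1 : ‖aeval (α₁ : ℂ) g‖ ≤ 1 / 2 * ((max 1 |α₁|) ^ (n - j) * E) := by
    have := hevg 0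
    refine (Complex.norm_le_abs_re_add_abs_im _).trans ?_
    rw [aeval_ofReal_im, abs_zero, add_zero]; exact this
  have n2 : ‖aeval (α₂ : ℂ) g‖ ≤ 1 / 2 * ((max 1 |α₂|) ^ (n - j) * E) := by
    have := hevg 1
    refine (Complex.norm_le_abs_re_add_abs_im _).trans ?_
    rw [aeval_ofReal_im, abs_zero, add_zero]; exact this
  have n3 : ‖aeval γ g‖ ≤ (max 1 ‖γ‖) ^ (n - j) * E := by
    have h1 : |(aeval γ g).re| ≤ 1 / 2 * ((max 1 ‖γ‖) ^ (n - j) * E) := hevg 2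
    have h2 : |(aeval γ g).im| ≤ 1 / 2 * ((max 1 ‖γ‖) ^ (n - j) * E) := hevg 3
    refine (Complex.norm_le_abs_re_add_abs_im _).trans ?_
    linarith
  rw [Fin.prod_univ_four]
  simp only [Matrix.cons_val]
  rw [norm_aeval_conj]
  calc _ ≤ (1 / 2 * ((max 1 |α₁|) ^ (n - j) * E)) * (1 / 2 * ((max 1 |α₂|) ^ (n - j) * E)) *
        ((max 1 ‖γ‖) ^ (n - j) * E) * ((max 1 ‖γ‖) ^ (n - j) * E) := by gcongr
    _ = 1 / 4 * (E ^ 4 * (max 1 |α₁| * max 1 |α₂| * max 1 ‖γ‖ ^ 2) ^ (n - j)) := by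
        simp only [mul_pow]; ring
    _ ≤ 1 / 4 * (E ^ 4 * Real.exp l ^ (n - j)) := by gcongr
    _ < 1 := by rw [hE4]; norm_num

theorem X_sub_C_pow_dvd_of_hasseDeriv {F : Type*} [Field F] {G : F[X]} {t : F} {m : ℕ}
    (h : ∀ j < m, eval t (hasseDeriv j G) = 0) : (X - C t) ^ m ∣ G := by
  rw [X_sub_C_pow_dvd_iff, ← taylor_apply, X_pow_dvd_iff]
  intro d hd
  rw [taylor_coeff]
  exact h d hd

theorem hasseDeriv_map {R S : Type*} [CommSemiring R] [CommSemiring S] (φ : R →+* S) (j : ℕ)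
    (P : R[X]) : hasseDeriv j (P.map φ) = (hasseDeriv j P).map φ := by
  ext k
  simp [hasseDeriv_coeff]

theorem root_ne_ratCast {f : ℤ[X]} (hirr : Irreducible (f.map (Int.castRingHom ℚ)))
    (hf : f.Monic) (hdeg : 1 < f.natDegree) {z : ℂ} (hz : aeval z f = 0) (q : ℚ) :
    z ≠ (q : ℂ) := by
  rintro rfl
  have h1 : aeval (algebraMap ℚ ℂ q) f = 0 := by simpa using hz
  rw [aeval_algebraMap_apply] at h1
  have h2 : aeval q f = 0 := by simpa using h1
  have h3 : IsRoot (f.map (Int.castRingHom ℚ)) q := by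
    rw [IsRoot, eval_map]; exact h2
  have := degree_eq_one_of_irreducible_of_root hirr h3
  have : (f.map (Int.castRingHom ℚ)).natDegree = 1 := natDegree_eq_of_degree_eq_some this
  rw [hf.natDegree_map] at this
  omega

theorem wronskian_ne_zero_of_forall_dvd {f : ℤ[X]} (hf : f.Monic)
    (hirr : Irreducible (f.map (Int.castRingHom ℚ))) (hdeg : 1 < f.natDegree)
    {k : ℕ} {r : Fin k → ℂ} (hrinj : Function.Injective r) (hr : ∀ i, aeval (r i) f = 0)
    {P Q : ℤ[X]} {m n : ℕ} (hn : n ≤ k * m) (hne : P ≠ 0 ∨ Q ≠ 0) (hP : P.natDegree < n)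
    (hQ : Q.natDegree < n) (hdvd : ∀ j < m, f ∣ hasseDeriv j P - X * hasseDeriv j Q) :
    wronskian P Q ≠ 0 := by
  classical
  intro hW
  let _ := EuclideanDomain.gcdMonoid ℚ[X]
  set P' := P.map (Int.castRingHom ℚ) with hP'
  set Q' := Q.map (Int.castRingHom ℚ) with hQ'
  have hinj := RingHom.injective_int (Int.castRingHom ℚ)
  have hne' : P' ≠ 0 ∨ Q' ≠ 0 := by
    rwa [hP', hQ', Polynomial.map_ne_zero_iff hinj, Polynomial.map_ne_zero_iff hinj]
  have hg0 : gcd P' Q' ≠ 0 := by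
    rw [Ne, gcd_eq_zero_iff]; tauto
  set G := gcd P' Q' with hG
  have hcop := isCoprime_div_gcd_div_gcd_of_gcd_ne_zero hg0
  have hp := EuclideanDomain.mul_div_cancel' hg0 (gcd_dvd_left P' Q')
  have hq := EuclideanDomain.mul_div_cancel' hg0 (gcd_dvd_right P' Q')
  set p := P' / G with hpdef
  set q := Q' / G with hqdef
  have hW' : wronskian P' Q' = 0 := by
    have := congrArg (Polynomial.map (Int.castRingHom ℚ)) hW
    simpa [wronskian, hP', hQ', derivative_map] using this
  have hW2 : G ^ 2 * wronskian p q = 0 := by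
    rw [← hW', ← hp, ← hq]
    simp only [wronskian, derivative_mul]; ring
  have hW3 := (mul_eq_zero.1 hW2).resolve_left (pow_ne_zero _ hg0)
  obtain ⟨hdp, hdq⟩ := hcop.wronskian_eq_zero_iff.1 hW3
  obtain ⟨c, hc⟩ := natDegree_eq_zero.1 (derivative_eq_zero.1 hdp)
  obtain ⟨d, hd⟩ := natDegree_eq_zero.1 (derivative_eq_zero.1 hdq)
  rw [← hc] at hp
  rw [← hd] at hq
  have hcd : c ≠ 0 ∨ d ≠ 0 := by
    by_contra! h
    rw [h.1] at hp; rw [h.2] at hq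
    simp only [map_zero, mul_zero] at hp hq
    rcases hne' with h | h
    · exact h hp.symm
    · exact h hq.symm
  set Gc := G.map (algebraMap ℚ ℂ) with hGc
  have hcomp : (algebraMap ℚ ℂ).comp (Int.castRingHom ℚ) = algebraMap ℤ ℂ := by ext; simp
  have hroot : ∀ i, (X - C (r i)) ^ m ∣ Gc := by
    intro i
    apply X_sub_C_pow_dvd_of_hasseDeriv
    intro j hj
    obtain ⟨h, hh⟩ := hdvd j hj
    have h1 : aeval (r i) (hasseDeriv j P - X * hasseDeriv j Q) = 0 := by
      rw [hh, map_mul, hr i, zero_mul]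
    have hPG : aeval (r i) (hasseDeriv j P) = c * eval (r i) (hasseDeriv j Gc) := by
      have : P.map (algebraMap ℤ ℂ) = Gc * C (c : ℂ) := by
        rw [← hcomp, ← map_map, ← hP', ← hp, Polynomial.map_mul, map_C]; rfl
      rw [aeval_def, ← eval_map, ← hasseDeriv_map, this, mul_comm, ← smul_eq_C_mul, map_smul,
        eval_smul, smul_eq_mul]
    have hQG : aeval (r i) (hasseDeriv j Q) = d * eval (r i) (hasseDeriv j Gc) := by
      have : Q.map (algebraMap ℤ ℂ) = Gc * C (d : ℂ) := by
        rw [← hcomp, ← map_map, ← hQ', ← hq, Polynomial.map_mul, map_C]; rfl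
      rw [aeval_def, ← eval_map, ← hasseDeriv_map, this, mul_comm, ← smul_eq_C_mul, map_smul,
        eval_smul, smul_eq_mul]
    rw [map_sub, map_mul, aeval_X, hPG, hQG] at h1
    have h2 : ((c : ℂ) - r i * d) * eval (r i) (hasseDeriv j Gc) = 0 := by
      rw [← h1]; ring
    refine (mul_eq_zero.1 h2).resolve_left fun h3 => ?_
    by_cases hd0 : d = 0
    · rw [hd0] at h3
      simp only [Rat.cast_zero, mul_zero, sub_zero, Rat.cast_eq_zero] at h3
      tauto
    · apply root_ne_ratCast hirr hf hdeg (hr i) (c / d)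
      have : (d : ℂ) ≠ 0 := by exact_mod_cast hd0
      rw [Rat.cast_div, eq_div_iff this]
      linear_combination -h3
  have hall : ∏ i, (X - C (r i)) ^ m ∣ Gc := by
    apply Fintype.prod_dvd_of_coprime _ hroot
    intro i j hij
    exact (pairwise_coprime_X_sub_C hrinj hij).pow
  have hGc0 : Gc ≠ 0 := by
    rw [hGc]; exact (Polynomial.map_ne_zero_iff (algebraMap ℚ ℂ).injective).2 hg0
  have hle := natDegree_le_of_dvd hall hGc0
  rw [natDegree_prod_of_monic _ _ (fun i _ => (monic_X_sub_C _).pow _)] at hle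
  simp only [natDegree_pow, natDegree_X_sub_C, mul_one, Finset.sum_const, Finset.card_univ,
    Fintype.card_fin, smul_eq_mul] at hle
  have hGn : Gc.natDegree < n := by
    rw [hGc, natDegree_map]
    rcases hcd with h | h
    · have h5 : P'.natDegree = G.natDegree := by
        rw [← hp, mul_comm, natDegree_C_mul h]
      rw [← h5]; exact natDegree_map_le.trans_lt hP
    · have h5 : Q'.natDegree = G.natDegree := by
        rw [← hq, mul_comm, natDegree_C_mul h]
      rw [← h5]; exact natDegree_map_le.trans_lt hQ
  omega

theorem abs_coeff_wronskian_le {P Q : ℤ[X]} {n : ℕ} {B : ℝ} (hP : P.natDegree < n)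
    (hQ : Q.natDegree < n) (hcP : ∀ k, |(P.coeff k : ℝ)| ≤ B)
    (hcQ : ∀ k, |(Q.coeff k : ℝ)| ≤ B) (k : ℕ) :
    |((wronskian P Q).coeff k : ℝ)| ≤ 4 * n ^ 2 * B ^ 2 := by
  have hB : 0 ≤ B := (abs_nonneg _).trans (hcP 0)
  have hder : ∀ R : ℤ[X], R.natDegree < n → (∀ k, |(R.coeff k : ℝ)| ≤ B) →
      ∀ k, |((derivative R).coeff k : ℝ)| ≤ n * B := by
    intro R hR hc k
    rw [coeff_derivative]
    by_cases hk : k + 1 < n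
    · push_cast
      rw [abs_mul, mul_comm]
      have : |(k : ℝ) + 1| ≤ n := by
        rw [abs_of_nonneg (by positivity)]; exact_mod_cast hk.le
      gcongr
      exact hc _
    · rw [coeff_eq_zero_of_natDegree_lt (by omega)]
      simp; positivity
  have hmul : ∀ R S : ℤ[X], R.natDegree < n → S.natDegree < n →
      (∀ k, |(R.coeff k : ℝ)| ≤ B) → (∀ k, |(S.coeff k : ℝ)| ≤ n * B) → ∀ k,
      |((R * S).coeff k : ℝ)| ≤ 2 * n ^ 2 * B ^ 2 := by
    intro R S hR hS hcR hcS k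
    by_cases hk : k + 1 ≤ 2 * n
    · rw [coeff_mul]
      push_cast
      refine (Finset.abs_sum_le_sum_abs _ _).trans ?_
      calc _ ≤ ∑ x ∈ Finset.HasAntidiagonal.antidiagonal k, B * (n * B) := by
            refine Finset.sum_le_sum fun x _ => ?_
            rw [abs_mul]
            gcongr
            exacts [hcR _, hcS _]
        _ = ((k + 1 : ℕ) : ℝ) * (n * B ^ 2) := by
            rw [Finset.sum_const, Finset.Nat.card_antidiagonal, nsmul_eq_mul]; ring
        _ ≤ ((2 * n : ℕ) : ℝ) * (n * B ^ 2) := by gcongr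
        _ = _ := by push_cast; ring
    · rw [coeff_eq_zero_of_natDegree_lt (natDegree_mul_le.trans_lt (by omega))]
      simp; positivity
  have hdd : ∀ R : ℤ[X], R.natDegree < n → (derivative R).natDegree < n := fun R hR =>
    (natDegree_derivative_le R).trans_lt (by omega)
  have h1 := hmul P (derivative Q) hP (hdd Q hQ) hcP (hder Q hQ hcQ) k
  have h2 := hmul Q (derivative P) hQ (hdd P hP) hcQ (hder P hP hcP) k
  rw [wronskian, coeff_sub, mul_comm (derivative P), Int.cast_sub]
  refine (abs_sub _ _).trans ?_
  linarith

theorem abs_pow_le_of_dvd {W : ℤ[X]} (hW : W ≠ 0) {x y : ℤ} {k : ℕ} {T : ℝ}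
    (hT : ∀ k, |(W.coeff k : ℝ)| ≤ T) (h : (C y * X - C x) ^ k ∣ W) (hy : y ≠ 0) :
    (max |(x : ℝ)| |(y : ℝ)|) ^ k ≤ T := by
  obtain ⟨H, rfl⟩ := h
  have hH : H ≠ 0 := right_ne_zero_of_mul hW
  have hint : ∀ a b : ℤ, b ≠ 0 → |(a : ℝ)| ≤ |((a * b : ℤ) : ℝ)| := by
    intro a b hb
    push_cast
    rw [abs_mul]
    have : (1 : ℝ) ≤ |(b : ℝ)| := by exact_mod_cast Int.one_le_abs hb
    exact le_mul_of_one_le_right (abs_nonneg _) this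
  have hyT : |(y : ℝ)| ^ k ≤ T := by
    have h1 : ((C y * X - C x) ^ k * H).leadingCoeff = y ^ k * H.leadingCoeff := by
      rw [leadingCoeff_mul, leadingCoeff_pow]
      congr 2
      rw [sub_eq_add_neg, ← C_neg]; exact leadingCoeff_linear hy
    have h2 := hT ((C y * X - C x) ^ k * H).natDegree
    rw [coeff_natDegree, h1] at h2
    refine le_trans ?_ h2
    have := hint (y ^ k) _ (leadingCoeff_ne_zero.2 hH)
    rwa [Int.cast_pow, abs_pow] at this
  rcases le_total |(x : ℝ)| |(y : ℝ)| with hxy | hxy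
  · rwa [max_eq_right hxy]
  · rw [max_eq_left hxy]
    have hx : x ≠ 0 := by
      rintro rfl
      apply hy
      rw [Int.cast_zero, abs_zero] at hxy
      exact_mod_cast abs_nonpos_iff.1 hxy
    have h2 := hT ((C y * X - C x) ^ k * H).natTrailingDegree
    have h3 : ((C y * X - C x) ^ k * H).coeff ((C y * X - C x) ^ k * H).natTrailingDegree =
        (-x) ^ k * H.trailingCoeff := by
      change trailingCoeff _ = _
      rw [trailingCoeff_mul]
      congr 1
      have h0 : (C y * X - C x).coeff 0 ≠ 0 := by simpa using hx
      have h5 : ((C y * X - C x) ^ k).coeff 0 = (-x) ^ k := by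
        rw [coeff_zero_eq_eval_zero]; simp
      have h4 : ((C y * X - C x) ^ k).natTrailingDegree = 0 := by
        apply natTrailingDegree_eq_zero.2
        right; rw [h5]; exact pow_ne_zero _ (neg_ne_zero.2 hx)
      rw [trailingCoeff, h4, h5]
    rw [h3] at h2
    refine le_trans ?_ h2
    have := hint ((-x) ^ k) H.trailingCoeff (by rwa [Ne, trailingCoeff_eq_zero])
    rwa [Int.cast_pow, abs_pow, Int.cast_neg, abs_neg] at this

theorem exists_hasseDeriv_ne_zero_of_wronskian {P Q : ℤ[X]} (hW : wronskian P Q ≠ 0)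
    {T : ℝ} (hT : ∀ k, |((wronskian P Q).coeff k : ℝ)| ≤ T) {x y x' y' : ℤ} (hy : 0 < y)
    (hxy : IsCoprime x y) (hy' : y' ≠ 0) :
    ∃ j : ℕ, eval ((x : ℝ) / y)
        ((hasseDeriv j (C y' * P - C x' * Q)).map (algebraMap ℤ ℝ)) ≠ 0 ∧
      (max |(x : ℝ)| |(y : ℝ)|) ^ (j - 1) ≤ T := by
  set R := C y' * P - C x' * Q with hR
  have hWR : C y' * wronskian P Q = R * derivative Q - derivative R * Q := by
    simp only [hR, wronskian, derivative_sub, derivative_mul, derivative_C]; ring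
  have hR0 : R ≠ 0 := by
    intro h
    rw [h] at hWR
    simp only [zero_mul, derivative_zero, sub_zero, mul_eq_zero, C_eq_zero] at hWR
    tauto
  set t : ℚ := (x : ℚ) / y with ht
  have hinj := RingHom.injective_int (Int.castRingHom ℚ)
  have hR0' : R.map (Int.castRingHom ℚ) ≠ 0 := (Polynomial.map_ne_zero_iff hinj).2 hR0
  obtain ⟨S, hS, hndvd⟩ := exists_eq_pow_rootMultiplicity_mul_and_not_dvd _ hR0' t
  set j := (R.map (Int.castRingHom ℚ)).rootMultiplicity t
  have hyq : (y : ℚ) ≠ 0 := by exact_mod_cast hy.ne'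
  refine ⟨j, ?_, ?_⟩
  · have h1 : eval t (hasseDeriv j (R.map (Int.castRingHom ℚ))) ≠ 0 := by
      rw [← taylor_coeff, hS, taylor_mul, taylor_pow, map_sub, taylor_X, taylor_C,
        add_sub_cancel_right, coeff_X_pow_mul', if_pos le_rfl, Nat.sub_self, taylor_coeff_zero]
      intro h
      exact hndvd (dvd_iff_isRoot.2 h)
    rw [hasseDeriv_map] at h1
    intro h2
    apply h1
    have h3 : ((x : ℝ) / y) = ((t : ℚ) : ℝ) := by rw [ht]; push_cast; rfl
    rw [h3, eval_map] at h2
    have h4 : aeval (algebraMap ℚ ℝ t) (hasseDeriv j R) = 0 := h2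
    rw [aeval_algebraMap_apply] at h4
    rw [eval_map]
    have h5 : aeval t (hasseDeriv j R) = 0 := by simpa using h4
    exact h5
  · apply abs_pow_le_of_dvd hW hT _ hy.ne'
    have hprim : (C y * X - C x : ℤ[X]).IsPrimitive := by
      rw [isPrimitive_iff_isUnit_of_C_dvd]
      intro r hr
      rw [C_dvd_iff_dvd_coeff] at hr
      have h0 := hr 0
      have h1 := hr 1
      simp only [coeff_sub, coeff_C_mul, coeff_X_zero, mul_zero, coeff_C_zero, zero_sub,
        dvd_neg] at h0
      simp only [coeff_sub, coeff_C_mul, coeff_X_one, mul_one, coeff_C_succ, sub_zero] at h1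
      exact hxy.isUnit_of_dvd' h0 h1
    have hprimpow : ((C y * X - C x : ℤ[X]) ^ (j - 1)).IsPrimitive := by
      induction j - 1 with
      | zero => rw [pow_zero]; exact isPrimitive_one
      | succ k ih => rw [pow_succ]; exact ih.mul hprim
    rw [IsPrimitive.Int.dvd_iff_map_cast_dvd_map_cast _ _ hprimpow]
    have hlin : (C y * X - C x : ℤ[X]).map (Int.castRingHom ℚ) = C (y : ℚ) * (X - C t) := by
      rw [mul_sub, ← C_mul, ht, mul_div_cancel₀ _ hyq]
      simp
    rw [Polynomial.map_pow, hlin, mul_pow, ← C_pow]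
    have hu : IsUnit (C ((y : ℚ) ^ (j - 1))) :=
      isUnit_C.2 (isUnit_iff_ne_zero.2 (pow_ne_zero _ hyq))
    rw [hu.mul_left_dvd]
    have hd1 : (X - C t) ^ j ∣ R.map (Int.castRingHom ℚ) := ⟨S, hS⟩
    have hd2 := pow_sub_one_dvd_derivative_of_pow_dvd hd1
    have hd3 : (X - C t) ^ (j - 1) ∣ R.map (Int.castRingHom ℚ) :=
      (pow_dvd_pow _ (Nat.sub_le _ _)).trans hd1
    have hWR' := congrArg (Polynomial.map (Int.castRingHom ℚ)) hWR
    rw [Polynomial.map_mul, map_C, Polynomial.map_sub, Polynomial.map_mul, Polynomial.map_mul,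
      ← derivative_map R] at hWR'
    have hu' : IsUnit (C ((Int.castRingHom ℚ) y')) :=
      isUnit_C.2 (isUnit_iff_ne_zero.2 (by simpa using hy'))
    rw [← hu'.dvd_mul_left, hWR']
    exact dvd_sub (hd3.mul_right _) (hd2.mul_right _)

theorem eval_hasseDeriv_eq_sum_taylor {F : Type*} [Field F] {U : F[X]} {n : ℕ}
    (hU : U.natDegree < n) (j : ℕ) (a t : F) :
    eval t (hasseDeriv j U) = ∑ k ∈ Finset.range n,
      (k.choose j : F) * eval a (hasseDeriv k U) * (t - a) ^ (k - j) := by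
  have h1 : eval t (hasseDeriv j U) = eval (t - a) (hasseDeriv j (taylor a U)) := by
    rw [← taylor_coeff, ← taylor_coeff, taylor_taylor, sub_add_cancel]
  have h2 : (taylor a U).natDegree < n := by rwa [natDegree_taylor]
  rw [h1, (taylor a U).as_sum_range' n h2]
  simp only [map_sum, eval_finsetSum, hasseDeriv_monomial, eval_monomial, taylor_coeff]

/-- The data entering the approximation argument: a monic irreducible quartic with two real roots
and a pair of complex conjugate roots, together with two good rational approximations to one of
the real roots. -/
structure IsApproxPair (f : ℤ[X]) (α₁ α₂ : ℝ) (γ : ℂ) (c l w w₂ : ℝ) (x₁ y₁ x₂ y₂ : ℤ) :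
    Prop where
  monic : f.Monic
  irreducible : Irreducible (f.map (Int.castRingHom ℚ))
  map_eq : f.map (Int.castRingHom ℂ) =
    (X - C (α₁ : ℂ)) * (X - C (α₂ : ℂ)) * (X - C γ) * (X - C ((starRingEnd ℂ) γ))
  ne : α₁ ≠ α₂
  im_ne : γ.im ≠ 0
  mahler_le : max 1 |α₁| * max 1 |α₂| * max 1 ‖γ‖ ^ 2 ≤ Real.exp l
  y₁_pos : 0 < y₁
  coprime : IsCoprime x₁ y₁
  y₂_ne : y₂ ≠ 0
  y₁_le : y₁ * max 1 |α₁| ≤ c * Real.exp w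
  x₁_le : |(x₁ : ℝ)| ≤ c * Real.exp w
  le_height : Real.exp w ≤ c * max |(x₁ : ℝ)| |(y₁ : ℝ)|
  approx₁ : |x₁ - α₁ * y₁| ≤ c * Real.exp (-3 * w)
  y₂_le : |(y₂ : ℝ)| * max 1 |α₁| ≤ c * Real.exp w₂
  approx₂ : |x₂ - α₁ * y₂| ≤ c * Real.exp (-3 * w₂)

section ApproxPair

variable {f : ℤ[X]} {α₁ α₂ : ℝ} {γ : ℂ} {c l w w₂ : ℝ} {x₁ y₁ x₂ y₂ : ℤ}

theorem norm_aeval_ofReal (α : ℝ) (g : ℤ[X]) : ‖aeval (α : ℂ) g‖ = |aeval α g| := by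
  have h : aeval (algebraMap ℝ ℂ α) g = algebraMap ℝ ℂ (aeval α g) := aeval_algebraMap_apply _ _ _
  have h' : aeval (α : ℂ) g = ((aeval α g : ℝ) : ℂ) := h
  rw [h', Complex.norm_real, Real.norm_eq_abs]

theorem IsApproxPair.one_le (h : IsApproxPair f α₁ α₂ γ c l w w₂ x₁ y₁ x₂ y₂) {m n : ℕ} {B : ℝ}
    (hc1 : 1 ≤ c) (hw : 0 ≤ w) {P Q : ℤ[X]} (hP : P.natDegree < n) (hQ : Q.natDegree < n)
    (hcP : ∀ k, |(P.coeff k : ℝ)| ≤ B) (hcQ : ∀ k, |(Q.coeff k : ℝ)| ≤ B)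
    (hdvd : ∀ j < m, f ∣ hasseDeriv j P - X * hasseDeriv j Q) {j : ℕ} (hj : j ≤ m)
    (hne : eval ((x₁ : ℝ) / y₁)
      ((hasseDeriv j (C y₂ * P - C x₂ * Q)).map (algebraMap ℤ ℝ)) ≠ 0) :
    1 ≤ n ^ 2 * 2 ^ (2 * n + 1) * c ^ (n + 1) * B *
      (Real.exp (w₂ - w * (4 * m - (n - 1) - 3 * j)) + Real.exp ((n - 1) * w - 3 * w₂)) := by
  have hB : 0 ≤ B := (abs_nonneg _).trans (hcP 0)
  have hy : (0 : ℝ) < y₁ := by exact_mod_cast h.y₁_pos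
  have hy1 : (1 : ℝ) ≤ y₁ := by exact_mod_cast h.y₁_pos
  set t : ℝ := (x₁ : ℝ) / y₁ with ht
  set N := n - 1 with hN
  have hNn : (N : ℝ) = n - 1 := by rw [hN, Nat.cast_sub (by omega)]; simp
  set R := C y₂ * P - C x₂ * Q with hR
  have hRdeg : R.natDegree ≤ N := by
    have h1 := natDegree_C_mul_le y₂ P
    have h2 := natDegree_C_mul_le x₂ Q
    have := natDegree_sub_le (C y₂ * P) (C x₂ * Q)
    rw [hR]; omega
  have h1 : 1 ≤ (y₁ : ℝ) ^ (N - j) * |aeval t (hasseDeriv j R)| := by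
    have h2 := one_le_pow_mul_abs_eval_div h.y₁_pos hne
    refine h2.trans ?_
    rw [eval_map]
    exact mul_le_mul_of_nonneg_right (pow_le_pow_right₀ hy1
      ((natDegree_hasseDeriv_le _ _).trans (Nat.sub_le_sub_right hRdeg _))) (abs_nonneg _)
  have hdec : aeval t (hasseDeriv j R) =
      y₂ * (aeval t (hasseDeriv j P) - α₁ * aeval t (hasseDeriv j Q)) -
        (x₂ - α₁ * y₂) * aeval t (hasseDeriv j Q) := by
    rw [hR, map_sub, ← smul_eq_C_mul, ← smul_eq_C_mul, map_smul, map_smul, map_sub, map_zsmul,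
      map_zsmul, zsmul_eq_mul, zsmul_eq_mul]
    ring
  set μ := max 1 |α₁| with hμ
  have hμ1 : 1 ≤ μ := le_max_left _ _
  -- the main term
  set U : ℝ[X] := P.map (algebraMap ℤ ℝ) - C α₁ * Q.map (algebraMap ℤ ℝ) with hU
  have hUeval : ∀ k a, eval a (hasseDeriv k U) =
      aeval a (hasseDeriv k P) - α₁ * aeval a (hasseDeriv k Q) := by
    intro k a
    rw [hU, map_sub, ← smul_eq_C_mul, map_smul, hasseDeriv_map, hasseDeriv_map, eval_sub,
      eval_smul, eval_map, eval_map]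
    rfl
  have hUdeg : U.natDegree < n := by
    have h1 := natDegree_map_le (f := algebraMap ℤ ℝ) (p := P)
    have h2 := natDegree_map_le (f := algebraMap ℤ ℝ) (p := Q)
    have h3 := natDegree_C_mul_le α₁ (Q.map (algebraMap ℤ ℝ))
    have := natDegree_sub_le (P.map (algebraMap ℤ ℝ)) (C α₁ * Q.map (algebraMap ℤ ℝ))
    rw [hU]; omega
  have hα : aeval (α₁ : ℂ) f = 0 := by
    have : eval (α₁ : ℂ) (f.map (Int.castRingHom ℂ)) = 0 := by rw [h.map_eq]; simp
    rw [eval_map] at this; exact this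
  have hU0 : ∀ k < m, eval α₁ (hasseDeriv k U) = 0 := by
    intro k hk
    obtain ⟨q, hq⟩ := hdvd k hk
    have h2 : |aeval α₁ (hasseDeriv k P - X * hasseDeriv k Q)| = 0 := by
      rw [← norm_aeval_ofReal, hq, map_mul, hα, zero_mul, norm_zero]
    rw [hUeval]
    rw [map_sub, map_mul, aeval_X] at h2
    exact abs_eq_zero.1 h2
  have hUk : ∀ k < n, |eval α₁ (hasseDeriv k U)| ≤ n * 2 ^ (n + 1) * B * μ ^ (n - k) := by
    intro k hk
    have h2 := norm_aeval_hasseDeriv_sub_le hP hQ hk hcP hcQ (z := (α₁ : ℂ)) hμ1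
      (by rw [Complex.norm_real]; exact le_max_right _ _)
    rw [norm_aeval_ofReal, map_sub, map_mul, aeval_X] at h2
    rwa [hUeval]
  have hδ : y₁ * |t - α₁| ≤ c * Real.exp (-3 * w) := by
    have h2 : (x₁ : ℝ) - α₁ * y₁ = y₁ * (t - α₁) := by
      rw [ht]; field_simp
    have h3 := h.approx₁
    rwa [h2, abs_mul, abs_of_pos hy] at h3
  have hmain : (y₁ : ℝ) ^ (N - j) * (|(y₂ : ℝ)| * |eval t (hasseDeriv j U)|) ≤
      n * (n * 2 ^ (2 * n + 1) * c ^ (n + 1) * B *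
        Real.exp (w₂ - w * (4 * m - N - 3 * j))) := by
    rw [eval_hasseDeriv_eq_sum_taylor hUdeg j α₁ t]
    calc _ ≤ (y₁ : ℝ) ^ (N - j) * (|(y₂ : ℝ)| * ∑ k ∈ Finset.range n,
          |(k.choose j : ℝ) * eval α₁ (hasseDeriv k U) * (t - α₁) ^ (k - j)|) := by
          gcongr; exact Finset.abs_sum_le_sum_abs _ _
      _ = ∑ k ∈ Finset.range n, (y₁ : ℝ) ^ (N - j) * (|(y₂ : ℝ)| *
          |(k.choose j : ℝ) * eval α₁ (hasseDeriv k U) * (t - α₁) ^ (k - j)|) := by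
          rw [Finset.mul_sum, Finset.mul_sum]
      _ ≤ ∑ k ∈ Finset.range n, (n * 2 ^ (2 * n + 1) * c ^ (n + 1) * B *
            Real.exp (w₂ - w * (4 * m - N - 3 * j))) := ?_
      _ = _ := by simp
    refine Finset.sum_le_sum fun k hk => ?_
    rw [Finset.mem_range] at hk
    rcases lt_or_ge k m with hkm | hkm
    · rw [hU0 k hkm]; simp; positivity
    have e1 : (y₁ : ℝ) ^ (N - j) = y₁ ^ (N - k) * y₁ ^ (k - j) := by
      rw [← pow_add]; congr 1; omega
    have e2 : μ ^ (n - k) = μ ^ (N - k) * μ := by rw [← pow_succ]; congr 1; omega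
    rw [abs_mul, abs_mul, abs_pow, Nat.abs_cast, e1]
    have hch : (k.choose j : ℝ) ≤ 2 ^ n := by
      exact_mod_cast (Nat.choose_le_two_pow k j).trans
            (Nat.pow_le_pow_right (by norm_num) hk.le : 2 ^ k ≤ 2 ^ n)
    calc (y₁ : ℝ) ^ (N - k) * y₁ ^ (k - j) * (|(y₂ : ℝ)| *
          ((k.choose j : ℝ) * |eval α₁ (hasseDeriv k U)| * |t - α₁| ^ (k - j)))
        ≤ (y₁ : ℝ) ^ (N - k) * y₁ ^ (k - j) * (|(y₂ : ℝ)| *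
          (2 ^ n * (n * 2 ^ (n + 1) * B * μ ^ (n - k)) * |t - α₁| ^ (k - j))) := by
          gcongr; exact hUk k hk
      _ = n * 2 ^ (2 * n + 1) * B * ((y₁ * μ) ^ (N - k) * (y₁ * |t - α₁|) ^ (k - j) *
            (|(y₂ : ℝ)| * μ)) := by
          rw [e2, mul_pow, mul_pow]; ring
      _ ≤ n * 2 ^ (2 * n + 1) * B * ((c * Real.exp w) ^ (N - k) *
            (c * Real.exp (-3 * w)) ^ (k - j) * (c * Real.exp w₂)) := by
          have i1 := pow_le_pow_left₀ (by positivity) h.y₁_le (N - k)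
          have i2 := pow_le_pow_left₀ (by positivity) hδ (k - j)
          have i3 := h.y₂_le
          exact mul_le_mul_of_nonneg_left (mul_le_mul (mul_le_mul i1 i2 (by positivity)
            (by positivity)) i3 (by positivity) (by positivity)) (by positivity)
      _ = n * 2 ^ (2 * n + 1) * c ^ (N - j + 1) * B *
            Real.exp (w₂ + (N - k) * w - 3 * (k - j) * w) := by
          have e3 : c ^ (N - j + 1) = c ^ (N - k) * c ^ (k - j) * c := by
            rw [pow_succ, ← pow_add]; congr 2; omega
          have e4 : Real.exp (w₂ + (N - k) * w - 3 * (k - j) * w) =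
              Real.exp w ^ (N - k) * Real.exp (-3 * w) ^ (k - j) * Real.exp w₂ := by
            rw [← Real.exp_nat_mul, ← Real.exp_nat_mul, ← Real.exp_add, ← Real.exp_add]
            have q1 : ((N - k : ℕ) : ℝ) = N - k := Nat.cast_sub (by omega)
            have q2 : ((k - j : ℕ) : ℝ) = k - j := Nat.cast_sub (by omega)
            rw [q1, q2]
            congr 1; ring
          rw [e3, e4, mul_pow, mul_pow]; ring
      _ ≤ _ := by
          have i1 : c ^ (N - j + 1) ≤ c ^ (n + 1) := pow_le_pow_right₀ hc1 (by omega)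
          have i2 : w₂ + (N - k) * w - 3 * (k - j) * w ≤ w₂ - w * (4 * m - N - 3 * j) := by
            have : (m : ℝ) ≤ k := by exact_mod_cast hkm
            nlinarith
          gcongr
  have hsecond : (y₁ : ℝ) ^ (N - j) * (|x₂ - α₁ * y₂| * |aeval t (hasseDeriv j Q)|) ≤
      n ^ 2 * 2 ^ (2 * n + 1) * c ^ (n + 1) * B * Real.exp (N * w - 3 * w₂) := by
    have h2 := norm_aeval_hasseDeriv_le hQ hcQ (z := (t : ℂ)) (j := j) (le_max_left 1 |t|)
      (by rw [Complex.norm_real]; exact le_max_right _ _)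
    rw [norm_aeval_ofReal] at h2
    have hyt : y₁ * max 1 |t| ≤ c * Real.exp w := by
      rw [mul_max_of_nonneg _ _ hy.le, mul_one]
      apply max_le
      · exact (le_mul_of_one_le_right hy.le hμ1).trans h.y₁_le
      · have : (y₁ : ℝ) * |t| = |(x₁ : ℝ)| := by
          rw [ht, abs_div, abs_of_pos hy]; field_simp
        rw [this]; exact h.x₁_le
    have hn1 : (1 : ℝ) ≤ n := by exact_mod_cast (by omega : 1 ≤ n)
    calc _ ≤ (y₁ : ℝ) ^ (N - j) * ((c * Real.exp (-3 * w₂)) *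
            (n * 2 ^ n * B * max 1 |t| ^ (n - 1 - j))) := by
          gcongr; exact h.approx₂
      _ = n * 2 ^ n * B * c * Real.exp (-3 * w₂) * (y₁ * max 1 |t|) ^ (N - j) := by
          rw [mul_pow]; ring
      _ ≤ n * 2 ^ n * B * c * Real.exp (-3 * w₂) * (c * Real.exp w) ^ (N - j) := by gcongr
      _ = n * 2 ^ n * c ^ (N - j + 1) * B * Real.exp ((N - j : ℕ) * w - 3 * w₂) := by
          rw [sub_eq_add_neg, Real.exp_add, Real.exp_nat_mul, mul_pow, pow_succ,
            neg_mul_eq_neg_mul]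
          ring
      _ ≤ _ := by
          have i1 : c ^ (N - j + 1) ≤ c ^ (n + 1) := pow_le_pow_right₀ hc1 (by omega)
          have i2 : (2 : ℝ) ^ n ≤ 2 ^ (2 * n + 1) := pow_le_pow_right₀ one_le_two (by omega)
          have i3 : (n : ℝ) ≤ n ^ 2 := le_self_pow₀ hn1 two_ne_zero
          have i4 : ((N - j : ℕ) : ℝ) ≤ N := by exact_mod_cast Nat.sub_le _ _
          gcongr
  rw [← hNn]
  refine h1.trans ?_
  rw [hdec, ← hUeval]
  calc _ ≤ (y₁ : ℝ) ^ (N - j) * (|(y₂ : ℝ)| * |eval t (hasseDeriv j U)|) +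
        (y₁ : ℝ) ^ (N - j) * (|x₂ - α₁ * y₂| * |aeval t (hasseDeriv j Q)|) := by
        rw [← mul_add, ← abs_mul, ← abs_mul]
        gcongr
        exact abs_sub _ _
    _ ≤ _ := add_le_add hmain hsecond
    _ = _ := by ring

end ApproxPair

theorem sum_fin_sub_eq {m n : ℕ} (h : m ≤ n) :
    ∑ j : Fin m, ((n - j : ℕ) : ℝ) = m * n - m * (m - 1) / 2 := by
  rw [Fin.sum_univ_eq_sum_range (fun j => ((n - j : ℕ) : ℝ)) m]
  induction m with
  | zero => simp
  | succ m ih =>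
    rw [Finset.sum_range_succ, ih (by omega), Nat.cast_sub (by omega)]
    push_cast; ring

theorem injective_vecCons_four {R : Type*} {a b c d : R} (hab : a ≠ b) (hac : a ≠ c) (had : a ≠ d)
    (hbc : b ≠ c) (hbd : b ≠ d) (hcd : c ≠ d) : Function.Injective ![a, b, c, d] := by
  intro i j hij
  fin_cases i <;> fin_cases j <;>
    simp only [Fin.zero_eta, Fin.mk_one, Fin.reduceFinMk, Matrix.cons_val] at hij ⊢ <;>
    first
    | exact absurd hij ‹_›
    | exact absurd hij.symm ‹_›

theorem IsApproxPair.false_of_parameters {c : ℝ} (hc : 1 ≤ c) {m s n : ℕ} (hm : 0 < m)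
    (hs : 0 < s) (hn : n = 2 * m + s) (hsm : s ≤ 2 * m) (hms : m ≤ 4 * s) {K : ℝ}
    (hK : K = (3 * Real.log c + 109) * n) {f : ℤ[X]} {α₁ α₂ : ℝ} {γ : ℂ} {l w w₂ β : ℝ}
    {x₁ y₁ x₂ y₂ : ℤ} (h : IsApproxPair f α₁ α₂ γ c l w w₂ x₁ y₁ x₂ y₂) (hl : 0 ≤ l) (hw : 0 ≤ w)
    (hβ : β = l * (m * n - m * (m - 1) / 2) / (2 * s))
    (hj : ∀ j : ℕ, ((j : ℝ) - 1) * (w - Real.log c) ≤ 2 * β + K →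
      j ≤ m ∧ w₂ + β + K < w * (4 * m - (n - 1) - 3 * j))
    (hω : (n - 1) * w + β + K < 3 * w₂) : False := by
  have hn1 : (1 : ℝ) ≤ n := by exact_mod_cast (by omega : 1 ≤ n)
  set k₀ : ℝ := 4 * m * Real.log (8 * n * 2 ^ (n + 1)) / (2 * s) with hk₀
  have hk₀0 : 0 ≤ k₀ := by
    have : (1 : ℝ) ≤ 8 * n * 2 ^ (n + 1) := by
      have : (1 : ℝ) ≤ 2 ^ (n + 1) := one_le_pow₀ one_le_two
      nlinarith
    have := Real.log_nonneg this
    positivity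
  set c' : ℝ := n ^ 2 * 2 ^ (2 * n + 1) * c ^ (n + 1) with hc'
  have hc'1 : 1 ≤ c' := by
    have h1 : (1 : ℝ) ≤ n ^ 2 := one_le_pow₀ hn1
    have h2 : (1 : ℝ) ≤ 2 ^ (2 * n + 1) := one_le_pow₀ one_le_two
    have h3 : (1 : ℝ) ≤ c ^ (n + 1) := one_le_pow₀ hc
    rw [hc']
    exact one_le_mul_of_one_le_of_one_le (one_le_mul_of_one_le_of_one_le h1 h2) h3
  have hl1 : 0 ≤ Real.log c := Real.log_nonneg hc
  have hl2 : 0 ≤ Real.log (16 * n ^ 2) := Real.log_nonneg (by nlinarith)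
  have hl3 : 0 ≤ Real.log (4 * c') := Real.log_nonneg (by linarith)
  have hs0 : (0 : ℝ) < s := by exact_mod_cast hs
  have hKle : Real.log c + Real.log (16 * n ^ 2) + Real.log (4 * c') + 2 * k₀ ≤ K := by
    have hn0 : (n : ℝ) ≠ 0 := by positivity
    have hlog2 : Real.log 2 ≤ 1 := by linarith [Real.log_two_lt_d9]
    have hlogn : Real.log n ≤ n := Real.log_le_self (by positivity)
    have e1 : Real.log (16 * n ^ 2) = 4 * Real.log 2 + 2 * Real.log n := by
      rw [Real.log_mul (by norm_num) (by positivity), Real.log_pow,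
        show (16 : ℝ) = 2 ^ 4 by norm_num, Real.log_pow]
      push_cast; ring
    have e2 : Real.log (4 * c') =
        2 * Real.log 2 + 2 * Real.log n + (2 * n + 1) * Real.log 2 + (n + 1) * Real.log c := by
      rw [hc', Real.log_mul (by norm_num) (by positivity), Real.log_mul (by positivity)
        (by positivity), Real.log_mul (by positivity) (by positivity), Real.log_pow, Real.log_pow,
        Real.log_pow, show (4 : ℝ) = 2 ^ 2 by norm_num, Real.log_pow]
      push_cast; ring
    have e3 : Real.log (8 * n * 2 ^ (n + 1)) = (n + 4) * Real.log 2 + Real.log n := by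
      rw [Real.log_mul (by positivity) (by positivity), Real.log_mul (by norm_num) (by positivity),
        Real.log_pow, show (8 : ℝ) = 2 ^ 3 by norm_num, Real.log_pow]
      push_cast; ring
    have e4 : k₀ ≤ 8 * (6 * n) := by
      rw [hk₀, div_le_iff₀ (by positivity), e3]
      have h1 : ((n : ℝ) + 4) * Real.log 2 + Real.log n ≤ 6 * n := by nlinarith
      have h2 : (m : ℝ) ≤ 4 * s := by exact_mod_cast hms
      calc 4 * (m : ℝ) * ((n + 4) * Real.log 2 + Real.log n) ≤ 4 * m * (6 * n) := by gcongr
        _ ≤ 4 * (4 * s) * (6 * n) := by gcongr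
        _ = _ := by ring
    rw [e1, e2, hK]
    nlinarith
  have hK0 : 0 ≤ K := by linarith
  have hmn : (m : ℝ) ≤ n := by exact_mod_cast (by omega : m ≤ n)
  have hm1 : (1 : ℝ) ≤ m := by exact_mod_cast hm
  have hβ0 : 0 ≤ β := by
    rw [hβ]
    have : (0 : ℝ) ≤ m * n - m * (m - 1) / 2 := by nlinarith
    positivity
  set B := ⌈Real.exp (β + k₀)⌉₊ with hB
  have hexp1 : 1 ≤ Real.exp (β + k₀) := Real.one_le_exp (by positivity)
  have hBl : Real.exp (β + k₀) ≤ B := Nat.le_ceil _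
  have hBu : (B : ℝ) ≤ 2 * Real.exp (β + k₀) := by
    have := Nat.ceil_lt_add_one (zero_le_one.trans hexp1)
    linarith
  have hB1' : (1 : ℝ) ≤ B := hexp1.trans hBl
  have hB1 : 1 ≤ B := by exact_mod_cast hB1'
  obtain ⟨P, Q, hne, hP, hQ, hcP, hcQ, hdvd⟩ := exists_pair_dvd_hasseDeriv h.monic h.irreducible
    h.map_eq hn hm hl h.mahler_le hB1 (by
      rw [sum_fin_sub_eq (by omega)]
      calc _ = Real.exp (β + k₀) ^ (2 * s) := by
            rw [← Real.exp_nat_mul]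
            have e1 : ((2 * s : ℕ) : ℝ) * (β + k₀) =
                (4 * m : ℕ) * Real.log (8 * n * 2 ^ (n + 1)) +
                  l * (m * n - m * (m - 1) / 2) := by
              rw [hβ, hk₀]; push_cast; field_simp; ring
            rw [e1, Real.exp_add, Real.exp_nat_mul, Real.exp_log (by positivity)]
        _ ≤ (B : ℝ) ^ (2 * s) := by gcongr)
  have hrr : ∏ i, (X - C ((![(α₁ : ℂ), α₂, γ, (starRingEnd ℂ) γ] : Fin 4 → ℂ) i)) =
      f.map (Int.castRingHom ℂ) := by rw [prod_X_sub_C_four, h.map_eq]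
  have hdeg : f.natDegree = 4 := by
    rw [← h.monic.natDegree_map (Int.castRingHom ℂ), ← hrr, natDegree_prod_of_monic _ _
      (fun i _ => monic_X_sub_C _)]
    simp
  have him : γ ≠ (starRingEnd ℂ) γ := fun e => h.im_ne (Complex.conj_eq_iff_im.1 e.symm)
  have hW : wronskian P Q ≠ 0 := by
    refine wronskian_ne_zero_of_forall_dvd (k := 4) (m := m) (n := n)
      (r := ![(α₁ : ℂ), α₂, γ, (starRingEnd ℂ) γ]) h.monic h.irreducible
      (by omega) ?_ ?_ (by omega) hne hP hQ hdvd
    · have hreal : ∀ a : ℝ, (a : ℂ) ≠ γ ∧ (a : ℂ) ≠ (starRingEnd ℂ) γ := by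
        refine fun a => ⟨?_, ?_⟩
        · rintro rfl; exact h.im_ne (Complex.ofReal_im a)
        · intro e
          apply h.im_ne
          have := congrArg Complex.im e
          simpa using this.symm
      have h12 : (α₁ : ℂ) ≠ α₂ := by exact_mod_cast h.ne
      have h13 := hreal α₁
      have h23 := hreal α₂
      exact injective_vecCons_four h12 h13.1 h13.2 h23.1 h23.2 him
    · intro i
      have : eval ((![(α₁ : ℂ), α₂, γ, (starRingEnd ℂ) γ] : Fin 4 → ℂ) i)
          (f.map (Int.castRingHom ℂ)) = 0 := by
        rw [← hrr, eval_prod]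
        exact Finset.prod_eq_zero (Finset.mem_univ i) (by simp)
      rw [eval_map] at this
      exact this
  obtain ⟨j, hjne, hjT⟩ := exists_hasseDeriv_ne_zero_of_wronskian (x' := x₂) hW
    (abs_coeff_wronskian_le hP hQ hcP hcQ) h.y₁_pos h.coprime h.y₂_ne
  set H := max |(x₁ : ℝ)| |(y₁ : ℝ)| with hH
  have hHl : Real.exp (w - Real.log c) ≤ H := by
    rw [Real.exp_sub, Real.exp_log (by linarith), div_le_iff₀ (by linarith), mul_comm]
    exact h.le_height
  have hj' : ((j : ℝ) - 1) * (w - Real.log c) ≤ 2 * β + K := by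
    rcases Nat.eq_zero_or_pos j with rfl | hjpos
    · simp only [Nat.cast_zero]; linarith
    have hj1 : ((j - 1 : ℕ) : ℝ) = j - 1 := by rw [Nat.cast_sub hjpos]; simp
    have h1 : Real.exp (((j : ℝ) - 1) * (w - Real.log c)) ≤
        Real.exp (2 * β + 2 * k₀ + Real.log (16 * n ^ 2)) := by
      calc _ = Real.exp (w - Real.log c) ^ (j - 1) := by rw [← hj1, Real.exp_nat_mul]
        _ ≤ H ^ (j - 1) := by gcongr
        _ ≤ 4 * n ^ 2 * B ^ 2 := hjT
        _ ≤ 4 * n ^ 2 * (2 * Real.exp (β + k₀)) ^ 2 := by gcongr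
        _ = _ := by
          have : Real.exp (2 * (β + k₀)) = Real.exp (β + k₀) * Real.exp (β + k₀) := by
            rw [← Real.exp_add]; congr 1; ring
          rw [Real.exp_add (2 * β + 2 * k₀), Real.exp_log (by positivity), ← mul_add, this]
          ring
    rw [Real.exp_le_exp] at h1
    have : (0 : ℝ) ≤ (j : ℝ) - 1 := by rw [← hj1]; positivity
    have hKc : Real.log c ≤ K := by linarith
    nlinarith
  obtain ⟨hjm, hjw⟩ := hj j hj'
  have hfin := h.one_le hc hw hP hQ hcP hcQ hdvd hjm hjne
  have hE1 : Real.exp (w₂ - w * (4 * m - (n - 1) - 3 * j)) < Real.exp (-(β + K)) := by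
    rw [Real.exp_lt_exp]; linarith
  have hE2 : Real.exp ((n - 1) * w - 3 * w₂) < Real.exp (-(β + K)) := by
    rw [Real.exp_lt_exp]; linarith
  have : (1 : ℝ) < 1 := by
    calc 1 ≤ c' * B * (Real.exp (w₂ - w * (4 * m - (n - 1) - 3 * j)) +
          Real.exp ((n - 1) * w - 3 * w₂)) := hfin
      _ < c' * B * (Real.exp (-(β + K)) + Real.exp (-(β + K))) := by gcongr
      _ ≤ c' * (2 * Real.exp (β + k₀)) * (Real.exp (-(β + K)) + Real.exp (-(β + K))) := by
          gcongr
      _ = 4 * c' * Real.exp (k₀ - K) := by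
          have : Real.exp (k₀ - K) = Real.exp (β + k₀) * Real.exp (-(β + K)) := by
            rw [← Real.exp_add]; congr 1; ring
          rw [this]; ring
      _ ≤ 4 * c' * Real.exp (-Real.log (4 * c')) := by
          gcongr; linarith
      _ = 1 := by
          rw [Real.exp_neg, Real.exp_log (by positivity)]
          exact mul_inv_cancel₀ (by positivity)
  exact lt_irrefl _ this

theorem IsApproxPair.false_of_le {c : ℝ} (hc : 1 ≤ c) {f : ℤ[X]} {α₁ α₂ : ℝ} {γ : ℂ} {w w₂ : ℝ}
    {x₁ y₁ x₂ y₂ : ℤ} (h : IsApproxPair f α₁ α₂ γ c (w / 39.9) w w₂ x₁ y₁ x₂ y₂)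
    (hw : 100000 * (3 * Real.log c + 109) ≤ w) (hw₂ : 3 * w ≤ w₂) : False := by
  have hlc : 0 ≤ Real.log c := Real.log_nonneg hc
  set κ := 3 * Real.log c + 109 with hκ
  have hw0 : 0 < w := by linarith
  have hl : 0 ≤ w / 39.9 := by positivity
  have small : ∀ {m s n : ℕ} (b : ℝ), 0 < m → 0 < s → n = 2 * m + s → s ≤ 2 * m → m ≤ 4 * s →
      n ≤ 20 → ((m : ℝ) * n - m * (m - 1) / 2) / (2 * s) / 39.9 = b → 2 * b ≤ 0.9 →
      w₂ < w * (4 * m - n - 2.001 - b) → w * (n - 1 + b + 0.001) < 3 * w₂ → False := by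
    intro m s n b hm hs hn hsm hms hn20 hb hb1 hu hv
    have hn20' : (n : ℝ) ≤ 20 := by exact_mod_cast hn20
    have hκn : κ * n ≤ 0.0002 * w := by nlinarith
    have hβ : w * b = w / 39.9 * ((m : ℝ) * n - m * (m - 1) / 2) / (2 * s) := by
      rw [← hb]; ring
    refine h.false_of_parameters hc hm hs hn hsm hms rfl hl hw0.le hβ (fun j hj => ?_) ?_
    · have hj2 : j < 2 := by
        by_contra! hj2
        have : (1 : ℝ) * (w - Real.log c) ≤ (j - 1) * (w - Real.log c) := by
          have : (2 : ℝ) ≤ j := by exact_mod_cast hj2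
          gcongr <;> linarith
        nlinarith
      have : (j : ℝ) ≤ 1 := by exact_mod_cast (by omega : j ≤ 1)
      exact ⟨by omega, by nlinarith⟩
    · nlinarith
  rcases lt_or_ge w₂ (4.6 * w) with h1 | h1
  · exact small (m := 4) (s := 1) (n := 9) (30 / 79.8) (by norm_num) (by norm_num) (by norm_num)
      (by norm_num) (by norm_num) (by norm_num) (by norm_num) (by norm_num)
      (by norm_num; linarith) (by norm_num; linarith)
  rcases lt_or_ge w₂ (7.5 * w) with h2 | h2
  · exact small (m := 6) (s := 2) (n := 14) (69 / 159.6) (by norm_num) (by norm_num) (by norm_num)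
      (by norm_num) (by norm_num) (by norm_num) (by norm_num) (by norm_num)
      (by norm_num; linarith) (by norm_num; linarith)
  rcases lt_or_ge w₂ (9.5 * w) with h3 | h3
  · exact small (m := 8) (s := 4) (n := 20) (132 / 319.2) (by norm_num) (by norm_num) (by norm_num)
      (by norm_num) (by norm_num) (by norm_num) (by norm_num) (by norm_num)
      (by norm_num; linarith) (by norm_num; linarith)
  set r := ⌊(w₂ / w + 2.14) / 3.55⌋₊ with hr
  have hwω : 9.5 ≤ w₂ / w := by rwa [le_div_iff₀ hw0]
  have hr1 : (r : ℝ) * 3.55 ≤ w₂ / w + 2.14 := by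
    rw [← le_div_iff₀ (by norm_num)]
    exact Nat.floor_le (by positivity)
  have hr2 : w₂ / w + 2.14 < (r + 1) * 3.55 := by
    rw [← div_lt_iff₀ (by norm_num)]
    exact Nat.lt_floor_add_one _
  set k := r + 1 with hk
  have hkr : (k : ℝ) = r + 1 := by rw [hk]; push_cast; ring
  have hk4 : 4 ≤ k := by
    by_contra! h4
    have : (r : ℝ) + 1 ≤ 3 := by exact_mod_cast (by omega : r + 1 ≤ 3)
    nlinarith
  have hk4' : (4 : ℝ) ≤ k := by exact_mod_cast hk4
  have u1 : w₂ < 3.55 * (w * k) - 2.14 * w := by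
    have : w₂ / w < 3.55 * k - 2.14 := by rw [hkr]; linarith
    rw [div_lt_iff₀ hw0] at this
    linarith
  have u2 : 3.55 * (w * k) - 5.69 * w ≤ w₂ := by
    have : 3.55 * k - 5.69 ≤ w₂ / w := by rw [hkr]; linarith
    rw [le_div_iff₀ hw0] at this
    linarith
  obtain ⟨β, hβ⟩ : ∃ β, β = w / 39.9 * (((3 * k : ℕ) : ℝ) * ((7 * k : ℕ) : ℝ) -
      ((3 * k : ℕ) : ℝ) * (((3 * k : ℕ) : ℝ) - 1) / 2) / (2 * k) := ⟨_, rfl⟩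
  have hβ' : 79.8 * β = 16.5 * (w * k) + 1.5 * w := by
    rw [hβ]
    push_cast
    field_simp
    ring
  have hκk : 100000 * (κ * k) ≤ w * k := by nlinarith
  have hwk : 4 * w ≤ w * k := by nlinarith
  refine h.false_of_parameters hc (m := 3 * k) (s := k) (n := 7 * k) (by omega) (by omega)
      (by omega) (by omega) (by omega) rfl hl hw0.le hβ (fun j hj => ?_) ?_
  · rw [← hκ] at hj ⊢
    push_cast at hj ⊢
    have hj3 : (j - 1) * w ≤ 0.413735 * (w * k) + 0.0377 * w := by
      rcases le_or_gt (j : ℝ) 1 with hj1 | hj1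
      · have : ((j : ℝ) - 1) * w ≤ 0 := mul_nonpos_of_nonpos_of_nonneg (by linarith) hw0.le
        linarith
      have : ((j : ℝ) - 1) * (300000 * Real.log c) ≤ (j - 1) * w := by
        apply mul_le_mul_of_nonneg_left <;> linarith
      linarith
    constructor
    · have : ((j : ℝ) - 1) * w ≤ (0.413735 * k + 0.0377) * w := by linarith
      have := le_of_mul_le_mul_right this hw0
      have : (j : ℝ) ≤ (3 * k : ℕ) := by push_cast; linarith
      exact_mod_cast this
    · linarith
  · rw [← hκ]
    push_cast
    rcases Nat.lt_or_ge k 5 with h5 | h5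
    · have hk : (k : ℝ) = 4 := by exact_mod_cast (by omega : k = 4)
      rw [hk] at hκk hβ' ⊢
      linarith
    · have : 5 * w ≤ w * k := by
        rw [mul_comm]; gcongr; exact_mod_cast h5
      linarith

theorem exists_quadratic_dvd {f : ℝ[X]} (hf : 2 ≤ f.natDegree) :
    ∃ p q : ℝ, X ^ 2 + C p * X + C q ∣ f := by
  have key : ∀ {z : ℂ} {g : ℝ[X]}, aeval z g = 0 → z.im ≠ 0 →
      ∃ p q : ℝ, X ^ 2 + C p * X + C q ∣ g := fun {z g} h hz => by
    refine ⟨-(2 * z.re), ‖z‖ ^ 2, ?_⟩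
    have := quadratic_dvd_of_aeval_eq_zero_im_ne_zero g h hz
    convert this using 1
    simp; ring
  have root : ∀ {g : ℝ[X]}, 1 ≤ g.natDegree →
      (∃ p q : ℝ, X ^ 2 + C p * X + C q ∣ g) ∨ ∃ r : ℝ, X - C r ∣ g := fun {g} hg => by
    obtain ⟨z, hz⟩ := IsAlgClosed.exists_aeval_eq_zero ℂ g
      (degree_ne_of_natDegree_ne (by change g.natDegree ≠ 0; omega))
    by_cases him : z.im = 0
    · right
      refine ⟨z.re, dvd_iff_isRoot.2 ?_⟩
      have e : z = algebraMap ℝ ℂ z.re := Complex.ext rfl him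
      rw [e, aeval_algebraMap_apply] at hz
      have := (algebraMap ℝ ℂ).injective (hz.trans (map_zero _).symm)
      simpa [IsRoot, aeval_def] using this
    · exact Or.inl (key hz him)
  rcases root (by omega : 1 ≤ f.natDegree) with h | ⟨r, f', rfl⟩
  · exact h
  have hf0 : f' ≠ 0 := by rintro rfl; simp at hf
  rw [natDegree_mul (X_sub_C_ne_zero r) hf0, natDegree_X_sub_C] at hf
  rcases root (by omega : 1 ≤ f'.natDegree) with ⟨p, q, h⟩ | ⟨r', h⟩
  · exact ⟨p, q, h.mul_left _⟩
  · refine ⟨-(r + r'), r * r', ?_⟩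
    convert mul_dvd_mul_left (X - C r) h using 1
    simp only [map_neg, map_add, map_mul]; ring

theorem exists_eq_quadratic_mul_quadratic {a b c d e : ℝ} (ha : a ≠ 0) :
    ∃ p q m n : ℝ, b = m + p * a ∧ c = n + p * m + q * a ∧ d = p * n + q * m ∧ e = q * n := by
  set f : ℝ[X] := C a * X ^ 4 + C b * X ^ 3 + C c * X ^ 2 + C d * X + C e with hf
  have hdeg : f.natDegree = 4 := by rw [hf]; compute_degree!
  obtain ⟨p, q, h, hh⟩ := exists_quadratic_dvd (f := f) (by omega)
  have hq : (X ^ 2 + C p * X + C q : ℝ[X]).natDegree = 2 := by compute_degree!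
  have hf0 : f ≠ 0 := by intro h0; rw [h0] at hdeg; simp at hdeg
  have hh2 : h.natDegree < 3 := by
    have := hdeg
    rw [hh, natDegree_mul (left_ne_zero_of_mul (hh ▸ hf0)) (right_ne_zero_of_mul (hh ▸ hf0)),
      hq] at this
    omega
  have hev : ∀ t : ℝ, a * t ^ 4 + b * t ^ 3 + c * t ^ 2 + d * t + e =
      (t ^ 2 + p * t + q) * (h.coeff 0 + h.coeff 1 * t + h.coeff 2 * t ^ 2) := by
    intro t
    have := congrArg (eval t) hh
    rw [eval_mul, eval_eq_sum_range' hh2 t, hf] at this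
    simpa [Finset.sum_range_succ] using this
  have h0 := hev 0
  have h1 := hev 1
  have h2 := hev (-1)
  have h3 := hev 2
  have h4 := hev (-2)
  have e2 : h.coeff 2 = a := by linarith
  refine ⟨p, q, h.coeff 1, h.coeff 0, ?_, ?_, ?_, ?_⟩
  all_goals rw [e2] at h0 h1 h2 h3 h4; linarith

/-- The coordinates `X = p₁ u + q₁ v`, `Y = p₂ u + q₂ v` of determinant one bring the quartic form
with coefficients `a, b, c, d, e` into the shape `± X Y (A X² + B X Y + A Y²)`, with a definite
quadratic factor. -/
structure IsReduction (a b c d e p₁ q₁ p₂ q₂ A B ε : ℝ) : Prop where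
  det : p₁ * q₂ - p₂ * q₁ = 1
  pos : 0 < A
  abs_lt : |B| < 2 * A
  sign : ε = 1 ∨ ε = -1
  eq : ∀ u v : ℝ, a * u ^ 4 + b * u ^ 3 * v + c * u ^ 2 * v ^ 2 + d * u * v ^ 3 + e * v ^ 4 =
    ε * ((p₁ * u + q₁ * v) * (p₂ * u + q₂ * v)) * (A * (p₁ * u + q₁ * v) ^ 2 +
      B * ((p₁ * u + q₁ * v) * (p₂ * u + q₂ * v)) + A * (p₂ * u + q₂ * v) ^ 2)

theorem IsReduction.swap {a b c d e p₁ q₁ p₂ q₂ A B ε : ℝ}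
    (h : IsReduction a b c d e p₁ q₁ p₂ q₂ A B ε) :
    IsReduction a b c d e p₂ q₂ (-p₁) (-q₁) A (-B) (-ε) where
  det := by linarith [h.det]
  pos := h.pos
  abs_lt := by rw [abs_neg]; exact h.abs_lt
  sign := by rcases h.sign with h | h <;> simp [h]
  eq u v := by rw [h.eq]; ring

theorem exists_isReduction_of_mul {a p q m n : ℝ} (ha : a ≠ 0) (hg : p ^ 2 - 4 * q < 0)
    (hh : 0 < m ^ 2 - 4 * a * n) :
    ∃ p₁ q₁ p₂ q₂ A B ε, IsReduction a (m + p * a) (n + p * m + q * a) (p * n + q * m) (q * n)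
      p₁ q₁ p₂ q₂ A B ε ∧ A ^ 4 * (4 * A ^ 2 - B ^ 2) = (4 * q - p ^ 2) * (m ^ 2 - 4 * a * n) *
        ((n - q * a) ^ 2 - (m - p * a) * (p * n - q * m)) ^ 2 := by
  obtain ⟨r₁, r₂, hr, hm, hn⟩ : ∃ r₁ r₂ : ℝ, r₂ < r₁ ∧ m = -a * (r₁ + r₂) ∧ n = a * (r₁ * r₂) := by
    have hs := Real.sq_sqrt hh.le
    have ha' : |a| ^ 2 = a ^ 2 := sq_abs a
    have ha0 : |a| ≠ 0 := abs_ne_zero.2 ha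
    refine ⟨-m / (2 * a) + √(m ^ 2 - 4 * a * n) / (2 * |a|),
      -m / (2 * a) - √(m ^ 2 - 4 * a * n) / (2 * |a|), ?_, ?_, ?_⟩
    · have : 0 < √(m ^ 2 - 4 * a * n) / (2 * |a|) := by positivity
      linarith
    · field_simp; ring
    · have e : (-m / (2 * a) + √(m ^ 2 - 4 * a * n) / (2 * |a|)) *
          (-m / (2 * a) - √(m ^ 2 - 4 * a * n) / (2 * |a|)) =
          (m ^ 2 / (2 * a) ^ 2 - √(m ^ 2 - 4 * a * n) ^ 2 / (4 * |a| ^ 2)) := by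
        field_simp; ring
      rw [e, hs, ha']; field_simp; ring
  subst hm hn
  have hgpos : ∀ t : ℝ, 0 < t ^ 2 + p * t + q := fun t => by nlinarith [sq_nonneg (t + p / 2)]
  obtain ⟨h₁, h₁0, e₁⟩ : ∃ h₁ : ℝ, 0 < h₁ ∧ h₁ ^ 2 = r₁ ^ 2 + p * r₁ + q :=
    ⟨_, Real.sqrt_pos.2 (hgpos r₁), Real.sq_sqrt (hgpos r₁).le⟩
  obtain ⟨h₂, h₂0, e₂⟩ : ∃ h₂ : ℝ, 0 < h₂ ∧ h₂ ^ 2 = r₂ ^ 2 + p * r₂ + q :=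
    ⟨_, Real.sqrt_pos.2 (hgpos r₂), Real.sq_sqrt (hgpos r₂).le⟩
  have hδ : 0 < r₁ - r₂ := by linarith
  obtain ⟨s, s0, hs⟩ : ∃ s : ℝ, 0 < s ∧ s ^ 2 * (h₁ * (r₁ - r₂)) = h₂ := by
    refine ⟨√(h₂ / (h₁ * (r₁ - r₂))), by positivity, ?_⟩
    rw [Real.sq_sqrt (by positivity)]; field_simp
  obtain ⟨s', hs'⟩ : ∃ s' : ℝ, s * s' * (r₁ - r₂) = 1 := ⟨1 / (s * (r₁ - r₂)), by field_simp⟩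
  have hs'2 : s' ^ 2 * (h₂ * (r₁ - r₂)) = h₁ := by
    have : (s * s' * (r₁ - r₂)) ^ 2 = 1 := by rw [hs']; norm_num
    rw [← hs]
    linear_combination h₁ * this
  set G := 2 * r₁ * r₂ + p * (r₁ + r₂) + 2 * q with hG
  have hGlt : (4 * q - p ^ 2) * (r₁ - r₂) ^ 2 = 4 * (h₁ * h₂) ^ 2 - G ^ 2 := by
    rw [mul_pow, e₁, e₂, hG]; ring
  refine ⟨s, -s * r₁, s', -s' * r₂, |a| * (h₁ * h₂), -|a| * G, SignType.sign a, ?_, ?_⟩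
  · refine ⟨by linear_combination hs', by positivity, ?_, ?_, fun u v => ?_⟩
    · rw [abs_mul, abs_neg, abs_abs, mul_left_comm 2]
      have : 0 < |a| := abs_pos.2 ha
      gcongr
      apply abs_lt_of_sq_lt_sq _ (by positivity)
      nlinarith [mul_pos (by linarith : 0 < 4 * q - p ^ 2) (pow_pos hδ 2)]
    · rcases lt_or_gt_of_ne ha with h | h <;> simp [h]
    · have hsa : (SignType.sign a : ℝ) * |a| = a := sign_mul_abs a
      have hδ2 : (r₁ - r₂) ^ 2 ≠ 0 := by positivity
      apply mul_right_cancel₀ hδ2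
      set P := u - r₁ * v with hP
      set Q := u - r₂ * v with hQ
      have eX : s * u + -s * r₁ * v = s * P := by rw [hP]; ring
      have eY : s' * u + -s' * r₂ * v = s' * Q := by rw [hQ]; ring
      rw [eX, eY]
      calc _ = a * (P * Q) * ((r₂ ^ 2 + p * r₂ + q) * P ^ 2 + (r₁ ^ 2 + p * r₁ + q) * Q ^ 2 -
            G * (P * Q)) := by rw [hP, hQ, hG]; ring
        _ = (SignType.sign a * |a|) * (s * s' * (r₁ - r₂)) * (P * Q) *
            (s ^ 2 * (h₁ * (r₁ - r₂)) * h₂ * P ^ 2 + s' ^ 2 * (h₂ * (r₁ - r₂)) * h₁ * Q ^ 2 -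
              G * (s * s' * (r₁ - r₂)) * (P * Q)) := by
            rw [hsa, hs, hs', hs'2, ← e₁, ← e₂]; ring
        _ = _ := by ring
  · have ha2 : |a| ^ 2 = a ^ 2 := sq_abs a
    have hres : (a * (r₁ * r₂) - q * a) ^ 2 - (-a * (r₁ + r₂) - p * a) *
        (p * (a * (r₁ * r₂)) - q * (-a * (r₁ + r₂))) = a ^ 2 * (h₁ * h₂) ^ 2 := by
      rw [mul_pow, e₁, e₂]; ring
    rw [hres]
    calc _ = (|a| ^ 2) ^ 3 * (h₁ * h₂) ^ 4 * (4 * (h₁ * h₂) ^ 2 - G ^ 2) := by ring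
      _ = _ := by rw [ha2, ← hGlt]; ring

theorem exists_isReduction {a b c d e : ℤ} (ha : a ≠ 0) (hD : quarticDisc a b c d e < 0) :
    ∃ p₁ q₁ p₂ q₂ A B ε, IsReduction a b c d e p₁ q₁ p₂ q₂ A B ε ∧
      -(quarticDisc a b c d e : ℝ) = A ^ 4 * (4 * A ^ 2 - B ^ 2) := by
  have ha' : (a : ℝ) ≠ 0 := by exact_mod_cast ha
  obtain ⟨p, q, m, n, hb, hc, hd, he⟩ :=
    exists_eq_quadratic_mul_quadratic (b := b) (c := c) (d := d) (e := e) ha'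
  have hD' : (quarticDisc a b c d e : ℝ) = (p ^ 2 - 4 * q) * (m ^ 2 - 4 * a * n) *
      ((n - q * a) ^ 2 - (m - p * a) * (p * n - q * m)) ^ 2 := by
    rw [quarticDisc]
    push_cast
    rw [hb, hc, hd, he]
    ring
  have hD0 : (quarticDisc a b c d e : ℝ) < 0 := by exact_mod_cast hD
  have hneg : (p ^ 2 - 4 * q) * (m ^ 2 - 4 * a * n) < 0 := by
    rw [hD'] at hD0
    exact neg_of_mul_neg_left hD0 (sq_nonneg _)
  rw [hb, hc, hd, he, hD']
  rcases mul_neg_iff.1 hneg with ⟨h1, h2⟩ | ⟨h1, h2⟩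
  · have h3 : (m / a) ^ 2 - 4 * (n / a) < 0 := by
      have : (m / a) ^ 2 - 4 * (n / a) = (m ^ 2 - 4 * a * n) / a ^ 2 := by field_simp
      rw [this]
      exact div_neg_of_neg_of_pos h2 (by positivity)
    have h4 : 0 < (p * a) ^ 2 - 4 * a * (q * a) := by
      have : (p * a) ^ 2 - 4 * a * (q * a) = a ^ 2 * (p ^ 2 - 4 * q) := by ring
      rw [this]; positivity
    obtain ⟨p₁, q₁, p₂, q₂, A, B, ε, hred, hAB⟩ := exists_isReduction_of_mul ha' h3 h4
    refine ⟨p₁, q₁, p₂, q₂, A, B, ε, ?_, ?_⟩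
    · convert hred using 1 <;> field_simp <;> ring
    · rw [hAB]; field_simp; ring
  · obtain ⟨p₁, q₁, p₂, q₂, A, B, ε, hred, hAB⟩ := exists_isReduction_of_mul ha' h1 h2
    exact ⟨p₁, q₁, p₂, q₂, A, B, ε, hred, by rw [hAB]; ring⟩

theorem exists_mvPolynomial_eval_eq {P : ℚ[X]} (hP : P.natDegree ≠ 0) (u₀ v₀ u₁ v₁ : ℚ) :
    ∃ H : MvPolynomial (Fin 2) ℚ, MvPolynomial.eval 0 H = 0 ∧ ∀ x : Fin 2 → ℚ,
      u₀ * x 1 - v₀ * x 0 ≠ 0 → MvPolynomial.eval x H = (u₀ * x 1 - v₀ * x 0) ^ P.natDegree *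
        P.eval ((v₁ * x 0 - u₁ * x 1) / (u₀ * x 1 - v₀ * x 0)) := by
  refine ⟨∑ k ∈ Finset.range (P.natDegree + 1), MvPolynomial.C (P.coeff k) *
    (MvPolynomial.C v₁ * MvPolynomial.X 0 - MvPolynomial.C u₁ * MvPolynomial.X 1) ^ k *
    (MvPolynomial.C u₀ * MvPolynomial.X 1 - MvPolynomial.C v₀ * MvPolynomial.X 0) ^
      (P.natDegree - k), ?_, fun x hx => ?_⟩
  · simp only [map_sum, map_mul, map_pow, map_sub, MvPolynomial.eval_C, MvPolynomial.eval_X,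
      Pi.zero_apply, mul_zero, sub_zero]
    refine Finset.sum_eq_zero fun k hk => ?_
    rw [mul_assoc, ← pow_add, zero_pow (by rw [Finset.mem_range] at hk; omega), mul_zero]
  · simp only [map_sum, map_mul, map_pow, map_sub, MvPolynomial.eval_C, MvPolynomial.eval_X]
    rw [eval_eq_sum_range, Finset.mul_sum]
    refine Finset.sum_congr rfl fun k hk => ?_
    rw [Finset.mem_range] at hk
    have : (u₀ * x 1 - v₀ * x 0) ^ P.natDegree = (u₀ * x 1 - v₀ * x 0) ^ (P.natDegree - k) *
      (u₀ * x 1 - v₀ * x 0) ^ k := by rw [← pow_add]; congr 1; omega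
    rw [this, div_pow]
    generalize u₀ * x 1 - v₀ * x 0 = t at hx ⊢
    field_simp

/-- The polynomial `F(u₀ t + u₁, v₀ t + v₁)` in `t`. -/
noncomputable def quarticLine {R : Type*} [CommRing R] (a b c d e u₀ v₀ u₁ v₁ : R) : R[X] :=
  C a * (C u₀ * X + C u₁) ^ 4 + C b * (C u₀ * X + C u₁) ^ 3 * (C v₀ * X + C v₁) +
    C c * (C u₀ * X + C u₁) ^ 2 * (C v₀ * X + C v₁) ^ 2 +
    C d * (C u₀ * X + C u₁) * (C v₀ * X + C v₁) ^ 3 + C e * (C v₀ * X + C v₁) ^ 4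

theorem eval_quarticLine {R : Type*} [CommRing R] (a b c d e u₀ v₀ u₁ v₁ t : R) :
    (quarticLine a b c d e u₀ v₀ u₁ v₁).eval t =
      a * (u₀ * t + u₁) ^ 4 + b * (u₀ * t + u₁) ^ 3 * (v₀ * t + v₁) +
        c * (u₀ * t + u₁) ^ 2 * (v₀ * t + v₁) ^ 2 + d * (u₀ * t + u₁) * (v₀ * t + v₁) ^ 3 +
        e * (v₀ * t + v₁) ^ 4 := by
  simp [quarticLine]

theorem map_quarticLine {R S : Type*} [CommRing R] [CommRing S] (φ : R →+* S)
    (a b c d e u₀ v₀ u₁ v₁ : R) : (quarticLine a b c d e u₀ v₀ u₁ v₁).map φ =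
      quarticLine (φ a) (φ b) (φ c) (φ d) (φ e) (φ u₀) (φ v₀) (φ u₁) (φ v₁) := by
  simp [quarticLine, Polynomial.map_add, Polynomial.map_mul, Polynomial.map_pow]

theorem irreducible_quarticLine {a b c d e : ℚ} (hF : Irreducible
      (MvPolynomial.C a * MvPolynomial.X 0 ^ 4 +
        MvPolynomial.C b * MvPolynomial.X 0 ^ 3 * MvPolynomial.X 1 +
        MvPolynomial.C c * MvPolynomial.X 0 ^ 2 * MvPolynomial.X 1 ^ 2 +
        MvPolynomial.C d * MvPolynomial.X 0 * MvPolynomial.X 1 ^ 3 +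
        MvPolynomial.C e * MvPolynomial.X 1 ^ 4 : MvPolynomial (Fin 2) ℚ))
    {u₀ v₀ u₁ v₁ ε : ℚ} (hdet : u₀ * v₁ - u₁ * v₀ = 1) (hε : ε ^ 2 = 1)
    (hmonic : (C ε * quarticLine a b c d e u₀ v₀ u₁ v₁).Monic)
    (hdeg : (C ε * quarticLine a b c d e u₀ v₀ u₁ v₁).natDegree = 4) :
    Irreducible (C ε * quarticLine a b c d e u₀ v₀ u₁ v₁) := by
  rw [hmonic.irreducible_iff_natDegree]
  refine ⟨fun h => by simp [h] at hdeg, fun P Q hP hQ hPQ => ?_⟩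
  by_contra! hne
  obtain ⟨H₁, hH₁0, hH₁⟩ := exists_mvPolynomial_eval_eq hne.1 u₀ v₀ u₁ v₁
  obtain ⟨H₂, hH₂0, hH₂⟩ := exists_mvPolynomial_eval_eq hne.2 u₀ v₀ u₁ v₁
  rw [← hPQ, hP.natDegree_mul hQ] at hdeg
  set T : MvPolynomial (Fin 2) ℚ :=
    MvPolynomial.C u₀ * MvPolynomial.X 1 - MvPolynomial.C v₀ * MvPolynomial.X 0 with hT
  have hT0 : T ≠ 0 := by
    intro h
    have := congrArg (MvPolynomial.eval ![u₁, v₁]) h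
    rw [hT] at this
    simp only [map_sub, map_mul, MvPolynomial.eval_C, MvPolynomial.eval_X, map_zero,
      Matrix.cons_val] at this
    linarith
  have hfac : T * (MvPolynomial.C a * MvPolynomial.X 0 ^ 4 +
        MvPolynomial.C b * MvPolynomial.X 0 ^ 3 * MvPolynomial.X 1 +
        MvPolynomial.C c * MvPolynomial.X 0 ^ 2 * MvPolynomial.X 1 ^ 2 +
        MvPolynomial.C d * MvPolynomial.X 0 * MvPolynomial.X 1 ^ 3 +
        MvPolynomial.C e * MvPolynomial.X 1 ^ 4) = T * (MvPolynomial.C ε * H₁ * H₂) := by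
    refine MvPolynomial.funext fun x => ?_
    have hTx : MvPolynomial.eval x T = u₀ * x 1 - v₀ * x 0 := by simp [hT]
    rw [map_mul, map_mul, hTx]
    by_cases hx : u₀ * x 1 - v₀ * x 0 = 0
    · rw [hx, zero_mul, zero_mul]
    congr 1
    rw [map_mul, map_mul, hH₁ x hx, hH₂ x hx]
    have e1 := congrArg (eval ((v₁ * x 0 - u₁ * x 1) / (u₀ * x 1 - v₀ * x 0))) hPQ
    rw [eval_mul, eval_mul, eval_C, eval_quarticLine] at e1
    simp only [map_add, map_mul, map_pow, MvPolynomial.eval_C, MvPolynomial.eval_X]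
    set t := u₀ * x 1 - v₀ * x 0 with ht
    set s := v₁ * x 0 - u₁ * x 1 with hs
    have e2 : t * (u₀ * (s / t) + u₁) = x 0 := by
      have : t * (u₀ * (s / t) + u₁) = u₀ * s + u₁ * t := by field_simp
      rw [this, hs, ht]; linear_combination (x 0) * hdet
    have e3 : t * (v₀ * (s / t) + v₁) = x 1 := by
      have : t * (v₀ * (s / t) + v₁) = v₀ * s + v₁ * t := by field_simp
      rw [this, hs, ht]; linear_combination (x 1) * hdet
    have e4 : t ^ P.natDegree * t ^ Q.natDegree = t ^ 4 := by rw [← pow_add, hdeg]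
    rw [show ε * (t ^ P.natDegree * eval (s / t) P) * (t ^ Q.natDegree * eval (s / t) Q) =
      ε * (t ^ P.natDegree * t ^ Q.natDegree) * (eval (s / t) P * eval (s / t) Q) by ring, e4, e1,
      ← e2, ← e3]
    linear_combination (-t ^ 4 * (a * (u₀ * (s / t) + u₁) ^ 4 +
        b * (u₀ * (s / t) + u₁) ^ 3 * (v₀ * (s / t) + v₁) +
        c * (u₀ * (s / t) + u₁) ^ 2 * (v₀ * (s / t) + v₁) ^ 2 +
        d * (u₀ * (s / t) + u₁) * (v₀ * (s / t) + v₁) ^ 3 +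
        e * (v₀ * (s / t) + v₁) ^ 4)) * hε
  rcases hF.isUnit_or_isUnit (mul_left_cancel₀ hT0 hfac) with h | h
  · have := h.map (MvPolynomial.eval (0 : Fin 2 → ℚ))
    rw [map_mul, hH₁0, mul_zero] at this
    exact not_isUnit_zero this
  · have := h.map (MvPolynomial.eval (0 : Fin 2 → ℚ))
    rw [hH₂0] at this
    exact not_isUnit_zero this

theorem IsReduction.exists_map_eq {a b c d e p₁ q₁ p₂ q₂ A B ε : ℝ}
    (h : IsReduction a b c d e p₁ q₁ p₂ q₂ A B ε) {u₀ v₀ u₁ v₁ ε₀ X₀ Y₀ X₁ Y₁ Q₀ : ℝ}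
    (hdet : u₀ * v₁ - u₁ * v₀ = 1) (hε₀ : ε₀ ^ 2 = 1)
    (hF : a * u₀ ^ 4 + b * u₀ ^ 3 * v₀ + c * u₀ ^ 2 * v₀ ^ 2 + d * u₀ * v₀ ^ 3 + e * v₀ ^ 4 = ε₀)
    (hX₀ : X₀ = p₁ * u₀ + q₁ * v₀) (hY₀ : Y₀ = p₂ * u₀ + q₂ * v₀) (hX₁ : X₁ = p₁ * u₁ + q₁ * v₁)
    (hY₁ : Y₁ = p₂ * u₁ + q₂ * v₁) (hQ₀ : Q₀ = A * X₀ ^ 2 + B * (X₀ * Y₀) + A * Y₀ ^ 2) :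
    ∃ γ : ℂ, γ.im ≠ 0 ∧ ‖γ - (-Y₁ / Y₀ : ℝ)‖ ^ 2 = A / (Y₀ ^ 2 * Q₀) ∧
      (C ε₀ * quarticLine a b c d e u₀ v₀ u₁ v₁).map (algebraMap ℝ ℂ) =
        (X - C ((-X₁ / X₀ : ℝ) : ℂ)) * (X - C ((-Y₁ / Y₀ : ℝ) : ℂ)) * (X - C γ) *
          (X - C ((starRingEnd ℂ) γ)) := by
  have hdet' : X₀ * Y₁ - X₁ * Y₀ = 1 := by
    rw [hX₀, hY₀, hX₁, hY₁]
    linear_combination (u₀ * v₁ - u₁ * v₀) * h.det + hdet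
  have h1 : ε * (X₀ * Y₀) * Q₀ = ε₀ := by rw [← hF, h.eq, hQ₀, hX₀, hY₀]
  have hne : ε₀ ≠ 0 := by rintro rfl; norm_num at hε₀
  have hQ0 : Q₀ ≠ 0 := by rintro h0; rw [h0, mul_zero] at h1; exact hne h1.symm
  have hX0 : X₀ ≠ 0 := by rintro h0; rw [h0] at h1; simp at h1; exact hne h1.symm
  have hY0 : Y₀ ≠ 0 := by rintro h0; rw [h0] at h1; simp at h1; exact hne h1.symm
  set r := (2 * A * (X₀ * X₁ + Y₀ * Y₁) + B * (X₀ * Y₁ + X₁ * Y₀)) / Q₀ with hr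
  set s := (A * X₁ ^ 2 + B * (X₁ * Y₁) + A * Y₁ ^ 2) / Q₀ with hs
  have hreal : C ε₀ * quarticLine a b c d e u₀ v₀ u₁ v₁ =
      (X - C (-X₁ / X₀)) * (X - C (-Y₁ / Y₀)) * (X ^ 2 + C r * X + C s) := by
    refine Polynomial.funext fun t => ?_
    rw [eval_mul, eval_C, eval_quarticLine, h.eq]
    simp only [eval_mul, eval_sub, eval_add, eval_pow, eval_X, eval_C]
    have e1 : p₁ * (u₀ * t + u₁) + q₁ * (v₀ * t + v₁) = X₀ * (t - -X₁ / X₀) := by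
      field_simp; rw [hX₀, hX₁]; ring
    have e2 : p₂ * (u₀ * t + u₁) + q₂ * (v₀ * t + v₁) = Y₀ * (t - -Y₁ / Y₀) := by
      field_simp; rw [hY₀, hY₁]; ring
    have e3 : A * (X₀ * (t - -X₁ / X₀)) ^ 2 + B * (X₀ * (t - -X₁ / X₀) * (Y₀ * (t - -Y₁ / Y₀))) +
        A * (Y₀ * (t - -Y₁ / Y₀)) ^ 2 = Q₀ * (t ^ 2 + r * t + s) := by
      rw [hr, hs]; field_simp; rw [hQ₀]; ring
    rw [e1, e2, e3]
    calc _ = ε₀ * (ε * (X₀ * Y₀) * Q₀) *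
          ((t - -X₁ / X₀) * (t - -Y₁ / Y₀) * (t ^ 2 + r * t + s)) := by ring
      _ = _ := by rw [h1, ← sq, hε₀, one_mul]
  have hdisc : 4 * s - r ^ 2 = (4 * A ^ 2 - B ^ 2) / Q₀ ^ 2 := by
    rw [hr, hs]; field_simp
    have : (X₀ * Y₁ - X₁ * Y₀) ^ 2 = 1 := by rw [hdet']; norm_num
    rw [hQ₀]; linear_combination (4 * A ^ 2 - B ^ 2) * this
  have hpos : 0 < 4 * s - r ^ 2 := by
    rw [hdisc]
    have h3 := _root_.abs_lt.1 h.abs_lt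
    have : 0 < 4 * A ^ 2 - B ^ 2 := by nlinarith
    positivity
  refine ⟨⟨-r / 2, √(4 * s - r ^ 2) / 2⟩, by positivity, ?_, ?_⟩
  · rw [← Complex.normSq_eq_norm_sq, Complex.normSq_apply]
    simp only [Complex.sub_re, Complex.sub_im, Complex.ofReal_re, Complex.ofReal_im, sub_zero]
    have e : √(4 * s - r ^ 2) / 2 * (√(4 * s - r ^ 2) / 2) = s - r ^ 2 / 4 := by
      have := Real.mul_self_sqrt hpos.le
      linarith
    rw [e]
    calc _ = (-Y₁ / Y₀) ^ 2 + r * (-Y₁ / Y₀) + s := by ring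
      _ = A * (X₀ * Y₁ - X₁ * Y₀) ^ 2 / (Y₀ ^ 2 * Q₀) := by
        rw [hr, hs]; field_simp; rw [hQ₀]; ring
      _ = _ := by rw [hdet']; ring
  · rw [hreal]
    set γ : ℂ := ⟨-r / 2, √(4 * s - r ^ 2) / 2⟩ with hγ
    have e1 : γ + (starRingEnd ℂ) γ = -(r : ℂ) := by
      rw [Complex.add_conj, hγ]; push_cast; ring
    have e2 : γ * (starRingEnd ℂ) γ = (s : ℂ) := by
      rw [Complex.mul_conj, Complex.normSq_apply, hγ]
      have := Real.mul_self_sqrt hpos.le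
      congr 1
      change -r / 2 * (-r / 2) + √(4 * s - r ^ 2) / 2 * (√(4 * s - r ^ 2) / 2) = s
      linarith
    have e3 : (X - C γ) * (X - C ((starRingEnd ℂ) γ)) = X ^ 2 + C (r : ℂ) * X + C (s : ℂ) := by
      rw [← e2, show (r : ℂ) = -(γ + (starRingEnd ℂ) γ) by rw [e1]; ring]
      simp only [map_neg, map_add, map_mul]; ring
    rw [mul_assoc _ (X - C γ), e3]
    simp [Polynomial.map_mul]

theorem cubic_bounds {A B X Y : ℝ} (hA : 0 < A) (hB : |B| < 2 * A)
    (h : |X * Y| * (A * X ^ 2 + B * (X * Y) + A * Y ^ 2) = 1) (hXY : 2 * |X| ≤ |Y|) :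
    A * Y ^ 2 / 4 ≤ A * X ^ 2 + B * (X * Y) + A * Y ^ 2 ∧ 4 ≤ 9 * (A * |X| * |Y| ^ 3) ∧
      A * |X| * |Y| ^ 3 ≤ 4 ∧ 8 ≤ 9 * A * Y ^ 4 := by
  have h1 : |B * (X * Y)| ≤ 2 * A * (|X| * |Y|) := by
    rw [abs_mul, abs_mul]; gcongr
  obtain ⟨h2, h3⟩ := abs_le.1 h1
  have eX := sq_abs X
  have eY := sq_abs Y
  have eY4 : Y ^ 4 = |Y| ^ 4 := by rw [show (4 : ℕ) = 2 * 2 by norm_num, pow_mul, pow_mul, eY]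
  rw [abs_mul] at h
  rw [eY4]
  rw [← eX, ← eY] at h ⊢
  set x := |X|
  set y := |Y|
  have hx : 0 ≤ x := abs_nonneg X
  have hy : 0 ≤ y := abs_nonneg Y
  have l : A * y ^ 2 / 4 ≤ A * x ^ 2 + B * (X * Y) + A * y ^ 2 := by
    have : A * (y / 2) ^ 2 ≤ A * (y - x) ^ 2 := by
      gcongr; linarith
    linarith
  have u : A * x ^ 2 + B * (X * Y) + A * y ^ 2 ≤ A * y ^ 2 * (9 / 4) := by
    have : A * (x + y) ^ 2 ≤ A * (3 / 2 * y) ^ 2 := by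
      gcongr; linarith
    linarith
  have hxy : 0 ≤ x * y := by positivity
  have m1 := mul_le_mul_of_nonneg_left l hxy
  have m2 := mul_le_mul_of_nonneg_left u hxy
  have m3 : A * x * y ^ 3 ≤ A * (y / 2) * y ^ 3 := by gcongr; linarith
  exact ⟨l, by linarith, by linarith, by linarith⟩

theorem coordinate_bounds {x y α₁ α₂ w : ℝ} (hw : 0 ≤ w) (hα₂ : |α₂| ≤ 1)
    (hd : 2 ≤ |α₁ - α₂|) (h₁ : |x - α₁ * y| ≤ 9 * Real.exp (-3 * w))
    (h₂ : |x - α₂ * y| = Real.exp w) :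
    |x - α₁ * y| ≤ 15 * Real.exp (-3 * w) ∧ |y| * max 1 |α₁| ≤ 15 * Real.exp w ∧
      |x| ≤ 15 * Real.exp w ∧ Real.exp w ≤ 15 * max |x| |y| := by
  have hE : Real.exp (-3 * w) ≤ Real.exp w := Real.exp_le_exp.2 (by linarith)
  have hE0 : 0 < Real.exp (-3 * w) := Real.exp_pos _
  have hyK : |y| * |α₁ - α₂| ≤ 10 * Real.exp w := by
    have e : |y| * |α₁ - α₂| = |(x - α₂ * y) - (x - α₁ * y)| := by
      rw [← abs_mul]; congr 1; ring
    rw [e]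
    have := abs_sub (x - α₂ * y) (x - α₁ * y)
    linarith
  have hy : |y| ≤ 5 * Real.exp w := by
    have := mul_le_mul_of_nonneg_left hd (abs_nonneg y)
    linarith
  have hα₁ : |α₁| ≤ 1 + |α₁ - α₂| := by
    have := abs_add_le (α₁ - α₂) α₂
    rw [sub_add_cancel] at this
    linarith
  have hα₂y : |α₂ * y| ≤ |y| := by
    rw [abs_mul]; exact mul_le_of_le_one_left (abs_nonneg y) hα₂
  refine ⟨by linarith, ?_, ?_, ?_⟩
  · rw [mul_max_of_nonneg _ _ (abs_nonneg y)]
    have := mul_le_mul_of_nonneg_left hα₁ (abs_nonneg y)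
    apply max_le <;> linarith
  · have := abs_add_le (x - α₂ * y) (α₂ * y)
    rw [sub_add_cancel] at this
    linarith
  · have := abs_sub x (α₂ * y)
    have m1 := le_max_left |x| |y|
    have m2 := le_max_right |x| |y|
    linarith [abs_nonneg x]

theorem abs_div_le_of_cubic {A X₀ Y₀ X Y w : ℝ} (h₀ : 4 ≤ 9 * (A * |X₀| * |Y₀| ^ 3))
    (h : A * |X| * |Y| ^ 3 ≤ 4) (hA : 0 < A) (hw : |Y / Y₀| = Real.exp w) :
    |X / X₀| ≤ 9 * Real.exp (-3 * w) := by
  have hX₀ : 0 < |X₀| := by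
    rcases (abs_nonneg X₀).eq_or_lt with h | h
    · rw [← h] at h₀; norm_num at h₀
    · exact h
  have hY₀ : 0 < |Y₀| := by
    rcases (abs_nonneg Y₀).eq_or_lt with h | h
    · rw [← h] at h₀; norm_num at h₀
    · exact h
  have hYw : |Y| = Real.exp w * |Y₀| := by
    rw [← hw, abs_div]; field_simp
  have e : Real.exp (-3 * w) * Real.exp w ^ 3 = 1 := by
    rw [← Real.exp_nat_mul, ← Real.exp_add, Real.exp_eq_one_iff]; push_cast; ring
  rw [abs_div, div_le_iff₀ hX₀]
  have hpos : 0 < A * Real.exp w ^ 3 * |Y₀| ^ 3 := by positivity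
  refine le_of_mul_le_mul_right ?_ hpos
  calc |X| * (A * Real.exp w ^ 3 * |Y₀| ^ 3) = A * |X| * |Y| ^ 3 := by rw [hYw]; ring
    _ ≤ 9 * (A * |X₀| * |Y₀| ^ 3) := h.trans h₀
    _ = 9 * (Real.exp (-3 * w) * Real.exp w ^ 3) * (A * |X₀| * |Y₀| ^ 3) := by rw [e]; ring
    _ = _ := by ring

theorem IsReduction.abs_mul_eq_one {a b c d e : ℤ} {p₁ q₁ p₂ q₂ A B ε : ℝ}
    (h : IsReduction a b c d e p₁ q₁ p₂ q₂ A B ε) {u v : ℤ}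
    (hF : quarticFormVal a b c d e (u, v) = 1 ∨ quarticFormVal a b c d e (u, v) = -1) :
    |(p₁ * u + q₁ * v) * (p₂ * u + q₂ * v)| * (A * (p₁ * u + q₁ * v) ^ 2 +
      B * ((p₁ * u + q₁ * v) * (p₂ * u + q₂ * v)) + A * (p₂ * u + q₂ * v) ^ 2) = 1 := by
  have h1 := h.eq u v
  have h2 :
      |(a * u ^ 4 + b * u ^ 3 * v + c * u ^ 2 * v ^ 2 + d * u * v ^ 3 + e * v ^ 4 : ℝ)| = 1 := by
    have : (a * u ^ 4 + b * u ^ 3 * v + c * u ^ 2 * v ^ 2 + d * u * v ^ 3 + e * v ^ 4 : ℝ) =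
      (quarticFormVal a b c d e (u, v) : ℤ) := by simp [quarticFormVal]
    rw [this]
    rcases hF with h | h <;> simp [h]
  have hε : |ε| = 1 := by rcases h.sign with h | h <;> simp [h]
  have hq : ∀ X Y : ℝ, 0 ≤ A * X ^ 2 + B * (X * Y) + A * Y ^ 2 := fun X Y => by
    have h3 := _root_.abs_lt.1 h.abs_lt
    nlinarith [sq_nonneg (X + Y), sq_nonneg (X - Y)]
  rw [h1, abs_mul, abs_mul, hε, one_mul, abs_of_nonneg (hq _ _)] at h2
  exact h2

theorem isCoprime_of_quarticFormVal {a b c d e x y : ℤ}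
    (h : quarticFormVal a b c d e (x, y) = 1 ∨ quarticFormVal a b c d e (x, y) = -1) :
    IsCoprime x y := by
  have e1 : quarticFormVal a b c d e (x, y) = (a * x ^ 3 + b * x ^ 2 * y + c * x * y ^ 2 +
      d * y ^ 3) * x + (e * y ^ 3) * y := by simp only [quarticFormVal]; ring
  rcases h with h | h
  · exact ⟨_, _, e1.symm.trans h⟩
  · exact ⟨-(a * x ^ 3 + b * x ^ 2 * y + c * x * y ^ 2 + d * y ^ 3), -(e * y ^ 3), by linarith⟩

theorem IsReduction.false_of_large {a b c d e : ℤ} (hirr : Irreducible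
      (MvPolynomial.C (a : ℚ) * MvPolynomial.X 0 ^ 4 +
        MvPolynomial.C (b : ℚ) * MvPolynomial.X 0 ^ 3 * MvPolynomial.X 1 +
        MvPolynomial.C (c : ℚ) * MvPolynomial.X 0 ^ 2 * MvPolynomial.X 1 ^ 2 +
        MvPolynomial.C (d : ℚ) * MvPolynomial.X 0 * MvPolynomial.X 1 ^ 3 +
        MvPolynomial.C (e : ℚ) * MvPolynomial.X 1 ^ 4 : MvPolynomial (Fin 2) ℚ))
    {p₁ q₁ p₂ q₂ A B ε : ℝ} (h : IsReduction a b c d e p₁ q₁ p₂ q₂ A B ε)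
    {u₀ v₀ u v u' v' : ℤ} {X₀ Y₀ X₁ Y₁ X₂ Y₂ w w₂ : ℝ}
    (hX₀ : X₀ = p₁ * u₀ + q₁ * v₀) (hY₀ : Y₀ = p₂ * u₀ + q₂ * v₀)
    (hX₁ : X₁ = p₁ * u + q₁ * v) (hY₁ : Y₁ = p₂ * u + q₂ * v)
    (hX₂ : X₂ = p₁ * u' + q₁ * v') (hY₂ : Y₂ = p₂ * u' + q₂ * v')
    (hF₀ : quarticFormVal a b c d e (u₀, v₀) = 1 ∨ quarticFormVal a b c d e (u₀, v₀) = -1)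
    (hF₁ : quarticFormVal a b c d e (u, v) = 1 ∨ quarticFormVal a b c d e (u, v) = -1)
    (hF₂ : quarticFormVal a b c d e (u', v') = 1 ∨ quarticFormVal a b c d e (u', v') = -1)
    (hT₀ : 2 * |X₀| ≤ |Y₀|) (hT₁ : 2 * |X₁| ≤ |Y₁|) (hT₂ : 2 * |X₂| ≤ |Y₂|)
    (hd₁ : u₀ * v - v₀ * u ≠ 0) (hd₂ : u₀ * v' - v₀ * u' ≠ 0) (hA : 8 ≤ A * Y₀ ^ 2)
    (hw₁ : |Y₁ / Y₀| = Real.exp w) (hw₂ : |Y₂ / Y₀| = Real.exp w₂)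
    (hM : (1 + 9 / 4 * (A * Y₀ ^ 2)) * (1 + 2 / Y₀ ^ 2) ^ 2 ≤ Real.exp (w / 39.9))
    (hw : 100000 * (3 * Real.log 15 + 109) ≤ w) (hww : 3 * w ≤ w₂) : False := by
  obtain ⟨h₀l, h₀4, h₀u, -⟩ := cubic_bounds h.pos h.abs_lt
    (by rw [hX₀, hY₀]; exact h.abs_mul_eq_one hF₀) hT₀
  obtain ⟨-, -, h₁u, -⟩ := cubic_bounds h.pos h.abs_lt
    (by rw [hX₁, hY₁]; exact h.abs_mul_eq_one hF₁) hT₁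
  obtain ⟨-, -, h₂u, -⟩ := cubic_bounds h.pos h.abs_lt
    (by rw [hX₂, hY₂]; exact h.abs_mul_eq_one hF₂) hT₂
  have hY0 : Y₀ ≠ 0 := by rintro rfl; norm_num at hA
  have hX0 : X₀ ≠ 0 := by rintro rfl; norm_num at h₀4
  -- a unimodular basis starting with the first solution
  obtain ⟨u₁, v₁, hdet, hα₂0, hα₂1⟩ : ∃ u₁ v₁ : ℤ, u₀ * v₁ - u₁ * v₀ = 1 ∧
      0 ≤ -(p₂ * u₁ + q₂ * v₁) / Y₀ ∧ -(p₂ * u₁ + q₂ * v₁) / Y₀ ≤ 1 := by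
    obtain ⟨r, s, hrs⟩ := isCoprime_of_quarticFormVal hF₀
    set k := ⌊-(p₂ * (-s : ℤ) + q₂ * (r : ℤ)) / Y₀⌋ with hk
    have e1 : -(p₂ * ((-s + k * u₀ : ℤ) : ℝ) + q₂ * ((r + k * v₀ : ℤ) : ℝ)) / Y₀ =
        Int.fract (-(p₂ * (-s : ℤ) + q₂ * (r : ℤ)) / Y₀) := by
      rw [Int.fract, ← hk]
      push_cast
      field_simp
      rw [hY₀]; ring
    refine ⟨-s + k * u₀, r + k * v₀, by linarith, ?_, ?_⟩
    · rw [e1]; exact Int.fract_nonneg _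
    · rw [e1]; exact (Int.fract_lt_one _).le
  have hdetR : (u₀ : ℝ) * v₁ - u₁ * v₀ = 1 := by exact_mod_cast hdet
  obtain ⟨X', hX'⟩ : ∃ X', X' = p₁ * u₁ + q₁ * v₁ := ⟨_, rfl⟩
  obtain ⟨Y', hY'⟩ : ∃ Y', Y' = p₂ * u₁ + q₂ * v₁ := ⟨_, rfl⟩
  rw [← hY'] at hα₂0 hα₂1
  obtain ⟨ε₀, hε₀⟩ : ∃ ε₀, ε₀ = quarticFormVal a b c d e (u₀, v₀) := ⟨_, rfl⟩
  have hε₀2 : ε₀ ^ 2 = 1 := by rw [hε₀]; rcases hF₀ with h | h <;> simp [h]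
  obtain ⟨γ, hγ0, hγ, hmap⟩ := h.exists_map_eq hdetR (ε₀ := ε₀) (by exact_mod_cast hε₀2)
    (by rw [hε₀]; simp [quarticFormVal]) hX₀ hY₀ hX' hY' rfl
  have hdet' : X₀ * Y' - X' * Y₀ = 1 := by
    rw [hX₀, hY₀, hX', hY']
    linear_combination ((u₀ : ℝ) * v₁ - u₁ * v₀) * h.det + hdetR
  set f : ℤ[X] := C ε₀ * quarticLine a b c d e u₀ v₀ u₁ v₁ with hf
  have hfC : f.map (Int.castRingHom ℂ) = (X - C ((-X' / X₀ : ℝ) : ℂ)) *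
      (X - C ((-Y' / Y₀ : ℝ) : ℂ)) * (X - C γ) * (X - C ((starRingEnd ℂ) γ)) := by
    rw [← hmap, hf]
    simp only [Polynomial.map_mul, map_quarticLine, Polynomial.map_C]
    simp
  have hmonic : f.Monic := by
    apply monic_of_injective (f := Int.castRingHom ℂ) Int.cast_injective
    rw [hfC]
    exact (((monic_X_sub_C _).mul (monic_X_sub_C _)).mul (monic_X_sub_C _)).mul (monic_X_sub_C _)
  have hdeg : f.natDegree = 4 := by
    rw [← hmonic.natDegree_map (Int.castRingHom ℂ), hfC, ← prod_X_sub_C_four,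
      natDegree_prod_of_monic _ _ (fun i _ => monic_X_sub_C _)]
    simp
  have hfQ : f.map (Int.castRingHom ℚ) = C (ε₀ : ℚ) *
      quarticLine (a : ℚ) b c d e u₀ v₀ u₁ v₁ := by
    rw [hf]
    simp only [Polynomial.map_mul, map_quarticLine, Polynomial.map_C]
    simp
  have hirrf : Irreducible (f.map (Int.castRingHom ℚ)) := by
    have m := hmonic.map (Int.castRingHom ℚ)
    have n := hmonic.natDegree_map (Int.castRingHom ℚ)
    rw [hdeg] at n
    rw [hfQ] at m n ⊢
    exact irreducible_quarticLine hirr (by exact_mod_cast hdet) (by exact_mod_cast hε₀2) m n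
  have hx : ∀ s t : ℝ, ((s * v₁ - t * u₁) - -X' / X₀ * (u₀ * t - v₀ * s)) =
      (p₁ * s + q₁ * t) / X₀ := fun s t => by
    field_simp
    rw [hX₀, hX']
    linear_combination (p₁ * s + q₁ * t) * hdetR
  have hy : ∀ s t : ℝ, ((s * v₁ - t * u₁) - -Y' / Y₀ * (u₀ * t - v₀ * s)) =
      (p₂ * s + q₂ * t) / Y₀ := fun s t => by
    field_simp
    rw [hY₀, hY']
    linear_combination (p₂ * s + q₂ * t) * hdetR
  obtain ⟨x₁, y₁, hy₁, hc₁, hx₁α, hy₁α⟩ : ∃ x₁ y₁ : ℤ, 0 < y₁ ∧ IsCoprime x₁ y₁ ∧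
      |x₁ - -X' / X₀ * y₁| = |X₁ / X₀| ∧ |x₁ - -Y' / Y₀ * y₁| = |Y₁ / Y₀| := by
    have hc : IsCoprime (u * v₁ - v * u₁) (u₀ * v - v₀ * u) := by
      obtain ⟨r, s, hrs⟩ := isCoprime_of_quarticFormVal hF₁
      exact ⟨r * u₀ + s * v₀, r * u₁ + s * v₁, by
        linear_combination hrs + (r * u + s * v) * hdet⟩
    have e1 := hx u v
    have e2 := hy u v
    rw [← hX₁] at e1
    rw [← hY₁] at e2
    rcases lt_or_gt_of_ne hd₁ with hlt | hlt
    · refine ⟨-(u * v₁ - v * u₁), -(u₀ * v - v₀ * u), by omega, hc.neg_neg, ?_, ?_⟩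
      · rw [← e1, ← abs_neg]; push_cast; congr 1; ring
      · rw [← e2, ← abs_neg]; push_cast; congr 1; ring
    · refine ⟨u * v₁ - v * u₁, u₀ * v - v₀ * u, hlt, hc, ?_, ?_⟩
      · rw [← e1]; push_cast; rfl
      · rw [← e2]; push_cast; rfl
  have hx₂α : |((u' * v₁ - v' * u₁ : ℤ) : ℝ) - -X' / X₀ * ((u₀ * v' - v₀ * u' : ℤ) : ℝ)| =
      |X₂ / X₀| := by
    rw [hX₂, ← hx u' v']; push_cast; rfl
  have hy₂α : |((u' * v₁ - v' * u₁ : ℤ) : ℝ) - -Y' / Y₀ * ((u₀ * v' - v₀ * u' : ℤ) : ℝ)| =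
      |Y₂ / Y₀| := by
    rw [hY₂, ← hy u' v']; push_cast; rfl
  have hdiff : |-X' / X₀ - -Y' / Y₀| = 1 / (|X₀| * |Y₀|) := by
    rw [← abs_mul, ← abs_one, ← abs_div]
    congr 1
    field_simp
    linarith
  have hX0' : 0 < |X₀| := abs_pos.2 hX0
  have hY0' : 0 < |Y₀| := abs_pos.2 hY0
  have hYsq : |Y₀| ^ 2 = Y₀ ^ 2 := sq_abs _
  have hd2 : 2 ≤ |-X' / X₀ - -Y' / Y₀| := by
    rw [hdiff, le_div_iff₀ (by positivity)]
    have : |X₀| * |Y₀| * 8 ≤ |X₀| * |Y₀| * (A * |Y₀| ^ 2) := by rw [hYsq]; gcongr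
    linarith
  have hd9 : |-X' / X₀ - -Y' / Y₀| ≤ 9 / 4 * (A * Y₀ ^ 2) := by
    rw [hdiff, div_le_iff₀ (by positivity), ← hYsq]
    linarith
  have hα₂ : |-Y' / Y₀| ≤ 1 := by rw [abs_of_nonneg hα₂0]; exact hα₂1
  have hw0 : 0 ≤ w := by
    have : 0 ≤ Real.log 15 := Real.log_nonneg (by norm_num)
    linarith
  obtain ⟨k₁, k₂, k₃, k₄⟩ := coordinate_bounds hw0 hα₂ hd2
    (hx₁α.trans_le (abs_div_le_of_cubic h₀4 h₁u h.pos hw₁)) (hy₁α.trans hw₁)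
  obtain ⟨l₁, l₂, -, -⟩ := coordinate_bounds (by linarith) hα₂ hd2
    (hx₂α.trans_le (abs_div_le_of_cubic h₀4 h₂u h.pos hw₂)) (hy₂α.trans hw₂)
  have hγn : ‖γ‖ ≤ 1 + 2 / Y₀ ^ 2 := by
    have h1 : ‖γ - ((-Y' / Y₀ : ℝ) : ℂ)‖ ≤ 2 / Y₀ ^ 2 := by
      refine (sq_le_sq₀ (norm_nonneg _) (by positivity)).1 ?_
      rw [hγ]
      have hpos := h.pos
      have hQ : 0 < A * Y₀ ^ 2 / 4 := by positivity
      calc A / (Y₀ ^ 2 * (A * X₀ ^ 2 + B * (X₀ * Y₀) + A * Y₀ ^ 2)) ≤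
          A / (Y₀ ^ 2 * (A * Y₀ ^ 2 / 4)) := by gcongr
        _ = (2 / Y₀ ^ 2) ^ 2 := by field_simp; norm_num
    have h2 : ‖((-Y' / Y₀ : ℝ) : ℂ)‖ ≤ 1 := by
      rw [Complex.norm_real, Real.norm_eq_abs]; exact hα₂
    have := norm_add_le (γ - ((-Y' / Y₀ : ℝ) : ℂ)) ((-Y' / Y₀ : ℝ) : ℂ)
    rw [sub_add_cancel] at this
    linarith
  have hα₁ : |-X' / X₀| ≤ 1 + 9 / 4 * (A * Y₀ ^ 2) := by
    have := abs_add_le (-X' / X₀ - -Y' / Y₀) (-Y' / Y₀)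
    rw [sub_add_cancel] at this
    linarith
  refine IsApproxPair.false_of_le (c := 15) (by norm_num) (f := f) (α₁ := -X' / X₀)
    (α₂ := -Y' / Y₀) (γ := γ) (x₁ := x₁) (y₁ := y₁) (x₂ := u' * v₁ - v' * u₁)
    (y₂ := u₀ * v' - v₀ * u') ⟨hmonic, hirrf, hfC, fun h0 => ?_, hγ0, hM.trans' ?_, hy₁,
      hc₁, hd₂, ?_, k₃, k₄, k₁, l₂, l₁⟩ hw hww
  · rw [h0] at hd2; norm_num at hd2
  · rw [max_eq_left hα₂, mul_one]
    have : 0 ≤ 2 / Y₀ ^ 2 := by positivity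
    have hpos := h.pos
    have : 0 ≤ A * Y₀ ^ 2 := by positivity
    gcongr
    · exact max_le (by linarith) hα₁
    · exact max_le (by linarith) hγn
  · rwa [abs_of_pos (show (0 : ℝ) < y₁ by exact_mod_cast hy₁)] at k₂

theorem IsReduction.false_of_chain {a b c d e : ℤ} (hirr : Irreducible
      (MvPolynomial.C (a : ℚ) * MvPolynomial.X 0 ^ 4 +
        MvPolynomial.C (b : ℚ) * MvPolynomial.X 0 ^ 3 * MvPolynomial.X 1 +
        MvPolynomial.C (c : ℚ) * MvPolynomial.X 0 ^ 2 * MvPolynomial.X 1 ^ 2 +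
        MvPolynomial.C (d : ℚ) * MvPolynomial.X 0 * MvPolynomial.X 1 ^ 3 +
        MvPolynomial.C (e : ℚ) * MvPolynomial.X 1 ^ 4 : MvPolynomial (Fin 2) ℚ))
    {p₁ q₁ p₂ q₂ A B ε : ℝ} (h : IsReduction a b c d e p₁ q₁ p₂ q₂ A B ε)
    (hA : 72 * Real.exp 600000 ≤ A)
    {u₀ v₀ u v u' v' : ℤ} {X₀ Y₀ X₁ Y₁ X₂ Y₂ : ℝ}
    (hX₀ : X₀ = p₁ * u₀ + q₁ * v₀) (hY₀ : Y₀ = p₂ * u₀ + q₂ * v₀)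
    (hX₁ : X₁ = p₁ * u + q₁ * v) (hY₁ : Y₁ = p₂ * u + q₂ * v)
    (hX₂ : X₂ = p₁ * u' + q₁ * v') (hY₂ : Y₂ = p₂ * u' + q₂ * v')
    (hF₀ : quarticFormVal a b c d e (u₀, v₀) = 1 ∨ quarticFormVal a b c d e (u₀, v₀) = -1)
    (hF₁ : quarticFormVal a b c d e (u, v) = 1 ∨ quarticFormVal a b c d e (u, v) = -1)
    (hF₂ : quarticFormVal a b c d e (u', v') = 1 ∨ quarticFormVal a b c d e (u', v') = -1)
    (hT₀ : 2 * |X₀| ≤ |Y₀|) (hT₁ : 2 * |X₁| ≤ |Y₁|) (hT₂ : 2 * |X₂| ≤ |Y₂|)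
    (hd₁ : u₀ * v - v₀ * u ≠ 0) (hd₂ : u₀ * v' - v₀ * u' ≠ 0)
    (ht₁ : 4 / 5 ≤ Y₀ ^ 2 ∧ (A * Y₀ ^ 2 / 8) ^ 81 ≤ A * Y₁ ^ 2 / 8 ∨
      (A * Y₀ ^ 2 / 8) ^ 243 ≤ A * Y₁ ^ 2 / 8)
    (ht₂ : (A * Y₁ ^ 2 / 8) ^ 3 ≤ A * Y₂ ^ 2 / 8) : False := by
  have hA0 := h.pos
  obtain ⟨-, -, -, h₀⟩ := cubic_bounds h.pos h.abs_lt
    (by rw [hX₀, hY₀]; exact h.abs_mul_eq_one hF₀) hT₀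
  obtain ⟨-, -, -, h₁⟩ := cubic_bounds h.pos h.abs_lt
    (by rw [hX₁, hY₁]; exact h.abs_mul_eq_one hF₁) hT₁
  obtain ⟨-, -, -, h₂⟩ := cubic_bounds h.pos h.abs_lt
    (by rw [hX₂, hY₂]; exact h.abs_mul_eq_one hF₂) hT₂
  have hY0 : Y₀ ≠ 0 := by rintro rfl; norm_num at h₀
  have hY1 : Y₁ ≠ 0 := by rintro rfl; norm_num at h₁
  have hY2 : Y₂ ≠ 0 := by rintro rfl; norm_num at h₂
  set t₀ := A * Y₀ ^ 2 / 8 with ht₀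
  set t := A * Y₁ ^ 2 / 8 with ht
  set t' := A * Y₂ ^ 2 / 8 with ht'
  have p₀ : 0 < t₀ := by positivity
  have p₁ : 0 < t := by positivity
  have p₂ : 0 < t' := by positivity
  have hsq : A ≤ 72 * t₀ ^ 2 := by
    have := mul_le_mul_of_nonneg_left h₀ hA0.le
    rw [ht₀]; linarith
  obtain ⟨L, hL⟩ : ∃ L, Real.exp L = t₀ := ⟨_, Real.exp_log p₀⟩
  obtain ⟨M, hM⟩ : ∃ M, Real.exp M = t := ⟨_, Real.exp_log p₁⟩
  obtain ⟨N, hN⟩ : ∃ N, Real.exp N = t' := ⟨_, Real.exp_log p₂⟩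
  have hL0 : 300000 ≤ L := by
    have : Real.exp 600000 ≤ Real.exp (2 * L) := by
      rw [two_mul, Real.exp_add, hL]; linarith
    have := Real.exp_le_exp.1 this
    linarith
  have ht1 : 1 ≤ t₀ := by rw [← hL]; exact Real.one_le_exp (by linarith)
  have hMN : 3 * M ≤ N := by
    rw [← hM, ← hN, ← Real.exp_nat_mul, Real.exp_le_exp] at ht₂
    exact_mod_cast ht₂
  have hw : ∀ {Y R : ℝ}, Y ≠ 0 → Real.exp R = A * Y ^ 2 / 8 →
      |Y / Y₀| = Real.exp ((R - L) / 2) := fun {Y R} hY hR => by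
    refine (sq_eq_sq₀ (abs_nonneg _) (Real.exp_pos _).le).1 ?_
    rw [← Real.exp_nat_mul, sq_abs]
    push_cast
    rw [mul_div_cancel₀ _ two_ne_zero, Real.exp_sub, hR, hL, ht₀]
    field_simp
  have hlog : Real.log 15 ≤ 3 := by
    rw [Real.log_le_iff_le_exp (by norm_num)]
    have := Real.exp_one_gt_d9
    calc (15 : ℝ) ≤ 2.7 ^ 3 := by norm_num
      _ ≤ Real.exp 1 ^ 3 := by gcongr; linarith
      _ = Real.exp 3 := by rw [← Real.exp_nat_mul]; norm_num
  have h10 : (6859 : ℝ) ≤ Real.exp 10 := by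
    have := Real.exp_one_gt_d9
    calc (6859 : ℝ) ≤ 2.7 ^ 10 := by norm_num
      _ ≤ Real.exp 1 ^ 10 := by gcongr; linarith
      _ = Real.exp 10 := by rw [← Real.exp_nat_mul]; norm_num
  have hpow : ∀ {n : ℕ}, t₀ ^ n ≤ t → n * L ≤ M := fun {n} hn => by
    rw [← hL, ← hM, ← Real.exp_nat_mul, Real.exp_le_exp] at hn
    exact hn
  have hLM : 81 * L ≤ M := by
    rcases ht₁ with ht₁ | ht₁
    · exact_mod_cast hpow ht₁.2
    · have := hpow ht₁
      push_cast at this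
      linarith
  refine h.false_of_large hirr hX₀ hY₀ hX₁ hY₁ hX₂ hY₂ hF₀ hF₁ hF₂ hT₀ hT₁ hT₂ hd₁ hd₂
    (by linarith) (hw hY1 hM) (hw hY2 hN) ?_ (by linarith) (by linarith)
  have hlin : 1 + 9 / 4 * (A * Y₀ ^ 2) ≤ 19 * t₀ := by linarith
  rcases ht₁ with ⟨hY, -⟩ | ht₁
  · have h2 : 2 / Y₀ ^ 2 ≤ 2.5 := by
      rw [div_le_iff₀ (by positivity)]; linarith
    calc (1 + 9 / 4 * (A * Y₀ ^ 2)) * (1 + 2 / Y₀ ^ 2) ^ 2 ≤ 19 * t₀ * (1 + 2.5) ^ 2 := by gcongr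
      _ ≤ 6859 * t₀ := by linarith
      _ ≤ Real.exp 10 * Real.exp L := by rw [hL]; gcongr
      _ = Real.exp (10 + L) := (Real.exp_add _ _).symm
      _ ≤ _ := Real.exp_le_exp.2 (by rw [le_div_iff₀ (by norm_num)]; linarith)
  · have h2 : 2 / Y₀ ^ 2 ≤ 18 * t₀ := by
      rw [div_le_iff₀ (by positivity)]
      refine le_of_mul_le_mul_left ?_ hA0
      have : A * (18 * t₀ * Y₀ ^ 2) = 144 * t₀ ^ 2 := by rw [ht₀]; ring
      linarith
    have := hpow ht₁
    push_cast at this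
    calc (1 + 9 / 4 * (A * Y₀ ^ 2)) * (1 + 2 / Y₀ ^ 2) ^ 2 ≤
          19 * t₀ * (t₀ + 18 * t₀) ^ 2 := by gcongr
      _ = 6859 * t₀ ^ 3 := by ring
      _ ≤ Real.exp 10 * Real.exp L ^ 3 := by rw [hL]; gcongr
      _ = Real.exp (10 + 3 * L) := by rw [Real.exp_add, ← Real.exp_nat_mul]; norm_num
      _ ≤ _ := Real.exp_le_exp.2 (by rw [le_div_iff₀ (by norm_num)]; linarith)

theorem Finset.exists_iterate_le {ι : Type*} {t : ι → ℝ} {g : ℝ → ℝ} (hg : Monotone g) (k : ℕ) :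
    ∀ s : Finset ι, s.card = k + 2 →
      (∀ i ∈ s, ∀ j ∈ s, i ≠ j → t i ≤ t j → g (t i) ≤ t j) →
      ∃ i ∈ s, ∃ a ∈ s, ∃ b ∈ s, b ≠ i ∧ g^[k] (t i) ≤ t a ∧ g (t a) ≤ t b := by
  classical
  induction k with
  | zero =>
    intro s hs hgap
    obtain ⟨i, hi, hmin⟩ := s.exists_min_image t (Finset.card_pos.1 (by omega))
    obtain ⟨b, hb, hbi⟩ := s.exists_mem_ne (by omega) i
    exact ⟨i, hi, i, hi, b, hb, hbi, le_rfl, hgap i hi b hb hbi.symm (hmin b hb)⟩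
  | succ k ih =>
    intro s hs hgap
    obtain ⟨i, hi, hmin⟩ := s.exists_min_image t (Finset.card_pos.1 (by omega))
    obtain ⟨i', hi', a, ha, b, hb, -, hia, hab⟩ := ih (s.erase i)
      (by rw [Finset.card_erase_of_mem hi]; omega) fun j hj l hl =>
        hgap j (Finset.mem_of_mem_erase hj) l (Finset.mem_of_mem_erase hl)
    refine ⟨i, hi, a, Finset.mem_of_mem_erase ha, b, Finset.mem_of_mem_erase hb,
      Finset.ne_of_mem_erase hb, ?_, hab⟩
    rw [Function.iterate_succ_apply]
    exact (hg.iterate k (hgap i hi i' (Finset.mem_of_mem_erase hi')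
      (Finset.ne_of_mem_erase hi').symm (hmin i' (Finset.mem_of_mem_erase hi')))).trans hia

theorem pow_three_le_of_cubic {A X Y X' Y' : ℝ} (hA : 0 < A) (h : A * |X| * |Y| ^ 3 ≤ 4)
    (h' : A * |X'| * |Y'| ^ 3 ≤ 4) (hY : |Y| ≤ |Y'|) (hd : 1 ≤ |X * Y' - X' * Y|) :
    (A * Y ^ 2 / 8) ^ 3 ≤ A * Y' ^ 2 / 8 := by
  have h1 : 1 ≤ |X| * |Y'| + |X'| * |Y| := by
    rw [← abs_mul, ← abs_mul]; exact hd.trans (abs_sub _ _)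
  have h2 : A * |Y| ^ 3 ≤ 8 * |Y'| := by
    have e1 := mul_le_mul_of_nonneg_left h1 (show 0 ≤ A * |Y| ^ 3 by positivity)
    have e2 := mul_le_mul_of_nonneg_right h (abs_nonneg Y')
    have e3 : A * |X'| * |Y| ^ 3 * |Y| ≤ A * |X'| * |Y'| ^ 3 * |Y'| := by gcongr
    have e4 := mul_le_mul_of_nonneg_right h' (abs_nonneg Y')
    linarith
  have h3 : (A * |Y| ^ 3) ^ 2 ≤ (8 * |Y'|) ^ 2 := by gcongr
  have e : |Y| ^ 6 = Y ^ 6 := by rw [show 6 = 2 * 3 by norm_num, pow_mul, pow_mul, sq_abs]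
  rw [mul_pow, mul_pow, ← pow_mul, sq_abs, e] at h3
  have := mul_le_mul_of_nonneg_left h3 hA.le
  linarith

theorem middle_bounds {A B X Y : ℝ} (hA : 0 < A) (hB : |B| < 2 * A)
    (h : |X * Y| * (A * X ^ 2 + B * (X * Y) + A * Y ^ 2) = 1) (h₁ : |X| ≤ 2 * |Y|)
    (h₂ : |Y| ≤ 2 * |X|) : 2 ≤ 9 * A * |X * Y| ^ 2 ∧ (2 * A - |B|) * |X * Y| ^ 2 ≤ 1 := by
  have h0 : |B * (X * Y)| = |B| * (|X| * |Y|) := by rw [abs_mul, abs_mul]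
  obtain ⟨h2, h3⟩ := abs_le.1 h0.le
  rw [abs_mul] at h ⊢
  rw [← sq_abs X, ← sq_abs Y] at h
  set x := |X|
  set y := |Y|
  have hx : 0 ≤ x := abs_nonneg X
  have hy : 0 ≤ y := abs_nonneg Y
  have hxy : 0 ≤ x * y := by positivity
  have h4 : |B| * (x * y) ≤ 2 * A * (x * y) := by gcongr
  constructor
  · have : A * ((x - 2 * y) * (2 * x - y)) ≤ 0 := by
      nlinarith [mul_nonneg (sub_nonneg.2 h₁) (sub_nonneg.2 h₂)]
    have := mul_le_mul_of_nonneg_left (show A * x ^ 2 + B * (X * Y) + A * y ^ 2 ≤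
      9 / 2 * A * (x * y) by linarith) hxy
    linarith
  · have : 0 ≤ A * (x - y) ^ 2 := by positivity
    have := mul_le_mul_of_nonneg_left (show (2 * A - |B|) * (x * y) ≤
      A * x ^ 2 + B * (X * Y) + A * y ^ 2 by linarith) hxy
    linarith

theorem middle_gap_of_nonpos {A B X Y X' Y' : ℝ} (hA : 8 < A) (hB0 : B ≤ 0) (hB : |B| < 2 * A)
    (h : |X * Y| * (A * X ^ 2 + B * (X * Y) + A * Y ^ 2) = 1)
    (h' : |X' * Y'| * (A * X' ^ 2 + B * (X' * Y') + A * Y' ^ 2) = 1)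
    (h₁ : |X| ≤ 2 * |Y|) (h₂ : |Y| ≤ 2 * |X|) (h₁' : |X'| ≤ 2 * |Y'|) (h₂' : |Y'| ≤ 2 * |X'|)
    (hle : |X * Y| ≤ |X' * Y'|) (hd : 1 ≤ |X * Y' - X' * Y|) :
    A / 16 * |X * Y| ≤ |X' * Y'| := by
  have sq_le : ∀ {x y : ℝ}, |x| ≤ 2 * |y| → x ^ 2 ≤ 2 * |x * y| := fun {x y} hxy => by
    rw [abs_mul, ← sq_abs, sq, mul_left_comm]; gcongr
  have hX := sq_le h₁
  have hY := sq_le h₂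
  have hX' := sq_le h₁'
  have hY' := sq_le h₂'
  rw [mul_comm Y X] at hY
  rw [mul_comm Y' X'] at hY'
  have hpos : 0 < |X * Y| := (abs_nonneg _).lt_of_ne fun h0 => by rw [← h0] at h; norm_num at h
  have hpos' : 0 < |X' * Y'| := hpos.trans_le hle
  have hd2 : 1 ≤ (X * Y' - X' * Y) ^ 2 := by rw [← sq_abs]; exact one_le_pow₀ hd
  have hd16 : 1 ≤ 16 * (|X * Y| * |X' * Y'|) := by
    have e1 : X ^ 2 * Y' ^ 2 ≤ (2 * |X * Y|) * (2 * |X' * Y'|) := by gcongr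
    have e2 : Y ^ 2 * X' ^ 2 ≤ (2 * |X * Y|) * (2 * |X' * Y'|) := by gcongr
    nlinarith [sq_nonneg (X * Y' + X' * Y)]
  have neg : ∀ {x y : ℝ}, |x * y| * (A * x ^ 2 + B * (x * y) + A * y ^ 2) = 1 → x * y ≤ 0 →
      2 * A * |x * y| ^ 2 ≤ 1 := fun {x y} hq hxy => by
    rw [← hq, abs_of_nonpos hxy]
    have e1 : 0 ≤ A * (x + y) ^ 2 := by positivity
    have e2 : 0 ≤ B * (x * y) := mul_nonneg_of_nonpos_of_nonpos hB0 hxy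
    have := mul_le_mul_of_nonneg_left (show 2 * A * -(x * y) ≤
      A * x ^ 2 + B * (x * y) + A * y ^ 2 by linarith) (neg_nonneg.2 hxy)
    linarith
  rcases le_total (X' * Y') 0 with hs' | hs'
  · exfalso
    have e1 := neg h' hs'
    have e2 := mul_le_mul_of_nonneg_right hle hpos'.le
    have e3 : 8 * |X' * Y'| ^ 2 < A * |X' * Y'| ^ 2 := by gcongr
    linarith
  rcases le_total (X * Y) 0 with hs | hs
  · have e1 := neg h hs
    refine le_of_mul_le_mul_left ?_ hpos
    have : 0 ≤ A * |X * Y| ^ 2 := by positivity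
    linarith
  have pos : ∀ {x y : ℝ}, |x * y| * (A * x ^ 2 + B * (x * y) + A * y ^ 2) = 1 → 0 ≤ x * y →
      A * |x * y| * (x - y) ^ 2 ≤ 1 := fun {x y} hq hxy => by
    have := (abs_le.1 hB.le).1
    rw [← hq, abs_of_nonneg hxy]
    have := mul_le_mul_of_nonneg_left (show A * (x - y) ^ 2 ≤
      A * x ^ 2 + B * (x * y) + A * y ^ 2 by nlinarith) hxy
    linarith
  have e := pos h hs
  have e' := pos h' hs'
  have f1 : (X * Y' - X' * Y) ^ 2 ≤ 2 * ((X - Y) ^ 2 * Y' ^ 2) + 2 * ((X' - Y') ^ 2 * Y ^ 2) := by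
    nlinarith [sq_nonneg ((X - Y) * Y' + (X' - Y') * Y)]
  have f2 : (X - Y) ^ 2 * Y' ^ 2 ≤ (X - Y) ^ 2 * (2 * |X' * Y'|) := by gcongr
  have f3 : (X' - Y') ^ 2 * Y ^ 2 ≤ (X' - Y') ^ 2 * (2 * |X * Y|) := by gcongr
  have hc : 0 ≤ A * |X * Y| := by positivity
  have g1 := mul_le_mul_of_nonneg_left (hd2.trans (f1.trans (by linarith [f2, f3] :
    _ ≤ 4 * ((X - Y) ^ 2 * |X' * Y'|) + 4 * ((X' - Y') ^ 2 * |X * Y|)))) hc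
  have g2 := mul_le_mul_of_nonneg_right e hpos'.le
  have g3 : A * |X * Y| * (X' - Y') ^ 2 * |X * Y| ≤ A * |X' * Y'| * (X' - Y') ^ 2 * |X' * Y'| := by
    gcongr
  have g4 := mul_le_mul_of_nonneg_right e' hpos'.le
  linarith

theorem middle_gap {A B X Y X' Y' : ℝ} (hA : 8 < A) (hB : |B| < 2 * A)
    (h : |X * Y| * (A * X ^ 2 + B * (X * Y) + A * Y ^ 2) = 1)
    (h' : |X' * Y'| * (A * X' ^ 2 + B * (X' * Y') + A * Y' ^ 2) = 1)
    (h₁ : |X| ≤ 2 * |Y|) (h₂ : |Y| ≤ 2 * |X|) (h₁' : |X'| ≤ 2 * |Y'|) (h₂' : |Y'| ≤ 2 * |X'|)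
    (hle : |X * Y| ≤ |X' * Y'|) (hd : 1 ≤ |X * Y' - X' * Y|) :
    A / 16 * |X * Y| ≤ |X' * Y'| := by
  rcases le_total B 0 with hB0 | hB0
  · exact middle_gap_of_nonpos hA hB0 hB h h' h₁ h₂ h₁' h₂' hle hd
  · have := middle_gap_of_nonpos (X := -X) (X' := -X') (Y := Y) (Y' := Y') hA (neg_nonpos.2 hB0)
      (by rwa [abs_neg]) (by rw [← h]; simp) (by rw [← h']; simp) (by rwa [abs_neg])
      (by rwa [abs_neg]) (by rwa [abs_neg]) (by rwa [abs_neg]) (by simpa using hle)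
      (by rw [← abs_neg]; convert hd using 2; ring)
    simpa using this

section Solutions

variable {a b c d e : ℤ} {p₁ q₁ p₂ q₂ A B ε : ℝ} {ι : Type*} {P : ι → ℤ × ℤ}

theorem IsReduction.one_le_abs_det (h : IsReduction a b c d e p₁ q₁ p₂ q₂ A B ε) {p q : ℤ × ℤ}
    (hd : p.1 * q.2 - p.2 * q.1 ≠ 0) :
    1 ≤ |(p₁ * p.1 + q₁ * p.2) * (p₂ * q.1 + q₂ * q.2) -
      (p₁ * q.1 + q₁ * q.2) * (p₂ * p.1 + q₂ * p.2)| := by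
  have : (p₁ * p.1 + q₁ * p.2) * (p₂ * q.1 + q₂ * q.2) -
      (p₁ * q.1 + q₁ * q.2) * (p₂ * p.1 + q₂ * p.2) = ((p.1 * q.2 - p.2 * q.1 : ℤ) : ℝ) := by
    push_cast
    linear_combination ((p.1 : ℝ) * q.2 - p.2 * q.1) * h.det
  rw [this, ← Int.cast_abs]
  exact_mod_cast Int.one_le_abs hd

theorem IsReduction.card_middle_le (h : IsReduction a b c d e p₁ q₁ p₂ q₂ A B ε) (hA : 16 ≤ A)
    (hD : 18 * 16 ^ 6 < A ^ 4 * (4 * A ^ 2 - B ^ 2))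
    (hP : ∀ i, quarticFormVal a b c d e (P i) = 1 ∨ quarticFormVal a b c d e (P i) = -1)
    (hdet : ∀ i j, i ≠ j → (P i).1 * (P j).2 - (P i).2 * (P j).1 ≠ 0) {s : Finset ι}
    (hs₁ : ∀ i ∈ s, |p₁ * (P i).1 + q₁ * (P i).2| ≤ 2 * |p₂ * (P i).1 + q₂ * (P i).2|)
    (hs₂ : ∀ i ∈ s, |p₂ * (P i).1 + q₂ * (P i).2| ≤ 2 * |p₁ * (P i).1 + q₁ * (P i).2|) :
    s.card ≤ 3 := by
  by_contra! hcard
  obtain ⟨s', hs', hcard'⟩ := Finset.exists_subset_card_eq (show 4 ≤ s.card from hcard)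
  set t : ι → ℝ := fun i => |(p₁ * (P i).1 + q₁ * (P i).2) * (p₂ * (P i).1 + q₂ * (P i).2)| with ht
  obtain ⟨i, hi, j, hj, k, hk, -, hij, hjk⟩ := Finset.exists_iterate_le (t := t)
    (g := fun x => A / 16 * x) (monotone_id.const_mul (by positivity)) 2 s' hcard'
    fun i hi j hj hij hle => middle_gap (by linarith) h.abs_lt (h.abs_mul_eq_one (hP i))
      (h.abs_mul_eq_one (hP j)) (hs₁ i (hs' hi)) (hs₂ i (hs' hi)) (hs₁ j (hs' hj))
      (hs₂ j (hs' hj)) hle (h.one_le_abs_det (hdet i j hij))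
  obtain ⟨hi2, -⟩ := middle_bounds h.pos h.abs_lt (h.abs_mul_eq_one (hP i)) (hs₁ i (hs' hi))
    (hs₂ i (hs' hi))
  obtain ⟨-, hk2⟩ := middle_bounds h.pos h.abs_lt (h.abs_mul_eq_one (hP k)) (hs₁ k (hs' hk))
    (hs₂ k (hs' hk))
  change 2 ≤ 9 * A * t i ^ 2 at hi2
  change (2 * A - |B|) * t k ^ 2 ≤ 1 at hk2
  have hB := h.abs_lt
  have hik : (A / 16) ^ 3 * t i ≤ t k := by
    simp only [Function.iterate_succ, Function.iterate_zero, Function.comp_apply, id] at hij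
    have := mul_le_mul_of_nonneg_left hij (show 0 ≤ A / 16 by positivity)
    linarith
  have hik2 : ((A / 16) ^ 3 * t i) ^ 2 ≤ t k ^ 2 :=
    pow_le_pow_left₀ (mul_nonneg (by positivity) (abs_nonneg _)) hik 2
  have e1 := mul_le_mul_of_nonneg_left hi2 (show 0 ≤ A ^ 5 by positivity)
  have e2 : A ^ 5 * 2 ≤ 9 * 16 ^ 6 * t k ^ 2 := by linarith
  have e3 : A ^ 4 * (4 * A ^ 2 - B ^ 2) ≤ 4 * A ^ 5 * (2 * A - |B|) := by
    rw [← sq_abs B]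
    have : 0 ≤ A ^ 4 * (2 * A - |B|) ^ 2 := by positivity
    linarith
  have e4 := mul_le_mul_of_nonneg_right e2 (sub_nonneg.2 hB.le)
  linarith

theorem IsReduction.false_of_card (hirr : Irreducible
      (MvPolynomial.C (a : ℚ) * MvPolynomial.X 0 ^ 4 +
        MvPolynomial.C (b : ℚ) * MvPolynomial.X 0 ^ 3 * MvPolynomial.X 1 +
        MvPolynomial.C (c : ℚ) * MvPolynomial.X 0 ^ 2 * MvPolynomial.X 1 ^ 2 +
        MvPolynomial.C (d : ℚ) * MvPolynomial.X 0 * MvPolynomial.X 1 ^ 3 +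
        MvPolynomial.C (e : ℚ) * MvPolynomial.X 1 ^ 4 : MvPolynomial (Fin 2) ℚ))
    (h : IsReduction a b c d e p₁ q₁ p₂ q₂ A B ε)
    (hA : 72 * Real.exp 600000 ≤ A)
    (hP : ∀ i, quarticFormVal a b c d e (P i) = 1 ∨ quarticFormVal a b c d e (P i) = -1)
    (hdet : ∀ i j, i ≠ j → (P i).1 * (P j).2 - (P i).2 * (P j).1 ≠ 0) {s : Finset ι}
    (hs : ∀ i ∈ s, 2 * |p₁ * (P i).1 + q₁ * (P i).2| ≤ |p₂ * (P i).1 + q₂ * (P i).2|)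
    (hcard : 7 ≤ s.card ∨
      6 ≤ s.card ∧ ∀ i ∈ s, 4 / 5 ≤ (p₂ * (P i).1 + q₂ * (P i).2) ^ 2) : False := by
  set t : ι → ℝ := fun i => A * (p₂ * (P i).1 + q₂ * (P i).2) ^ 2 / 8 with ht
  have hA0 := h.pos
  have gap : ∀ i ∈ s, ∀ j ∈ s, i ≠ j → t i ≤ t j → t i ^ 3 ≤ t j := fun i hi j hj hij hle => by
    obtain ⟨-, -, hi', -⟩ := cubic_bounds h.pos h.abs_lt (h.abs_mul_eq_one (hP i)) (hs i hi)
    obtain ⟨-, -, hj', -⟩ := cubic_bounds h.pos h.abs_lt (h.abs_mul_eq_one (hP j)) (hs j hj)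
    refine pow_three_le_of_cubic h.pos hi' hj' (sq_le_sq.1 ?_) (h.one_le_abs_det (hdet i j hij))
    refine le_of_mul_le_mul_left ?_ h.pos
    simp only [ht] at hle
    linarith
  have one_lt : ∀ i ∈ s, 1 < t i := fun i hi => by
    obtain ⟨-, -, -, hi'⟩ := cubic_bounds h.pos h.abs_lt (h.abs_mul_eq_one (hP i)) (hs i hi)
    have h1 : 1 < Real.exp 600000 := Real.one_lt_exp_iff.2 (by norm_num)
    have h2 : A * 8 ≤ A * (9 * A * (p₂ * (P i).1 + q₂ * (P i).2) ^ 4) := by gcongr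
    have h3 : 1 < t i ^ 2 := by simp only [ht]; linarith
    exact (one_lt_sq_iff₀ (by positivity)).1 h3
  obtain ⟨n, hn, hns, hn'⟩ : ∃ n, 4 ≤ n ∧ n + 2 ≤ s.card ∧
      (n = 5 ∨ n = 4 ∧ ∀ i ∈ s, 4 / 5 ≤ (p₂ * (P i).1 + q₂ * (P i).2) ^ 2) := by
    rcases hcard with hcard | ⟨hcard, hY⟩
    · exact ⟨5, by norm_num, hcard, .inl rfl⟩
    · exact ⟨4, le_rfl, hcard, .inr ⟨rfl, hY⟩⟩
  obtain ⟨s', hs', hcard'⟩ := Finset.exists_subset_card_eq hns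
  obtain ⟨i, hi, j, hj, k, hk, hki, hij, hjk⟩ := Finset.exists_iterate_le (t := t)
    (g := fun x => x ^ 3) (Odd.strictMono_pow (by decide)).monotone n s' hcard'
    fun i hi j hj => gap i (hs' hi) j (hs' hj)
  have hiter : ∀ (m : ℕ) (x : ℝ), (fun x : ℝ => x ^ 3)^[m] x = x ^ 3 ^ m := fun m => by
    induction m with
    | zero => simp
    | succ m ih => intro x; rw [Function.iterate_succ_apply, ih, ← pow_mul, pow_succ']
  rw [hiter] at hij
  have hji : j ≠ i := by
    rintro rfl
    exact hij.not_gt (lt_self_pow₀ (one_lt j (hs' hj)) (Nat.one_lt_pow (by omega) (by norm_num)))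
  refine h.false_of_chain hirr hA rfl rfl rfl rfl rfl rfl (hP i) (hP j) (hP k) (hs i (hs' hi))
    (hs j (hs' hj)) (hs k (hs' hk)) (hdet i j hji.symm) (hdet i k hki.symm) ?_ hjk
  rcases hn' with rfl | ⟨rfl, hY⟩
  · right; norm_num at hij; exact hij
  · left; norm_num at hij; exact ⟨hY i (hs' hi), hij⟩

theorem IsReduction.card_le (hirr : Irreducible
      (MvPolynomial.C (a : ℚ) * MvPolynomial.X 0 ^ 4 +
        MvPolynomial.C (b : ℚ) * MvPolynomial.X 0 ^ 3 * MvPolynomial.X 1 +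
        MvPolynomial.C (c : ℚ) * MvPolynomial.X 0 ^ 2 * MvPolynomial.X 1 ^ 2 +
        MvPolynomial.C (d : ℚ) * MvPolynomial.X 0 * MvPolynomial.X 1 ^ 3 +
        MvPolynomial.C (e : ℚ) * MvPolynomial.X 1 ^ 4 : MvPolynomial (Fin 2) ℚ))
    (h : IsReduction a b c d e p₁ q₁ p₂ q₂ A B ε)
    (hA : 72 * Real.exp 600000 ≤ A) (hD : 18 * 16 ^ 6 < A ^ 4 * (4 * A ^ 2 - B ^ 2)) [Fintype ι]
    (hP : ∀ i, quarticFormVal a b c d e (P i) = 1 ∨ quarticFormVal a b c d e (P i) = -1)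
    (hdet : ∀ i j, i ≠ j → (P i).1 * (P j).2 - (P i).2 * (P j).1 ≠ 0) : Fintype.card ι ≤ 14 := by
  classical
  by_contra! hcard
  have hA16 : 16 ≤ A := by
    have : 1 ≤ Real.exp 600000 := Real.one_le_exp (by norm_num)
    linarith
  have hneg : ∀ i, |-p₁ * (P i).1 + -q₁ * (P i).2| = |p₁ * (P i).1 + q₁ * (P i).2| := fun i => by
    rw [← abs_neg]; congr 1; ring
  set S := Finset.univ.filter
    fun i => 2 * |p₁ * (P i).1 + q₁ * (P i).2| ≤ |p₂ * (P i).1 + q₂ * (P i).2| with hS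
  set T := Finset.univ.filter
    fun i => 2 * |p₂ * (P i).1 + q₂ * (P i).2| ≤ |p₁ * (P i).1 + q₁ * (P i).2| with hT
  have hSm : ∀ i ∈ S, 2 * |p₁ * (P i).1 + q₁ * (P i).2| ≤ |p₂ * (P i).1 + q₂ * (P i).2| :=
    fun i hi => (Finset.mem_filter.1 hi).2
  have hTm : ∀ i ∈ T, 2 * |p₂ * (P i).1 + q₂ * (P i).2| ≤ |p₁ * (P i).1 + q₁ * (P i).2| :=
    fun i hi => (Finset.mem_filter.1 hi).2
  have hmid : (S ∪ T)ᶜ.card ≤ 3 := by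
    refine h.card_middle_le hA16 hD hP hdet (fun i hi => ?_) fun i hi => ?_ <;>
      simp only [hS, hT, Finset.mem_compl, Finset.mem_union, Finset.mem_filter, Finset.mem_univ,
        true_and, not_or, not_le] at hi
    · exact hi.2.le
    · exact hi.1.le
  have hun := Finset.card_union_le S T
  have hcompl := (S ∪ T).card_add_card_compl
  have hTm' : ∀ i ∈ T, 2 * |p₂ * (P i).1 + q₂ * (P i).2| ≤
      |-p₁ * (P i).1 + -q₁ * (P i).2| := fun i hi => by rw [hneg]; exact hTm i hi
  have hS7 : ¬ 7 ≤ S.card := fun h7 => h.false_of_card hirr hA hP hdet hSm (.inl h7)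
  have hT7 : ¬ 7 ≤ T.card := fun h7 => h.swap.false_of_card hirr hA hP hdet hTm' (.inl h7)
  have hS6 : 6 ≤ S.card := by omega
  have hT6 : 6 ≤ T.card := by omega
  obtain ⟨i, hi, hYi⟩ : ∃ i ∈ S, (p₂ * (P i).1 + q₂ * (P i).2) ^ 2 < 4 / 5 := by
    by_contra! hall
    exact h.false_of_card hirr hA hP hdet hSm (.inr ⟨hS6, hall⟩)
  obtain ⟨j, hj, hXj⟩ : ∃ j ∈ T, (-p₁ * (P j).1 + -q₁ * (P j).2) ^ 2 < 4 / 5 := by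
    by_contra! hall
    exact h.swap.false_of_card hirr hA hP hdet hTm' (.inr ⟨hT6, hall⟩)
  have hi' := hSm i hi
  have hj' := hTm j hj
  rw [← sq_abs, hneg] at hXj
  rw [← sq_abs] at hYi
  by_cases hij : i = j
  · subst hij
    have hX0 : |p₁ * (P i).1 + q₁ * (P i).2| = 0 := by
      linarith [abs_nonneg (p₁ * (P i).1 + q₁ * (P i).2), abs_nonneg (p₂ * (P i).1 + q₂ * (P i).2)]
    have := h.abs_mul_eq_one (hP i)
    rw [abs_mul, hX0] at this
    norm_num at this
  have hd := (h.one_le_abs_det (hdet i j hij)).trans (abs_sub _ _)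
  rw [abs_mul, abs_mul] at hd
  set x := |p₁ * (P i).1 + q₁ * (P i).2|
  set y := |p₂ * (P i).1 + q₂ * (P i).2|
  set x' := |p₁ * (P j).1 + q₁ * (P j).2|
  set y' := |p₂ * (P j).1 + q₂ * (P j).2|
  have h1 : x * y' ≤ y / 2 * (x' / 2) :=
    mul_le_mul (by linarith) (by linarith) (abs_nonneg _) (by positivity)
  nlinarith [sq_nonneg (x' - y)]

end Solutions

theorem eq_or_eq_neg_of_det_eq_zero {a b c d e : ℤ} {p q : ℤ × ℤ}
    (hp : quarticFormVal a b c d e p = 1 ∨ quarticFormVal a b c d e p = -1)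
    (hq : quarticFormVal a b c d e q = 1 ∨ quarticFormVal a b c d e q = -1)
    (hdet : p.1 * q.2 - p.2 * q.1 = 0) : p = q ∨ p = -q := by
  obtain ⟨r, s, hrs⟩ := isCoprime_of_quarticFormVal (x := p.1) (y := p.2) hp
  set k := r * q.1 + s * q.2 with hk
  have h1 : q.1 = k * p.1 := by rw [hk]; linear_combination (-q.1) * hrs - s * hdet
  have h2 : q.2 = k * p.2 := by rw [hk]; linear_combination (-q.2) * hrs + r * hdet
  have h3 : quarticFormVal a b c d e q = k ^ 4 * quarticFormVal a b c d e p := by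
    simp only [quarticFormVal, h1, h2]; ring
  have h4 : IsUnit k := by
    refine (isUnit_pow_iff four_ne_zero).1 (isUnit_of_dvd_unit ⟨_, h3⟩ ?_)
    exact Int.isUnit_iff.2 hq
  rcases Int.isUnit_iff.1 h4 with h | h
  · left; ext <;> simp [h1, h2, h]
  · right; ext <;> simp [h1, h2, h]

theorem leadingCoeff_ne_zero_of_irreducible {a b c d e : ℚ} (hirr : Irreducible
      (MvPolynomial.C a * MvPolynomial.X 0 ^ 4 +
        MvPolynomial.C b * MvPolynomial.X 0 ^ 3 * MvPolynomial.X 1 +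
        MvPolynomial.C c * MvPolynomial.X 0 ^ 2 * MvPolynomial.X 1 ^ 2 +
        MvPolynomial.C d * MvPolynomial.X 0 * MvPolynomial.X 1 ^ 3 +
        MvPolynomial.C e * MvPolynomial.X 1 ^ 4 : MvPolynomial (Fin 2) ℚ)) : a ≠ 0 := by
  rintro rfl
  rcases hirr.isUnit_or_isUnit (show _ = MvPolynomial.X 1 *
    (MvPolynomial.C b * MvPolynomial.X 0 ^ 3 +
      MvPolynomial.C c * MvPolynomial.X 0 ^ 2 * MvPolynomial.X 1 +
      MvPolynomial.C d * MvPolynomial.X 0 * MvPolynomial.X 1 ^ 2 +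
      MvPolynomial.C e * MvPolynomial.X 1 ^ 3) by rw [map_zero]; ring) with h | h
  all_goals
    have := h.map (MvPolynomial.eval (0 : Fin 2 → ℚ))
    simp at this

end

/-- There is a constant `N` such that every quartic Thue equation `F(U,V) = ±1`, with
`F` irreducible over `ℚ` whose discriminant is negative with absolute value at least
`N`, has at most `14` integer solutions (counting `(u,v)` and `(-u,-v)` as one
solution). -/
theorem quartic_thue_eq_large_negative_disc_at_most_14_solutions :
    ∃ N : ℕ, ∀ a b c d e : ℤ,
      Irreducible
        (MvPolynomial.C (a : ℚ) * MvPolynomial.X 0 ^ 4 +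
          MvPolynomial.C (b : ℚ) * MvPolynomial.X 0 ^ 3 * MvPolynomial.X 1 +
          MvPolynomial.C (c : ℚ) * MvPolynomial.X 0 ^ 2 * MvPolynomial.X 1 ^ 2 +
          MvPolynomial.C (d : ℚ) * MvPolynomial.X 0 * MvPolynomial.X 1 ^ 3 +
          MvPolynomial.C (e : ℚ) * MvPolynomial.X 1 ^ 4 : MvPolynomial (Fin 2) ℚ) →
      quarticDisc a b c d e < 0 →
      (N : ℤ) ≤ |quarticDisc a b c d e| →
      Finite (Quot (pmRelQuartic a b c d e)) ∧
        Nat.card (Quot (pmRelQuartic a b c d e)) ≤ 14 := by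
  set K := 72 * Real.exp 600000 with hK
  have hK0 : 0 < K := by positivity
  refine ⟨⌈18 * 16 ^ 6 + 4 * K ^ 6⌉₊ + 1, fun a b c d e hirr hneg hN => ?_⟩
  obtain ⟨p₁, q₁, p₂, q₂, A, B, ε, h, hdisc⟩ := exists_isReduction
    (Int.cast_ne_zero.1 (leadingCoeff_ne_zero_of_irreducible hirr)) hneg
  have hA0 := h.pos
  have hlarge : 18 * 16 ^ 6 + 4 * K ^ 6 < A ^ 4 * (4 * A ^ 2 - B ^ 2) := by
    rw [← hdisc]
    rw [abs_of_neg hneg] at hN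
    have h1 : ((⌈18 * 16 ^ 6 + 4 * K ^ 6⌉₊ + 1 : ℕ) : ℝ) ≤ -(quarticDisc a b c d e : ℝ) := by
      exact_mod_cast hN
    push_cast at h1
    linarith [Nat.le_ceil (18 * 16 ^ 6 + 4 * K ^ 6)]
  have hA : K ≤ A := by
    by_contra! hlt
    have h1 : A ^ 6 < K ^ 6 := by gcongr
    have h2 : 0 ≤ A ^ 4 * B ^ 2 := by positivity
    linarith
  have hcard : ∀ {ι : Type} [Fintype ι] (f : ι ↪ Quot (pmRelQuartic a b c d e)),
      Fintype.card ι ≤ 14 := fun {ι} _ f =>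
    h.card_le hirr hA (by linarith [pow_pos hK0 6]) (P := fun i => (f i).out.1)
      (fun i => (f i).out.2) fun i j hij hdet => hij <| f.injective <| by
        have : pmRelQuartic a b c d e (f i).out (f j).out :=
          eq_or_eq_neg_of_det_eq_zero (f i).out.2 (f j).out.2 hdet
        simpa only [Quot.out_eq] using Quot.sound this
  have hfin : Finite (Quot (pmRelQuartic a b c d e)) := by
    by_contra hinf
    rw [not_finite_iff_infinite] at hinf
    have := hcard (Fin.valEmbedding.trans (Infinite.natEmbedding _) : Fin 15 ↪ _)
    simp at this
  have := Fintype.ofFinite (Quot (pmRelQuartic a b c d e))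
  exact ⟨hfin, by rw [Nat.card_eq_fintype_card]; exact hcard (.refl _)⟩
end

section
/- Let a_1, a_2, a_3, a_4 ∈ ℂ and let ξ_1, ξ_2, ξ_3, ξ_4 ∈ ℂ satisfy T⁴ + a_1T³ + a_2T² + a_3T + a_4 = (T − ξ_1)(T − ξ_2)(T − ξ_3)(T − ξ_4), with ξ_1 ≠ ξ_2 and ξ_3 ≠ ξ_4. Let a, x, y, z ∈ ℂ and set α_i = a + xξ_i + yξ_i² + zξ_i³ for i = 1, 2, 3, 4. Then ((α_1 − α_2)/(ξ_1 − ξ_2)) · ((α_3 − α_4)/(ξ_3 − ξ_4)) = Q_1(x,y,z) − (ξ_1ξ_2 + ξ_3ξ_4) · Q_2(x,y,z), where Q_1(X,Y,Z) = X² − a_1XY + a_2Y² + (a_1² − 2a_2)XZ + (a_3 − a_1a_2)YZ + (−a_1a_3 + a_2² + a_4)Z² and Q_2(X,Y,Z) = Y² − XZ − a_1YZ + a_2Z². -/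
/-- Vieta's formulas for a monic quartic over a field of characteristic zero, from equality of
polynomial functions. -/
theorem vieta_quartic_of_forall_eval {K : Type*} [Field K] [CharZero K]
    {a1 a2 a3 a4 ξ1 ξ2 ξ3 ξ4 : K}
    (h : ∀ T : K, T ^ 4 + a1 * T ^ 3 + a2 * T ^ 2 + a3 * T + a4 =
      (T - ξ1) * (T - ξ2) * (T - ξ3) * (T - ξ4)) :
    a1 = -(ξ1 + ξ2 + ξ3 + ξ4) ∧
      a2 = ξ1 * ξ2 + ξ1 * ξ3 + ξ1 * ξ4 + ξ2 * ξ3 + ξ2 * ξ4 + ξ3 * ξ4 ∧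
      a3 = -(ξ1 * ξ2 * ξ3 + ξ1 * ξ2 * ξ4 + ξ1 * ξ3 * ξ4 + ξ2 * ξ3 * ξ4) ∧
      a4 = ξ1 * ξ2 * ξ3 * ξ4 := by
  have h0 := h 0
  have h1 := h 1
  have hm := h (-1)
  have h2 := h 2
  have e1 : a1 = -(ξ1 + ξ2 + ξ3 + ξ4) := by
    linear_combination (h2 - 3 * h1 - hm + 3 * h0) / 6
  refine ⟨e1, ?_, ?_, ?_⟩
  · linear_combination (h1 + hm) / 2 - h0
  · linear_combination (h1 - hm) / 2 - e1
  · linear_combination h0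

/-- The divided difference of a cubic at two distinct points. -/
theorem cubic_sub_div_sub {K : Type*} [Field K] {s t : K} (hst : s ≠ t) (a x y z : K) :
    ((a + x * s + y * s ^ 2 + z * s ^ 3) - (a + x * t + y * t ^ 2 + z * t ^ 3)) / (s - t) =
      x + y * (s + t) + z * (s ^ 2 + s * t + t ^ 2) := by
  rw [div_eq_iff (sub_ne_zero.mpr hst)]
  ring

/-- If `T⁴ + a₁T³ + a₂T² + a₃T + a₄ = (T − ξ₁)(T − ξ₂)(T − ξ₃)(T − ξ₄)` with
`ξ₁ ≠ ξ₂` and `ξ₃ ≠ ξ₄`, and `αᵢ = a + xξᵢ + yξᵢ² + zξᵢ³`, then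
`((α₁ − α₂)/(ξ₁ − ξ₂))·((α₃ − α₄)/(ξ₃ − ξ₄)) = Q₁(x,y,z) − (ξ₁ξ₂ + ξ₃ξ₄)·Q₂(x,y,z)`. -/
theorem pair_quotient_eq_Q1_sub_xi_Q2 (a1 a2 a3 a4 ξ1 ξ2 ξ3 ξ4 : ℂ)
    (h : ∀ T : ℂ, T ^ 4 + a1 * T ^ 3 + a2 * T ^ 2 + a3 * T + a4 =
      (T - ξ1) * (T - ξ2) * (T - ξ3) * (T - ξ4))
    (h12 : ξ1 ≠ ξ2) (h34 : ξ3 ≠ ξ4)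
    (a x y z : ℂ) :
    (((a + x * ξ1 + y * ξ1 ^ 2 + z * ξ1 ^ 3) - (a + x * ξ2 + y * ξ2 ^ 2 + z * ξ2 ^ 3)) /
        (ξ1 - ξ2)) *
      (((a + x * ξ3 + y * ξ3 ^ 2 + z * ξ3 ^ 3) - (a + x * ξ4 + y * ξ4 ^ 2 + z * ξ4 ^ 3)) /
        (ξ3 - ξ4)) =
    (x ^ 2 - a1 * x * y + a2 * y ^ 2 + (a1 ^ 2 - 2 * a2) * x * z +
        (a3 - a1 * a2) * y * z + (-(a1 * a3) + a2 ^ 2 + a4) * z ^ 2) -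
      (ξ1 * ξ2 + ξ3 * ξ4) * (y ^ 2 - x * z - a1 * y * z + a2 * z ^ 2) := by
  obtain ⟨rfl, rfl, rfl, rfl⟩ := vieta_quartic_of_forall_eval h
  rw [cubic_sub_div_sub h12, cubic_sub_div_sub h34]
  ring
end

section
/- Let ξ be an algebraic integer of degree 4 over ℚ with minimal polynomial T⁴ + a_1T³ + a_2T² + a_3T + a_4 ∈ ℤ[T]. Then for x, y, z ∈ ℤ, the element xξ + yξ² + zξ³ is a monogenizer of ℤ[ξ] (i.e., ℤ[xξ + yξ² + zξ³] = ℤ[ξ]) if and only if F(Q_1(x,y,z), Q_2(x,y,z)) = 1 or F(Q_1(x,y,z), Q_2(x,y,z)) = −1, where F(U,V) = U³ − a_2U²V + (a_1a_3 − 4a_4)UV² + (4a_2a_4 − a_3² − a_1²a_4)V³, Q_1(X,Y,Z) = X² − a_1XY + a_2Y² + (a_1² − 2a_2)XZ + (a_3 − a_1a_2)YZ + (−a_1a_3 + a_2² + a_4)Z², and Q_2(X,Y,Z) = Y² − XZ − a_1YZ + a_2Z². -/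
/-- The ternary quadratic form `Q₁`. -/
def Q1 (a1 a2 a3 a4 x y z : ℤ) : ℤ :=
  x ^ 2 - a1 * x * y + a2 * y ^ 2 + (a1 ^ 2 - 2 * a2) * x * z +
    (a3 - a1 * a2) * y * z + (-(a1 * a3) + a2 ^ 2 + a4) * z ^ 2

/-- The ternary quadratic form `Q₂`. -/
def Q2 (a1 a2 x y z : ℤ) : ℤ :=
  y ^ 2 - x * z - a1 * y * z + a2 * z ^ 2

/-- The binary cubic resolvent form `F`. -/
def Fcub (a1 a2 a3 a4 u v : ℤ) : ℤ :=
  u ^ 3 - a2 * u ^ 2 * v + (a1 * a3 - 4 * a4) * u * v ^ 2 +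
    (4 * a2 * a4 - a3 ^ 2 - a1 ^ 2 * a4) * v ^ 3

/-- The coordinates of `(x g + y g² + z g³) * (u₀ + u₁ g + u₂ g² + u₃ g³)` with respect to
`1, g, g², g³`, where `g⁴ + a₁ g³ + a₂ g² + a₃ g + a₄ = 0`. -/
def quarticMulCoord (a1 a2 a3 a4 x y z : ℤ) (u : Fin 4 → ℤ) : Fin 4 → ℤ :=
  let e6 := z * u 3
  let e5 := y * u 3 + z * u 2 - a1 * e6
  let e4 := x * u 3 + y * u 2 + z * u 1 - a2 * e6 - a1 * e5
  ![-a4 * e4,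
    x * u 0 - a4 * e5 - a3 * e4,
    x * u 1 + y * u 0 - a4 * e6 - a3 * e5 - a2 * e4,
    x * u 2 + y * u 1 + z * u 0 - a3 * e6 - a2 * e5 - a1 * e4]

/-- Multiplication by `x g + y g² + z g³` in coordinates. -/
theorem sum_quarticMulCoord {R : Type*} [CommRing R] {g : R} {a1 a2 a3 a4 : ℤ}
    (hg : g ^ 4 + a1 * g ^ 3 + a2 * g ^ 2 + a3 * g + a4 = 0) (x y z : ℤ) (u : Fin 4 → ℤ) :
    ∑ i, quarticMulCoord a1 a2 a3 a4 x y z u i • g ^ (i : ℕ) =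
      (x * g + y * g ^ 2 + z * g ^ 3) * ∑ i, u i • g ^ (i : ℕ) := by
  simp only [Fin.sum_univ_four, quarticMulCoord, zsmul_eq_mul, Matrix.cons_val, Fin.isValue,
    Fin.coe_ofNat_eq_mod, Nat.reduceMod]
  push_cast
  linear_combination (-(z * u 3 * g ^ 2 + (y * u 3 + z * u 2 - a1 * (z * u 3)) * g +
    (x * u 3 + y * u 2 + z * u 1 - a2 * (z * u 3) -
      a1 * (y * u 3 + z * u 2 - a1 * (z * u 3)))) : R) * hg

/-- The determinant of the first four powers of `x g + y g² + z g³` with respect to the basis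
`1, g, g², g³` is the value of the cubic resolvent form. -/
theorem det_pow_eq_Fcub {R : Type*} [CommRing R] {g : R} {a1 a2 a3 a4 : ℤ}
    (hg : g ^ 4 + a1 * g ^ 3 + a2 * g ^ 2 + a3 * g + a4 = 0)
    (b : Module.Basis (Fin 4) ℤ R) (hb : ∀ i, b i = g ^ (i : ℕ)) (x y z : ℤ) :
    b.det (fun i : Fin 4 => (x * g + y * g ^ 2 + z * g ^ 3) ^ (i : ℕ)) =
      Fcub a1 a2 a3 a4 (Q1 a1 a2 a3 a4 x y z) (Q2 a1 a2 x y z) := by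
  have hpow (n : ℕ) : b.equivFun ((x * g + y * g ^ 2 + z * g ^ 3) ^ n) =
      (quarticMulCoord a1 a2 a3 a4 x y z)^[n] ![1, 0, 0, 0] := by
    rw [← LinearEquiv.eq_symm_apply, b.equivFun_symm_apply]
    simp only [hb]
    induction n with
    | zero => simp [Fin.sum_univ_four]
    | succ n ih => rw [Function.iterate_succ_apply', sum_quarticMulCoord hg, ← ih, pow_succ']
  have hmat : b.toMatrix (fun i : Fin 4 => (x * g + y * g ^ 2 + z * g ^ 3) ^ (i : ℕ)) =
      Matrix.of fun i j : Fin 4 =>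
        (quarticMulCoord a1 a2 a3 a4 x y z)^[(j : ℕ)] ![1, 0, 0, 0] i := by
    ext i j
    rw [Matrix.of_apply, ← hpow, Module.Basis.toMatrix_apply, Module.Basis.equivFun_apply]
  rw [Module.Basis.det_apply, hmat, Matrix.det_succ_row_zero]
  simp [Fin.sum_univ_four, Matrix.det_fin_three, Fin.succAbove, quarticMulCoord, Fcub, Q1, Q2,
    Function.iterate_succ_apply']
  ring

/-- If `ℤ[ξ]` is free of rank `n`, then `α ∈ ℤ[ξ]` generates `ℤ[ξ]` exactly when the first `n`
powers of `α` form a basis. -/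
theorem adjoin_eq_iff_isUnit_det {A : Type*} [CommRing A] [IsDomain A] [CharZero A] {ξ : A}
    {n : ℕ} (b : Module.Basis (Fin n) ℤ (Algebra.adjoin ℤ ({ξ} : Set A)))
    (α : Algebra.adjoin ℤ ({ξ} : Set A)) :
    Algebra.adjoin ℤ ({(α : A)} : Set A) = Algebra.adjoin ℤ ({ξ} : Set A) ↔
      IsUnit (b.det fun i : Fin n => α ^ (i : ℕ)) := by
  rw [← Module.Basis.is_basis_iff_det]
  constructor
  · intro h
    have : Module.Finite ℤ (Algebra.adjoin ℤ ({ξ} : Set A)) := .of_basis b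
    have hα : IsIntegral ℤ (α : A) := (Algebra.IsIntegral.isIntegral (R := ℤ) α).map
      (Algebra.adjoin ℤ ({ξ} : Set A)).val
    let B := (Algebra.adjoin.powerBasis' hα).map (Subalgebra.equivOfEq _ _ h)
    have hdim : B.dim = n := by
      rw [← B.finrank, Module.finrank_eq_card_basis b, Fintype.card_fin]
    have hgen : B.gen = α := by
      apply Subtype.ext
      simp [B]
    have hB : (fun i : Fin n => α ^ (i : ℕ)) = B.basis.reindex (finCongr hdim) := by
      ext i
      simp [hgen]
    rw [hB]
    exact ⟨Module.Basis.linearIndependent _, Module.Basis.span_eq _⟩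
  · rintro ⟨-, hspan⟩
    apply le_antisymm
    · exact Algebra.adjoin_le (Set.singleton_subset_iff.2 α.2)
    · intro t ht
      have hmem : (⟨t, ht⟩ : Algebra.adjoin ℤ ({ξ} : Set A)) ∈
          Submodule.span ℤ (Set.range fun i : Fin n => α ^ (i : ℕ)) := hspan ▸ trivial
      have hle : Submodule.span ℤ (Set.range fun i : Fin n => α ^ (i : ℕ)) ≤
          ((Algebra.adjoin ℤ ({(α : A)} : Set A)).comap
            (Algebra.adjoin ℤ ({ξ} : Set A)).val).toSubmodule := by
        rw [Submodule.span_le]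
        rintro _ ⟨i, rfl⟩
        exact pow_mem (Algebra.self_mem_adjoin_singleton ℤ (α : A)) i
      exact hle hmem

/-- Let `ξ` be an algebraic integer of degree `4` with minimal polynomial
`T⁴ + a₁T³ + a₂T² + a₃T + a₄ ∈ ℤ[T]`. Then `xξ + yξ² + zξ³` is a monogenizer of
`ℤ[ξ]` if and only if `F(Q₁(x,y,z), Q₂(x,y,z)) = ±1`. -/
theorem monogenizer_iff_resolvent_eq_pm_one (ξ : ℂ) (a1 a2 a3 a4 : ℤ)
    (hint : IsIntegral ℤ ξ)
    (hmin : minpoly ℤ ξ =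
      Polynomial.X ^ 4 + Polynomial.C a1 * Polynomial.X ^ 3 +
        Polynomial.C a2 * Polynomial.X ^ 2 + Polynomial.C a3 * Polynomial.X +
        Polynomial.C a4)
    (x y z : ℤ) :
    Algebra.adjoin ℤ ({(x : ℂ) * ξ + (y : ℂ) * ξ ^ 2 + (z : ℂ) * ξ ^ 3} : Set ℂ) =
        Algebra.adjoin ℤ ({ξ} : Set ℂ) ↔
      (Fcub a1 a2 a3 a4 (Q1 a1 a2 a3 a4 x y z) (Q2 a1 a2 x y z) = 1 ∨
        Fcub a1 a2 a3 a4 (Q1 a1 a2 a3 a4 x y z) (Q2 a1 a2 x y z) = -1) := by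
  have hdim : (Algebra.adjoin.powerBasis' hint).dim = 4 := by
    rw [Algebra.adjoin.powerBasis'_dim, hmin]
    compute_degree!
  let g : Algebra.adjoin ℤ ({ξ} : Set ℂ) := ⟨ξ, Algebra.self_mem_adjoin_singleton ℤ ξ⟩
  have hg : g ^ 4 + a1 * g ^ 3 + a2 * g ^ 2 + a3 * g + a4 = 0 := by
    apply Subtype.ext
    simpa [hmin, g] using minpoly.aeval ℤ ξ
  let b := (Algebra.adjoin.powerBasis' hint).basis.reindex (finCongr hdim)
  have hb (i : Fin 4) : b i = g ^ (i : ℕ) := by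
    rw [Module.Basis.reindex_apply, PowerBasis.basis_eq_pow, Algebra.adjoin.powerBasis'_gen]
    rfl
  have h := adjoin_eq_iff_isUnit_det b (x * g + y * g ^ 2 + z * g ^ 3)
  rw [det_pow_eq_Fcub hg b hb, Int.isUnit_iff] at h
  simpa [g] using h
end

section
/- Let a_1, a_2, a_3, a_4 ∈ ℤ and let x, y, z ∈ ℤ satisfy Q_1(x,y,z) = 1 and Q_2(x,y,z) = 0, where Q_1(X,Y,Z) = X² − a_1XY + a_2Y² + (a_1² − 2a_2)XZ + (a_3 − a_1a_2)YZ + (−a_1a_3 + a_2² + a_4)Z² and Q_2(X,Y,Z) = Y² − XZ − a_1YZ + a_2Z². Then there exist integers p, q and a sign ε ∈ {1, −1} such that x = ε(p² − a_1pq + a_2q²), y = ε pq, and z = ε q². -/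
/-- A factorization of a square into coprime integers comes, up to sign, from squares. -/
theorem exists_eq_sign_mul_sq_of_isCoprime {w y z : ℤ} (hc : IsCoprime w z)
    (h : w * z = y ^ 2) :
    ∃ p q ε : ℤ, (ε = 1 ∨ ε = -1) ∧ w = ε * p ^ 2 ∧ y = ε * (p * q) ∧ z = ε * q ^ 2 := by
  obtain ⟨p, hp⟩ := Int.sq_of_isCoprime hc h
  obtain ⟨q, hq⟩ := Int.sq_of_isCoprime hc.symm ((mul_comm z w).trans h)
  have same_sign (hpq : y ^ 2 = (p * q) ^ 2) (ε : ℤ) (hε : ε = 1 ∨ ε = -1)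
      (hw : w = ε * p ^ 2) (hz : z = ε * q ^ 2) :
      ∃ p q ε : ℤ, (ε = 1 ∨ ε = -1) ∧ w = ε * p ^ 2 ∧ y = ε * (p * q) ∧ z = ε * q ^ 2 := by
    have hε' : ε * ε = 1 := by rcases hε with rfl | rfl <;> rfl
    rcases sq_eq_sq_iff_eq_or_eq_neg.mp hpq with hy | hy
    · exact ⟨ε * p, q, ε, hε, by linear_combination hw - ε * p ^ 2 * hε',
        by linear_combination hy - p * q * hε', hz⟩
    · exact ⟨-(ε * p), q, ε, hε, by linear_combination hw - ε * p ^ 2 * hε',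
        by linear_combination hy + p * q * hε', hz⟩
  have opposite_sign (hpq : y ^ 2 = -(p * q) ^ 2) : y = 0 ∧ (p = 0 ∨ q = 0) := by
    have hy : y = 0 := by nlinarith [sq_nonneg y, sq_nonneg (p * q)]
    have h0 : p * q = 0 := by nlinarith [sq_nonneg y, sq_nonneg (p * q)]
    exact ⟨hy, mul_eq_zero.mp h0⟩
  rcases hp with hp | hp <;> rcases hq with hq | hq <;> rw [hp, hq] at h
  · exact same_sign (by linear_combination -h) 1 (by simp) (by simpa) (by simpa)
  · obtain ⟨hy, rfl | rfl⟩ := opposite_sign (by linear_combination -h)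
    · exact ⟨0, q, -1, by simp, by simpa using hp, by simpa, by simpa⟩
    · exact ⟨p, 0, 1, by simp, by simpa, by simpa, by simpa using hq⟩
  · obtain ⟨hy, rfl | rfl⟩ := opposite_sign (by linear_combination -h)
    · exact ⟨0, q, 1, by simp, by simpa using hp, by simpa, by simpa⟩
    · exact ⟨p, 0, -1, by simp, by simpa, by simpa, by simpa using hq⟩
  · exact same_sign (by linear_combination -h) (-1) (by simp) (by simpa) (by simpa)

/-- On the zero locus of `Q₂`, where `y² = (x + a₁y - a₂z)z`, the equation `Q₁ = 1` forces the two
factors of `y²` to be coprime. -/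
theorem isCoprime_of_Q1_eq_one_of_Q2_eq_zero {a1 a2 a3 a4 x y z : ℤ}
    (h1 : Q1 a1 a2 a3 a4 x y z = 1) (h2 : Q2 a1 a2 x y z = 0) :
    IsCoprime (x + a1 * y - a2 * z) z := by
  unfold Q1 at h1
  unfold Q2 at h2
  refine ⟨x + a1 * y - a2 * z - 3 * a1 * y,
    (2 * a1 ^ 2 + 3 * a2) * (x + a1 * y - a2 * z) + a2 ^ 2 * z - 3 * a1 * a2 * y +
      (a1 ^ 2 - 2 * a2) * x + (a3 - a1 * a2) * y + (-(a1 * a3) + a2 ^ 2 + a4) * z, ?_⟩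
  linear_combination h1 - (2 * a1 ^ 2 + a2) * h2

/-- Integer solutions of `Q₁(x,y,z) = 1`, `Q₂(x,y,z) = 0` are parametrized, up to
sign, by `x = p² − a₁pq + a₂q²`, `y = pq`, `z = q²`. -/
theorem parametrization_of_Q1_eq_one_Q2_eq_zero (a1 a2 a3 a4 x y z : ℤ)
    (h1 : Q1 a1 a2 a3 a4 x y z = 1) (h2 : Q2 a1 a2 x y z = 0) :
    ∃ p q ε : ℤ, (ε = 1 ∨ ε = -1) ∧
      x = ε * (p ^ 2 - a1 * p * q + a2 * q ^ 2) ∧ y = ε * (p * q) ∧ z = ε * q ^ 2 := by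
  have hc := isCoprime_of_Q1_eq_one_of_Q2_eq_zero h1 h2
  unfold Q2 at h2
  obtain ⟨p, q, ε, hε, hw, hy, hz⟩ :=
    exists_eq_sign_mul_sq_of_isCoprime (y := y) hc (by linear_combination -h2)
  exact ⟨p, q, ε, hε, by linear_combination hw - a1 * hy + a2 * hz, hy, hz⟩
end

section
/- Let a_1, a_2, a_3, a_4, u_0, v_0 ∈ ℤ, and let M be the symmetric 3×3 matrix over ℚ that is the Gram matrix of the ternary quadratic form Q(X,Y,Z) = u_0·Q_2(X,Y,Z) − v_0·Q_1(X,Y,Z); explicitly, M has rows (−v_0, a_1v_0/2, (−u_0 − (a_1² − 2a_2)v_0)/2), (a_1v_0/2, u_0 − a_2v_0, (−a_1u_0 − (a_3 − a_1a_2)v_0)/2), and ((−u_0 − (a_1² − 2a_2)v_0)/2, (−a_1u_0 − (a_3 − a_1a_2)v_0)/2, a_2u_0 + (a_1a_3 − a_2² − a_4)v_0). Then 4·|det M| = |F(u_0, v_0)|, where F(U,V) = U³ − a_2U²V + (a_1a_3 − 4a_4)UV² + (4a_2a_4 − a_3² − a_1²a_4)V³. -/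
/-- The Gram matrix (over `ℚ`) of the ternary quadratic form
`Q = u₀·Q₂ − v₀·Q₁` attached to integers `a₁, a₂, a₃, a₄, u₀, v₀`. -/
def gramQ (a1 a2 a3 a4 u0 v0 : ℤ) : Matrix (Fin 3) (Fin 3) ℚ :=
  !![(-v0 : ℚ), (a1 * v0 : ℚ) / 2, ((-u0 - (a1 ^ 2 - 2 * a2) * v0 : ℤ) : ℚ) / 2;
     (a1 * v0 : ℚ) / 2, ((u0 - a2 * v0 : ℤ) : ℚ),
       ((-(a1 * u0) - (a3 - a1 * a2) * v0 : ℤ) : ℚ) / 2;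
     ((-u0 - (a1 ^ 2 - 2 * a2) * v0 : ℤ) : ℚ) / 2,
       ((-(a1 * u0) - (a3 - a1 * a2) * v0 : ℤ) : ℚ) / 2,
       ((a2 * u0 + (a1 * a3 - a2 ^ 2 - a4) * v0 : ℤ) : ℚ)]

/-- Four times the absolute value of the determinant of the Gram matrix of
`u₀·Q₂ − v₀·Q₁` equals `|F(u₀, v₀)|`, where `F` is the cubic resolvent form. -/
theorem four_det_gram_eq_abs_F (a1 a2 a3 a4 u0 v0 : ℤ) :
    4 * |(gramQ a1 a2 a3 a4 u0 v0).det| =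
      |((u0 ^ 3 - a2 * u0 ^ 2 * v0 + (a1 * a3 - 4 * a4) * u0 * v0 ^ 2 +
          (4 * a2 * a4 - a3 ^ 2 - a1 ^ 2 * a4) * v0 ^ 3 : ℤ) : ℚ)| := by
  have h : ((u0 ^ 3 - a2 * u0 ^ 2 * v0 + (a1 * a3 - 4 * a4) * u0 * v0 ^ 2 +
      (4 * a2 * a4 - a3 ^ 2 - a1 ^ 2 * a4) * v0 ^ 3 : ℤ) : ℚ) =
      -(4 * (gramQ a1 a2 a3 a4 u0 v0).det) := by
    simp only [gramQ, Matrix.det_fin_three, Matrix.of_apply, Matrix.cons_val]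
    push_cast
    ring
  rw [h, abs_neg, abs_mul, abs_of_pos (four_pos : (0 : ℚ) < 4)]
end
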